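/- arXiv:2201.02776 — 3 statements merged into one kernel-verified Lean document; each statement's English description precedes it below -/
import Mathlib

section
/- Let n ≥ 4 and let F_n^2 be the n-dimensional complex Leibniz algebra with basis e_1, …, e_n and nonzero products [e_1, e_1] = e_3 and [e_i, e_1] = e_{i+1} for 3 ≤ i ≤ n−1 (all other basis products zero). Then any (n+2)-dimensional complex solvable Leibniz algebra whose nilradical is isomorphic to F_n^2 is isomorphic to exactly one of the following two non-isomorphic algebras on basis {e_1, …, e_n, x, y}: R₁ with nonzero products [e_1,e_1]=e_3, [e_i,e_1]=e_{i+1} (3≤i≤n−1), [e_1,x]=e_1, [x,e_1]=−e_1, [e_2,y]=e_2, [y,e_2]=−e_2, [e_i,x]=(i−1)·e_i (3≤i≤n); and R₂ with nonzero products [e_1,e_1]=e_3, [e_i,e_1]=e_{i+1} (3≤i≤n−1), [e_1,x]=e_1, [x,e_1]=−e_1, [e_2,y]=e_2, [e_i,x]=(i−1)·e_i (3≤i≤n). -/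
open Module Submodule

universe u v w

/-- A bilinear bracket on `L`. -/
abbrev Bil (L : Type u) [AddCommGroup L] [Module ℂ L] : Type u := L →ₗ[ℂ] L →ₗ[ℂ] L

variable {L : Type u} [AddCommGroup L] [Module ℂ L]

/-- The (right) Leibniz identity. -/
def IsLeibniz (br : Bil L) : Prop :=
  ∀ x y z : L, br (br x y) z = br (br x z) y + br x (br y z)

/-- The span of all brackets `[S, T]`. -/
def bspan (br : Bil L) (S T : Submodule ℂ L) : Submodule ℂ L :=
  Submodule.span ℂ {z : L | ∃ x ∈ S, ∃ y ∈ T, z = br x y}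

/-- `I` is a (two-sided) ideal of the subalgebra `S`. -/
def IsIdealIn (br : Bil L) (S I : Submodule ℂ L) : Prop :=
  I ≤ S ∧ ∀ x ∈ I, ∀ y ∈ S, br x y ∈ I ∧ br y x ∈ I

/-- `I` is a (two-sided) ideal of the whole algebra. -/
abbrev IsIdeal (br : Bil L) (I : Submodule ℂ L) : Prop := IsIdealIn br ⊤ I

/-- Lower central series of the subalgebra `S`. -/
def lcs (br : Bil L) (S : Submodule ℂ L) : ℕ → Submodule ℂ L
  | 0 => S
  | n + 1 => bspan br (lcs br S n) S

/-- The subalgebra `S` is nilpotent. -/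
def IsNilpotentSub (br : Bil L) (S : Submodule ℂ L) : Prop :=
  ∃ n, lcs br S n = ⊥

/-- Derived series of the subalgebra `S`. -/
def derS (br : Bil L) (S : Submodule ℂ L) : ℕ → Submodule ℂ L
  | 0 => S
  | n + 1 => bspan br (derS br S n) (derS br S n)

/-- The subalgebra `S` is solvable. -/
def IsSolvableSub (br : Bil L) (S : Submodule ℂ L) : Prop :=
  ∃ m, derS br S m = ⊥

/-- `N` is the nilradical (maximal nilpotent ideal) of the subalgebra `S`. -/
def IsNilradicalIn (br : Bil L) (S N : Submodule ℂ L) : Prop :=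
  IsIdealIn br S N ∧ IsNilpotentSub br N ∧
    ∀ I : Submodule ℂ L, IsIdealIn br S I → IsNilpotentSub br I → I ≤ N

/-- `N` is the nilradical of the whole algebra. -/
abbrev IsNilradical (br : Bil L) (N : Submodule ℂ L) : Prop := IsNilradicalIn br ⊤ N

/-- `N² = [N, N]`. -/
abbrev sqr (br : Bil L) (N : Submodule ℂ L) : Submodule ℂ L := bspan br N N

/-- `dim (N / N²)`. -/
noncomputable def dimModSq (br : Bil L) (N : Submodule ℂ L) : ℕ :=
  finrank ℂ (↥N ⧸ (Submodule.comap N.subtype (sqr br N)))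

/-- The subalgebra `S` splits as a direct sum of two nonzero ideals. -/
def IsSplitIn (br : Bil L) (S : Submodule ℂ L) : Prop :=
  ∃ A B : Submodule ℂ L, IsIdealIn br S A ∧ IsIdealIn br S B ∧
    A ≠ ⊥ ∧ B ≠ ⊥ ∧ A ⊓ B = ⊥ ∧ A ⊔ B = S

/-- The subalgebra `S` is abelian. -/
def IsAbelianIn (br : Bil L) (S : Submodule ℂ L) : Prop :=
  ∀ x ∈ S, ∀ y ∈ S, br x y = 0

section Two
variable {L1 : Type v} {L2 : Type w} [AddCommGroup L1] [Module ℂ L1]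
  [AddCommGroup L2] [Module ℂ L2]

/-- A bracket-preserving linear isomorphism between the subalgebra `S1` of `L1` and
the subalgebra `S2` of `L2`. -/
def SubAlgIso (br1 : Bil L1) (S1 : Submodule ℂ L1) (br2 : Bil L2) (S2 : Submodule ℂ L2) :
    Prop :=
  ∃ φ : S1 →ₗ[ℂ] L2, Function.Injective φ ∧ Set.range ⇑φ = (S2 : Set L2) ∧
    ∀ x y z : S1, (z : L1) = br1 (x : L1) (y : L1) → φ z = br2 (φ x) (φ y)

/-- An isomorphism of the two algebras. -/
def AlgIso (br1 : Bil L1) (br2 : Bil L2) : Prop :=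
  ∃ φ : L1 ≃ₗ[ℂ] L2, ∀ x y : L1, φ (br1 x y) = br2 (φ x) (φ y)

end Two

/-- The multiplication table of the nilpotent algebra `Fₙ²`
(`[e_1,e_1] = e_3`, `[e_i,e_1] = e_{i+1}` for `3 ≤ i ≤ n-1`; `0`-based indices). -/
def tableF (n : ℕ) {W : Type v} [AddCommGroup W] [Module ℂ W]
    (v : Fin n → W) (i j : Fin n) : W :=
  let u : ℕ → W := fun m => if h : m < n then v ⟨m, h⟩ else 0
  if (j : ℕ) = 0 then
    (if (i : ℕ) = 0 then u 2
     else if 2 ≤ (i : ℕ) ∧ (i : ℕ) + 1 < n then u ((i : ℕ) + 1)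
     else 0)
  else 0

/-- The multiplication table of the solvable algebras `R₁` (`c = -1`) and `R₂` (`c = 0`)
on the basis `e_1, …, e_n, x, y`, written `0`-based: `e_{i+1} ↦ v i`, `x ↦ v n`,
`y ↦ v (n+1)`. -/
def table15 (n : ℕ) (c : ℂ) {W : Type v} [AddCommGroup W] [Module ℂ W]
    (v : Fin (n + 2) → W) (i j : Fin (n + 2)) : W :=
  let u : ℕ → W := fun m => if h : m < n + 2 then v ⟨m, h⟩ else 0
  if (j : ℕ) = 0 then
    (if (i : ℕ) = 0 then u 2
     else if 2 ≤ (i : ℕ) ∧ (i : ℕ) + 1 < n then u ((i : ℕ) + 1)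
     else if (i : ℕ) = n then -u 0
     else 0)
  else if (j : ℕ) = n then
    (if (i : ℕ) = 0 then u 0
     else if 2 ≤ (i : ℕ) ∧ (i : ℕ) ≤ n - 1 then ((i : ℕ) : ℂ) • u (i : ℕ)
     else 0)
  else if (j : ℕ) = n + 1 then (if (i : ℕ) = 1 then u 1 else 0)
  else if (j : ℕ) = 1 then (if (i : ℕ) = n + 1 then c • u 1 else 0)
  else 0


namespace S15

/-- Coordinate space. -/
abbrev V (m : ℕ) : Type := Fin (m + 4) → ℂ

/-- Standard basis vector. -/
noncomputable abbrev E {m : ℕ} (i : Fin (m + 4)) : V m := Pi.single i 1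

/-- The shift operator, right multiplication by `e_1`. -/
noncomputable def Sh (m : ℕ) : V m →ₗ[ℂ] V m where
  toFun a := fun i => if (i : ℕ) = 2 then a 0 else
    if 3 ≤ (i : ℕ) then a ⟨(i : ℕ) - 1, by omega⟩ else 0
  map_add' a b := by
    funext i
    simp only [Pi.add_apply]
    split_ifs <;> simp
  map_smul' c a := by
    funext i
    simp only [Pi.smul_apply, RingHom.id_apply]
    split_ifs <;> simp

lemma Sh_apply {m : ℕ} (a : V m) (i : Fin (m + 4)) :
    Sh m a i = if (i : ℕ) = 2 then a 0 else
      if 3 ≤ (i : ℕ) then a ⟨(i : ℕ) - 1, by omega⟩ else 0 := rfl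

lemma E_apply {m : ℕ} (i j : Fin (m + 4)) : (E i : V m) j = if (j : ℕ) = i then 1 else 0 := by
  simp [E, Pi.single_apply, Fin.ext_iff]

lemma v0 {m : ℕ} : ((0 : Fin (m + 4)) : ℕ) = 0 := rfl
lemma v1 {m : ℕ} : ((1 : Fin (m + 4)) : ℕ) = 1 := rfl
lemma v2 {m : ℕ} : ((2 : Fin (m + 4)) : ℕ) = 2 := rfl

lemma Sh_E0 {m : ℕ} : Sh m (E 0) = E 2 := by
  funext i
  simp only [Sh_apply, E_apply, v0, v2]
  split_ifs <;> first | rfl | omega | (simp_all <;> omega)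

lemma Sh_E1 {m : ℕ} : Sh m (E 1) = 0 := by
  funext i
  simp only [Sh_apply, E_apply, v0, v1, Pi.zero_apply]
  split_ifs <;> first | rfl | omega | (simp_all <;> omega)

lemma Sh_E {m : ℕ} (k : ℕ) (hk : 2 ≤ k) (hk' : k + 1 < m + 4) :
    Sh m (E ⟨k, by omega⟩) = E ⟨k + 1, hk'⟩ := by
  funext i
  simp only [Sh_apply, E_apply, v0]
  split_ifs <;> first | rfl | omega | (simp_all <;> omega)

lemma Sh_Elast {m : ℕ} : Sh m (E ⟨m + 3, by omega⟩) = 0 := by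
  funext i
  have := i.2
  simp only [Sh_apply, E_apply, v0, Pi.zero_apply]
  split_ifs <;> first | rfl | omega | (simp_all <;> omega)

/-- The bracket of `F` in coordinates. -/
lemma brF_eq {m : ℕ} (brF : Bil (V m))
    (h : ∀ i j : Fin (m + 4), brF (Pi.single i 1) (Pi.single j 1) =
      tableF (m + 4) (fun t => Pi.single t 1) i j) (a b : V m) :
    brF a b = b 0 • Sh m a := by
  have key : brF = ((LinearMap.proj (R := ℂ) (φ := fun _ : Fin (m+4) => ℂ) 0).smulRight
      (Sh m)).flip := by
    refine LinearMap.pi_ext' fun i => LinearMap.ext_ring ?_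
    refine LinearMap.pi_ext' fun j => LinearMap.ext_ring ?_
    simp only [LinearMap.comp_apply, LinearMap.single_apply, LinearMap.flip_apply, h]
    simp only [LinearMap.smulRight_apply, LinearMap.proj_apply, LinearMap.smul_apply]
    rw [show (Pi.single j (1:ℂ) : V m) 0 = if (j:ℕ) = 0 then 1 else 0 by
      rw [← E, E_apply, v0]; simp only [eq_comm]]
    unfold tableF
    by_cases hj : (j : ℕ) = 0
    · simp only [hj, if_true, one_smul]
      by_cases hi : (i : ℕ) = 0
      · have : i = 0 := Fin.ext hi
        subst this
        rw [← E, Sh_E0]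
        simp
        rfl
      · by_cases hi1 : (i : ℕ) = 1
        · have : i = 1 := Fin.ext hi1
          subst this
          rw [← E, Sh_E1]
          simp
        · by_cases hi2 : (i : ℕ) + 1 < m + 4
          · have := Sh_E (m := m) i (by omega) hi2
            rw [← E]
            simp only [Fin.eta] at this
            rw [this]
            simp [hi, hi2, show 2 ≤ (i:ℕ) by omega]
          · obtain rfl : i = (⟨m+3, Nat.lt_succ_self _⟩ : Fin (m+4)) := Fin.ext (by simp; omega)
            rw [← E, Sh_Elast]
            simp
    · simp [hj]
  rw [key]
  simp

/-- Diagonal entries of a derivation. -/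
noncomputable def lam (α β : ℂ) (k : ℕ) : ℂ := if k = 0 then α else if k = 1 then β else k * α

lemma lam_nat (k : ℕ) : lam 1 0 k = ((if k = 0 then 1 else if k = 1 then 0 else k : ℕ) : ℂ) := by
  unfold lam
  split_ifs <;> simp

lemma lam_inj {i j : ℕ} (h : lam 1 0 i = lam 1 0 j) : i = j := by
  rw [lam_nat, lam_nat, Nat.cast_inj] at h
  split_ifs at h <;> omega

section Der
variable {m : ℕ} (D : V m →ₗ[ℂ] V m)

lemma der_S
    (hD : ∀ a b : V m, D (b 0 • Sh m a) = b 0 • Sh m (D a) + (D b) 0 • Sh m a) (a : V m) : D (Sh m a) = Sh m (D a) + (D (E 0)) 0 • Sh m a := by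
  have := hD a (E 0)
  simpa using this

lemma der_0
    (hD : ∀ a b : V m, D (b 0 • Sh m a) = b 0 • Sh m (D a) + (D b) 0 • Sh m a) (b : V m) : (D b) 0 = b 0 * (D (E 0)) 0 := by
  have h1 := hD (E 0) b
  rw [map_smul, der_S D hD, smul_add, Sh_E0] at h1
  have h2 := congrFun (add_left_cancel h1) 2
  simpa using h2.symm

lemma der_ker
    (hD : ∀ a b : V m, D (b 0 • Sh m a) = b 0 • Sh m (D a) + (D b) 0 • Sh m a) : Sh m (D (E 1)) = 0 := by
  have := der_S D hD (E 1)
  simpa [Sh_E1] using this.symm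

lemma der_E1
    (hD : ∀ a b : V m, D (b 0 • Sh m a) = b 0 • Sh m (D a) + (D b) 0 • Sh m a) (j : Fin (m + 4)) (h1 : (j : ℕ) ≠ 1) (h2 : (j : ℕ) ≠ m + 3) : D (E 1) j = 0 := by
  have h := der_ker D hD
  by_cases hj : (j : ℕ) = 0
  · have : j = 0 := Fin.ext hj
    subst this
    have := congrFun h 2
    simpa [Sh_apply] using this
  · have := congrFun h ⟨j + 1, by omega⟩
    rw [Sh_apply] at this
    simp only [Pi.zero_apply] at this
    rw [if_neg (by omega), if_pos (by omega)] at this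
    simpa using this

lemma der_tri
    (hD : ∀ a b : V m, D (b 0 • Sh m a) = b 0 • Sh m (D a) + (D b) 0 • Sh m a) (k : ℕ) (hk : k < m + 4) (j : Fin (m + 4)) (hj : (j : ℕ) ≤ k) :
    D (E ⟨k, hk⟩) j = if (j : ℕ) = k then lam ((D (E 0)) 0) ((D (E 1)) 1) k else 0 := by
  induction k generalizing j with
  | zero =>
    have : j = 0 := Fin.ext (by simpa using hj)
    subst this
    simp [lam]
  | succ k ih =>
    rcases Nat.lt_or_ge k 2 with h | h
    · interval_cases k
      · by_cases h1 : (j : ℕ) = 1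
        · have : j = 1 := Fin.ext h1
          subst this
          simp [lam]
        · have := der_E1 D hD j h1 (by omega)
          simpa [h1] using this
      · have e : (E ⟨1 + 1, hk⟩ : V m) = Sh m (E 0) := by rw [Sh_E0]; rfl
        rw [e, der_S D hD, Sh_E0]
        simp only [Pi.add_apply, Pi.smul_apply, smul_eq_mul, Sh_apply, E_apply, v2]
        by_cases h2 : (j : ℕ) = 2
        · simp [h2, lam]; ring
        · simp [h2, show ¬ 3 ≤ (j:ℕ) by omega]
    · rw [← Sh_E k h hk, der_S D hD, Sh_E k h hk]
      simp only [Pi.add_apply, Pi.smul_apply, smul_eq_mul, Sh_apply, E_apply]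
      by_cases h2 : (j : ℕ) = 2
      · rw [if_pos h2, ih _ _ (by simp), v0]
        simp [h2, show ¬ 0 = k by omega, show ¬ 2 = k + 1 by omega]
      · by_cases h3 : 3 ≤ (j : ℕ)
        · rw [if_neg h2, if_pos h3, ih (by omega) _ (by simp; omega)]
          by_cases h4 : (j : ℕ) = k + 1
          · simp [h4, lam, show ¬ k = 0 by omega, show ¬ k = 1 by omega]; ring
          · simp [h4, show ¬ (j:ℕ) - 1 = k by omega]
        · simp [h2, h3, show ¬ (j:ℕ) = k + 1 by omega]

lemma der_app
    (hD : ∀ a b : V m, D (b 0 • Sh m a) = b 0 • Sh m (D a) + (D b) 0 • Sh m a) (a : V m) (j : Fin (m + 4)) (ha : ∀ i : Fin (m + 4), (i : ℕ) < j → a i = 0) :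
    D a j = lam ((D (E 0)) 0) ((D (E 1)) 1) j * a j := by
  rw [LinearMap.pi_apply_eq_sum_univ D a, Finset.sum_apply, Finset.sum_eq_single j]
  · have := der_tri D hD j j.2 j le_rfl
    simp only [if_true] at this
    have e : (fun k => if j = k then (1:ℂ) else 0) = E j := by
      funext k; simp [E, Pi.single_apply, eq_comm]
    rw [e, Pi.smul_apply, smul_eq_mul, this, mul_comm]
  · intro i _ hij
    have e : (fun k => if i = k then (1:ℂ) else 0) = E i := by
      funext k; simp [E, Pi.single_apply, eq_comm]
    rw [e, Pi.smul_apply, smul_eq_mul]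
    rcases Nat.lt_or_ge i j with h | h
    · rw [ha i h, zero_mul]
    · have := der_tri D hD i i.2 j h
      rw [if_neg (fun h => hij (Fin.ext h.symm))] at this
      rw [this, mul_zero]
  · simp

/-- Diagonalization of a derivation with eigenvalues `1, 0`. -/
lemma der_diag
    (hD : ∀ a b : V m, D (b 0 • Sh m a) = b 0 • Sh m (D a) + (D b) 0 • Sh m a) (h0 : (D (E 0)) 0 = 1) (h1 : (D (E 1)) 1 = 0) :
    ∃ T : V m →ₗ[ℂ] V m, Function.Injective T ∧ (∀ b, (T b) 0 = b 0) ∧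
      (∀ a, T (Sh m a) = Sh m (T a)) ∧ ∀ i, D (T (E i)) = lam 1 0 i • T (E i) := by
  -- eigenvector for eigenvalue 1
  obtain ⟨f, hf, hDf⟩ : ∃ f : V m, f 0 = 1 ∧ D f = f := by
    have hns : ¬ Function.Surjective ((D - LinearMap.id : V m →ₗ[ℂ] V m)) := by
      intro hs
      obtain ⟨a, ha⟩ := hs (E 0)
      have := congrFun ha 0
      simp [der_0 D hD a, h0] at this
    have hni : ¬ Function.Injective (D - LinearMap.id : V m →ₗ[ℂ] V m) :=
      fun h => hns (LinearMap.injective_iff_surjective.1 h)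
    rw [← LinearMap.ker_eq_bot , Submodule.eq_bot_iff] at hni
    push Not at hni
    obtain ⟨f, hf, hf0⟩ := hni
    have hDf : D f = f := by
      simpa [sub_eq_zero] using hf
    have hne : f 0 ≠ 0 := by
      intro h00
      apply hf0
      have : ∀ k (hk : k < m + 4), f ⟨k, hk⟩ = 0 := by
        intro k
        induction k using Nat.strong_induction_on with
        | _ k ih =>
          intro hk
          by_cases hk0 : k = 0
          · subst hk0; exact h00
          have := der_app D hD f ⟨k, hk⟩ (fun i hi => ih i hi i.2)
          rw [hDf, h0, h1] at this
          have hl : lam 1 0 k ≠ 1 := by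
            unfold lam
            rw [if_neg hk0]
            split_ifs with hh
            · simp
            · simp [hh]
          by_contra hne
          apply hl
          have := mul_right_cancel₀ hne ((one_mul _).trans this)
          exact this.symm
      funext i
      exact this i i.2
    refine ⟨(f 0)⁻¹ • f, by simp [hne], by rw [map_smul, hDf]⟩
  -- eigenvector for eigenvalue 0
  obtain ⟨g, hg0, hg1, hgS, hDg⟩ : ∃ g : V m, g 0 = 0 ∧ g 1 = 1 ∧ Sh m g = 0 ∧ D g = 0 := by
    have hlast : D (E ⟨m+3, by omega⟩) = ((m : ℂ) + 3) • E ⟨m+3, by omega⟩ := by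
      funext j
      rw [der_tri D hD (m+3) (by omega) j (by omega), Pi.smul_apply, E_apply]
      simp [lam, h0]
    have hE1 : D (E 1) = D (E 1) ⟨m+3, by omega⟩ • E ⟨m+3, by omega⟩ := by
      funext j
      rw [Pi.smul_apply, E_apply]
      by_cases hj : (j : ℕ) = 1
      · have : j = 1 := Fin.ext hj
        subst this
        simp [h1]
      · by_cases hj' : (j : ℕ) = m + 3
        · obtain rfl : j = (⟨m+3, Nat.lt_succ_self _⟩ : Fin (m+4)) := Fin.ext hj'
          simp
        · rw [der_E1 D hD j hj hj']
          simp [hj']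
    have hm : (m : ℂ) + 3 ≠ 0 := by exact_mod_cast (by omega : m + 3 ≠ 0)
    refine ⟨E 1 - (D (E 1) ⟨m+3, by omega⟩ / ((m:ℂ) + 3)) • E ⟨m+3, by omega⟩, ?_, ?_, ?_, ?_⟩
    · simp only [Pi.sub_apply, Pi.smul_apply, E_apply, v0, v1]; simp
    · simp only [Pi.sub_apply, Pi.smul_apply, E_apply, v0, v1]; simp
    · rw [map_sub, map_smul, Sh_E1, Sh_Elast]; simp
    · rw [map_sub, map_smul, hlast, hE1, smul_smul]
      simp [hm]
  -- powers
  have hp : ∀ k (i : Fin (m + 4)), (i : ℕ) < k + 2 → ((Sh m ^ (k+1)) f) i = 0 := by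
    intro k
    induction k with
    | zero =>
      intro i hi
      rw [zero_add, pow_one, Sh_apply, if_neg (by omega), if_neg (by omega)]
    | succ k ih =>
      intro i hi
      rw [pow_succ', Module.End.mul_apply, Sh_apply]
      split_ifs
      · exact ih _ (by simp)
      · exact ih _ (by simp; omega)
      · rfl
  have hp1 : ∀ k (hk : k + 2 < m + 4), ((Sh m ^ (k+1)) f) ⟨k+2, hk⟩ = 1 := by
    intro k
    induction k with
    | zero =>
      intro hk
      rw [zero_add, pow_one, Sh_apply, if_pos rfl, hf]
    | succ k ih =>
      intro hk
      rw [pow_succ', Module.End.mul_apply, Sh_apply, if_neg (by simp), if_pos (by simp)]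
      exact ih (by omega)
  have hpD : ∀ k : ℕ, D ((Sh m ^ k) f) = ((k : ℂ) + 1) • (Sh m ^ k) f := by
    intro k
    induction k with
    | zero => simp [hDf]
    | succ k ih =>
      rw [pow_succ', Module.End.mul_apply, der_S D hD, ih, h0, map_smul, ← add_smul]
      push_cast
      rfl
  let t : Fin (m + 4) → V m := fun i =>
    if (i : ℕ) = 0 then f else if (i : ℕ) = 1 then g else (Sh m ^ ((i : ℕ) - 1)) f
  have ht0 : t 0 = f := by simp [t]
  have ht1 : t 1 = g := by simp [t]
  have htk : ∀ k (hk : k + 2 < m + 4), t ⟨k + 2, hk⟩ = (Sh m ^ (k+1)) f := by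
    intro k hk; simp [t]
  have cases3 : ∀ i : Fin (m + 4), i = 0 ∨ i = 1 ∨ ∃ k, ∃ hk : k + 2 < m + 4, i = ⟨k+2, hk⟩ := by
    intro i
    by_cases hi : (i : ℕ) = 0
    · exact Or.inl (Fin.ext hi)
    by_cases hi1 : (i : ℕ) = 1
    · exact Or.inr (Or.inl (Fin.ext hi1))
    · exact Or.inr (Or.inr ⟨i - 2, by omega, Fin.ext (by simp; omega)⟩)
  let T : V m →ₗ[ℂ] V m := (Pi.basisFun ℂ (Fin (m + 4))).constr ℂ t
  have hT : ∀ i, T (E i) = t i := by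
    intro i
    have := (Pi.basisFun ℂ (Fin (m + 4))).constr_basis ℂ t i
    rwa [Pi.basisFun_apply] at this
  have hev : ∀ i, D (t i) = lam 1 0 i • t i := by
    intro i
    rcases cases3 i with rfl | rfl | ⟨k, hk, rfl⟩
    · rw [ht0, hDf]; simp [lam]
    · rw [ht1, hDg]; simp [lam]
    · rw [htk, hpD]; simp [lam]; congr 1; ring
  refine ⟨T, ?_, ?_, ?_, ?_⟩
  · have hli : LinearIndependent ℂ t := by
      refine Module.End.eigenvectors_linearIndependent' D (fun i : Fin (m+4) => lam 1 0 i) ?_ t ?_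
      · intro i j hij
        exact Fin.ext (lam_inj hij)
      · intro i
        refine ⟨Module.End.mem_eigenspace_iff.2 (hev i), ?_⟩
        rcases cases3 i with rfl | rfl | ⟨k, hk, rfl⟩
        · rw [ht0]; rintro rfl; simp at hf
        · rw [ht1]; rintro rfl; simp at hg1
        · rw [htk]; intro h
          have := hp1 k hk
          rw [h] at this; simp at this
    have hTc : ∀ a, T a = Fintype.linearCombination ℂ t a := by
      intro a
      rw [Fintype.linearCombination_apply]
      simp [T, Module.Basis.constr_apply_fintype]
    rw [linearIndependent_iff_injective_fintypeLinearCombination] at hli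
    intro a b hab
    rw [hTc, hTc] at hab
    exact hli hab
  · intro b
    have : (LinearMap.proj 0 : V m →ₗ[ℂ] ℂ) ∘ₗ T = LinearMap.proj 0 := by
      refine LinearMap.pi_ext' fun i => LinearMap.ext_ring ?_
      simp only [LinearMap.comp_apply, LinearMap.single_apply, LinearMap.proj_apply]
      rw [← E, hT]
      rcases cases3 i with rfl | rfl | ⟨k, hk, rfl⟩
      · rw [ht0, hf]; simp
      · rw [ht1, hg0, E_apply]; simp
      · rw [htk, hp k 0 (by simp), E_apply]; simp
    exact LinearMap.congr_fun this b
  · intro a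
    have : T ∘ₗ Sh m = Sh m ∘ₗ T := by
      refine LinearMap.pi_ext' fun i => LinearMap.ext_ring ?_
      simp only [LinearMap.comp_apply, LinearMap.single_apply]
      rw [← E, hT]
      rcases cases3 i with rfl | rfl | ⟨k, hk, rfl⟩
      · rw [Sh_E0, hT, ht0]
        have := htk 0 (by omega)
        exact (this.trans (by simp))
      · rw [Sh_E1, ht1, hgS, map_zero]
      · rw [htk, ← Module.End.mul_apply (Sh m), ← pow_succ']
        by_cases hk' : k + 3 < m + 4
        · rw [Sh_E (k+2) (by omega) hk', hT, htk (k+1) hk']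
        · have : (⟨k+2, hk⟩ : Fin (m+4)) = ⟨m+3, by omega⟩ := Fin.ext (by simp; omega)
          rw [this, Sh_Elast, map_zero]
          funext i
          rw [hp (k+1) i (by omega)]
          rfl
    exact LinearMap.congr_fun this a
  · intro i
    rw [hT]
    exact hev i

end Der

/-- A coordinate frame for the nilradical. -/
structure Frame {m : ℕ} (br : Bil L) (φ : V m →ₗ[ℂ] L) (g : L →ₗ[ℂ] V m)
    (N : Submodule ℂ L) : Prop where
  leib : IsLeibniz br
  gφ : ∀ a, g (φ a) = a
  rng : ∀ z, z ∈ N ↔ φ (g z) = z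
  hom : ∀ a b, br (φ a) (φ b) = φ (b 0 • Sh m a)
  idl : ∀ z ∈ N, ∀ w, br z w ∈ N ∧ br w z ∈ N

/-- Right multiplication in coordinates. -/
def Dm {m : ℕ} (br : Bil L) (φ : V m →ₗ[ℂ] L) (g : L →ₗ[ℂ] V m) (x : L) : V m →ₗ[ℂ] V m :=
  g ∘ₗ (br.flip x) ∘ₗ φ

lemma Dm_apply {m : ℕ} (br : Bil L) (φ : V m →ₗ[ℂ] L) (g : L →ₗ[ℂ] V m) (x : L) (a : V m) :
    Dm br φ g x a = g (br (φ a) x) := rfl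

/-- The two weights. -/
noncomputable def psi {m : ℕ} (br : Bil L) (φ : V m →ₗ[ℂ] L) (g : L →ₗ[ℂ] V m) : L →ₗ[ℂ] ℂ × ℂ :=
  LinearMap.prod ((LinearMap.proj 0 : V m →ₗ[ℂ] ℂ) ∘ₗ g ∘ₗ br (φ (E 0)))
    ((LinearMap.proj 1 : V m →ₗ[ℂ] ℂ) ∘ₗ g ∘ₗ br (φ (E 1)))

lemma psi_apply {m : ℕ} (br : Bil L) (φ : V m →ₗ[ℂ] L) (g : L →ₗ[ℂ] V m) (x : L) :
    psi br φ g x = (Dm br φ g x (E 0) 0, Dm br φ g x (E 1) 1) := rfl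

namespace Frame
variable {m : ℕ} {br : Bil L} {φ : V m →ₗ[ℂ] L} {g : L →ₗ[ℂ] V m} {N : Submodule ℂ L}

lemma memN (F : Frame br φ g N) (a : V m) : φ a ∈ N := by
  rw [F.rng, F.gφ]

lemma inj (F : Frame br φ g N) {a b : V m} (h : φ a = φ b) : a = b := by
  rw [← F.gφ a, h, F.gφ]

lemma ex (F : Frame br φ g N) {z : L} (h : z ∈ N) : ∃ a, z = φ a :=
  ⟨g z, ((F.rng z).1 h).symm⟩

lemma φD (F : Frame br φ g N) (x : L) (a : V m) : φ (Dm br φ g x a) = br (φ a) x := by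
  rw [Dm_apply]
  exact (F.rng _).1 (F.idl _ (F.memN a) x).1

lemma der (F : Frame br φ g N) (x : L) (a b : V m) :
    Dm br φ g x (b 0 • Sh m a) = b 0 • Sh m (Dm br φ g x a) + (Dm br φ g x b) 0 • Sh m a := by
  apply F.inj
  rw [F.φD, ← F.hom, F.leib, ← F.φD x a, ← F.φD x b, F.hom, F.hom, map_add]

lemma comm (F : Frame br φ g N) (x y : L) (a : V m) :
    Dm br φ g (br x y) a = Dm br φ g y (Dm br φ g x a) - Dm br φ g x (Dm br φ g y a) := by
  apply F.inj
  rw [map_sub, F.φD, F.φD, F.φD, F.φD, F.φD, F.leib (φ a) x y]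
  abel

lemma DN (F : Frame br φ g N) (b a : V m) : Dm br φ g (φ b) a = b 0 • Sh m a := by
  apply F.inj
  rw [F.φD, F.hom]

lemma psi_N (F : Frame br φ g N) (b : V m) : psi br φ g (φ b) = 0 := by
  rw [psi_apply, F.DN, F.DN, Sh_E1, Sh_E0, Pi.smul_apply, E_apply, v0, v2]
  simp

lemma psi_br (F : Frame br φ g N) (x y : L) : psi br φ g (br x y) = 0 := by
  rw [psi_apply, F.comm, F.comm]
  have h1 : ∀ x y, Dm br φ g y (Dm br φ g x (E 1)) 1
      = Dm br φ g x (E 1) 1 * Dm br φ g y (E 1) 1 := by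
    intro x y
    rw [der_app _ (F.der y)]
    · simp [lam, mul_comm]
    · intro i hi
      exact der_E1 _ (F.der x) i (by simp at hi; simp [hi]) (by simp at hi; simp [hi])
  rw [Pi.sub_apply, Pi.sub_apply, h1 x y, h1 y x, der_0 _ (F.der y) (Dm br φ g x (E 0)), der_0 _ (F.der x) (Dm br φ g y (E 0))]
  ext <;> simp <;> ring

lemma nil (F : Frame br φ g N) (M : Submodule ℂ L)
    (hK : ∀ x ∈ M, psi br φ g x = 0) (hM : ∀ x ∈ M, ∀ y ∈ M, br x y ∈ N) :
    IsNilpotentSub br M := by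
  have key : ∀ k, ∀ z ∈ lcs br M (k+1), φ (g z) = z ∧ ∀ j : Fin (m+4), (j : ℕ) < k → g z j = 0 := by
    intro k
    induction k with
    | zero =>
      intro z hz
      refine ⟨?_, by simp⟩
      rw [← F.rng]
      have : lcs br M (0+1) ≤ N := by
        refine Submodule.span_le.2 ?_
        rintro _ ⟨x, hx, y, hy, rfl⟩
        exact hM x hx y hy
      exact this hz
    | succ k ih =>
      intro z hz
      change z ∈ Submodule.span ℂ _ at hz
      induction hz using Submodule.span_induction with
      | mem z hz =>
        obtain ⟨w, hw, x, hx, rfl⟩ := hz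
        obtain ⟨h1, h2⟩ := ih w hw
        have e : br w x = φ (Dm br φ g x (g w)) := by rw [F.φD, h1]
        rw [e, F.gφ]
        refine ⟨rfl, fun j hj => ?_⟩
        rw [der_app _ (F.der x) _ _ (fun i hi => h2 i (by omega))]
        have := hK x hx
        rw [psi_apply, Prod.mk_eq_zero] at this
        rw [this.1, this.2]
        simp [lam]
      | zero => simp
      | add a b _ _ ha hb =>
        refine ⟨by rw [map_add, map_add, ha.1, hb.1], fun j hj => ?_⟩
        rw [map_add, Pi.add_apply, ha.2 j hj, hb.2 j hj, add_zero]
      | smul c a _ ha =>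
        refine ⟨by rw [map_smul, map_smul, ha.1], fun j hj => ?_⟩
        rw [map_smul, Pi.smul_apply, ha.2 j hj, smul_zero]
  refine ⟨m + 4 + 1, ?_⟩
  rw [Submodule.eq_bot_iff]
  intro z hz
  obtain ⟨h1, h2⟩ := key _ z hz
  have : g z = 0 := funext fun j => h2 j j.2
  rw [← h1, this, map_zero]

lemma finrankN (F : Frame br φ g N) : finrank ℂ N = m + 4 := by
  have : N = LinearMap.range φ := by
    ext z
    rw [F.rng]
    exact ⟨fun h => ⟨_, h⟩, by rintro ⟨a, rfl⟩; rw [F.gφ]⟩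
  rw [this, LinearMap.finrank_range_of_inj (fun a b h => F.inj h)]
  simp

lemma LL [FiniteDimensional ℂ L] (F : Frame br φ g N) (hN : IsNilradical br N)
    (hs : IsSolvableSub br (⊤ : Submodule ℂ L)) (hd : finrank ℂ L = m + 4 + 2) (x y : L) :
    br x y ∈ N := by
  set M := bspan br ⊤ ⊤ ⊔ N with hMdef
  have hbM : ∀ x y, br x y ∈ M := fun x y =>
    Submodule.mem_sup_left (Submodule.subset_span ⟨x, trivial, y, trivial, rfl⟩)
  have hne : M ≠ ⊤ := by
    intro hM
    have : ∀ k, derS br (⊤ : Submodule ℂ L) k ⊔ N = ⊤ := by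
      intro k
      induction k with
      | zero => simp [derS]
      | succ k ih =>
        rw [eq_top_iff]
        refine hM.symm.le.trans ?_
        refine sup_le (Submodule.span_le.2 ?_) le_sup_right
        rintro _ ⟨a, -, b, -, rfl⟩
        have ha : a ∈ derS br (⊤ : Submodule ℂ L) k ⊔ N := by rw [ih]; trivial
        have hb : b ∈ derS br (⊤ : Submodule ℂ L) k ⊔ N := by rw [ih]; trivial
        obtain ⟨a1, ha1, a2, ha2, rfl⟩ := Submodule.mem_sup.1 ha
        obtain ⟨b1, hb1, b2, hb2, rfl⟩ := Submodule.mem_sup.1 hb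
        have : br (a1 + a2) (b1 + b2) = br a1 b1 + (br a1 b2 + br a2 (b1 + b2)) := by
          simp only [map_add, LinearMap.add_apply]; abel
        rw [this]
        refine Submodule.add_mem_sup (Submodule.subset_span ⟨a1, ha1, b1, hb1, rfl⟩) ?_
        exact N.add_mem (F.idl _ hb2 _).2 (F.idl _ ha2 _).1
    obtain ⟨k, hk⟩ := hs
    have h := this k
    rw [hk, bot_sup_eq] at h
    have h2 := F.finrankN
    rw [h, finrank_top] at h2
    omega
  have hMN : M ≤ N := by
    by_contra hcon
    obtain ⟨z, hzM, hzN⟩ := SetLike.not_le_iff_exists.1 hcon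
    have hlt : finrank ℂ M < m + 4 + 2 := by
      rw [← hd]
      exact Submodule.finrank_lt hne
    have hle : N ⊔ Submodule.span ℂ {z} ≤ M :=
      sup_le le_sup_right ((Submodule.span_singleton_le_iff_mem _ _).2 hzM)
    have hlt2 : N < N ⊔ Submodule.span ℂ {z} := by
      refine lt_of_le_of_ne le_sup_left fun h => hzN ?_
      rw [h]
      exact Submodule.mem_sup_right (Submodule.mem_span_singleton_self z)
    have h3 := Submodule.finrank_lt_finrank_of_lt hlt2
    rw [F.finrankN] at h3
    have heq : N ⊔ Submodule.span ℂ {z} = M :=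
      Submodule.eq_of_le_of_finrank_le hle (by omega)
    have hdec : ∀ w ∈ M, ∃ a ∈ N, ∃ c : ℂ, w = a + c • z := by
      intro w hw
      rw [← heq] at hw
      obtain ⟨a, ha, b, hb, rfl⟩ := Submodule.mem_sup.1 hw
      obtain ⟨c, rfl⟩ := Submodule.mem_span_singleton.1 hb
      exact ⟨a, ha, c, rfl⟩
    have hzz : br z z ∈ N := by
      obtain ⟨a, ha, c, hc⟩ := hdec _ (hbM z z)
      have h0 : br z (br z z) = 0 := by
        have := F.leib z z z
        exact left_eq_add.1 this
      by_cases hc0 : c = 0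
      · rw [hc, hc0, zero_smul, add_zero]; exact ha
      · have h1 : c • br z z = - br z a := by
          have h5 : br z (a + c • z) = 0 := by rw [← hc]; exact h0
          rw [map_add, map_smul] at h5
          exact eq_neg_of_add_eq_zero_right h5
        have h2 : c • br z z ∈ N := by
          rw [h1]
          exact N.neg_mem (F.idl _ ha _).2
        exact (Submodule.smul_mem_iff _ hc0).1 h2
    refine hzN (hN.2.2 M ⟨le_top, fun x _ y _ => ⟨hbM _ _, hbM _ _⟩⟩ (F.nil M ?_ ?_) hzM)
    · intro x hx
      have : M ≤ LinearMap.ker (psi br φ g) := by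
        refine sup_le (Submodule.span_le.2 ?_) ?_
        · rintro _ ⟨a, -, b, -, rfl⟩
          exact F.psi_br a b
        · intro w hw
          obtain ⟨a, rfl⟩ := F.ex hw
          exact F.psi_N a
      exact this hx
    · intro x hx y hy
      obtain ⟨a, ha, c, rfl⟩ := hdec x hx
      obtain ⟨b, hb, d, rfl⟩ := hdec y hy
      have : br (a + c • z) (b + d • z) = br a (b + d • z) + (c • br z b + c • d • br z z) := by
        simp only [map_add, map_smul, LinearMap.add_apply, LinearMap.smul_apply, smul_add]
        rw [smul_comm d c]; abel
      rw [this]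
      exact N.add_mem (F.idl _ ha _).1 (N.add_mem (N.smul_mem _ (F.idl _ hb _).2)
        (N.smul_mem _ (N.smul_mem _ hzz)))
  exact hMN (hbM x y)

lemma ker_psi (F : Frame br φ g N) (hN : IsNilradical br N) (hLL : ∀ x y, br x y ∈ N) (x : L)
    (hx : psi br φ g x = 0) : x ∈ N := by
  have hb : ∀ x y, br x y ∈ LinearMap.ker (psi br φ g) := fun x y => F.psi_br x y
  exact hN.2.2 (LinearMap.ker (psi br φ g)) ⟨le_top, fun x _ y _ => ⟨hb _ _, hb _ _⟩⟩
    (F.nil _ (fun x hx => hx) (fun x _ y _ => hLL x y)) hx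

lemma psi_surj [FiniteDimensional ℂ L] (F : Frame br φ g N) (hN : IsNilradical br N)
    (hLL : ∀ x y, br x y ∈ N) (hd : finrank ℂ L = m + 4 + 2) :
    Function.Surjective (psi br φ g) := by
  have hk : LinearMap.ker (psi br φ g) = N := by
    apply le_antisymm
    · exact fun x hx => F.ker_psi hN hLL x hx
    · intro w hw
      obtain ⟨a, rfl⟩ := F.ex hw
      exact F.psi_N a
  have h := LinearMap.finrank_range_add_finrank_ker (psi br φ g)
  rw [hk, F.finrankN, hd] at h
  rw [← LinearMap.range_eq_top]
  apply Submodule.eq_top_of_finrank_eq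
  rw [Module.finrank_prod, Module.finrank_self]
  omega

end Frame

/-- Diagonal action of `x`. -/
noncomputable def Lm (m : ℕ) : V m →ₗ[ℂ] V m :=
  LinearMap.pi fun i : Fin (m + 4) => lam 1 0 i • (LinearMap.proj i : V m →ₗ[ℂ] ℂ)

/-- Diagonal action of `y`. -/
noncomputable def Pm (m : ℕ) : V m →ₗ[ℂ] V m :=
  (LinearMap.proj 1 : V m →ₗ[ℂ] ℂ).smulRight (E 1)

lemma Lm_apply {m : ℕ} (a : V m) (i : Fin (m + 4)) : Lm m a i = lam 1 0 i * a i := rfl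

lemma Pm_apply {m : ℕ} (a : V m) : Pm m a = a 1 • E 1 := rfl

lemma Pm_zero {m : ℕ} {a : V m} (h : a 1 = 0) : Pm m a = 0 := by rw [Pm_apply, h, zero_smul]

lemma Lm_E {m : ℕ} (k : Fin (m + 4)) : Lm m (E k) = lam 1 0 k • E k := by
  funext i
  rw [Lm_apply, Pi.smul_apply, E_apply, smul_eq_mul]
  by_cases h : (i : ℕ) = k
  · rw [h]
  · simp [h]

lemma Lm_E0 {m : ℕ} : Lm m (E 0) = E 0 := by rw [Lm_E]; simp [lam]

lemma Lm_E1 {m : ℕ} : Lm m (E 1) = 0 := by rw [Lm_E]; simp [lam]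

lemma Lm_eig {m : ℕ} {a : V m} (k : Fin (m + 4)) (h : Lm m a = lam 1 0 k • a) :
    a = a k • E k := by
  funext i
  have := congrFun h i
  rw [Lm_apply, Pi.smul_apply, smul_eq_mul] at this
  rw [Pi.smul_apply, E_apply, smul_eq_mul]
  by_cases hi : (i : ℕ) = k
  · rw [Fin.ext hi]; simp
  · rw [if_neg hi, mul_zero]
    by_contra hne
    exact hi (lam_inj (mul_right_cancel₀ hne this))

lemma Lm_eig1 {m : ℕ} {a : V m} (h : Lm m a = a) : a = a 0 • E 0 :=
  Lm_eig 0 (by rw [h]; simp [lam])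

lemma Lm_eig0 {m : ℕ} {a : V m} (h : Lm m a = 0) : a = a 1 • E 1 :=
  Lm_eig 1 (by rw [h]; simp [lam])

lemma Lm_solve {m : ℕ} {u : V m} (h0 : u 0 = 0) (h1 : u 1 = 0) :
    ∃ w : V m, w 0 = 0 ∧ w 1 = 0 ∧ Lm m w = u := by
  refine ⟨fun i => u i / (i : ℕ), by simp, by simp [h1], ?_⟩
  funext i
  rw [Lm_apply]
  by_cases hi0 : (i : ℕ) = 0
  · obtain rfl : i = 0 := Fin.ext hi0
    simp [h0]
  by_cases hi1 : (i : ℕ) = 1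
  · obtain rfl : i = 1 := Fin.ext hi1
    simp [h1]
  · have : ((i : ℕ) : ℂ) ≠ 0 := by exact_mod_cast hi0
    simp only [lam, hi0, hi1, if_false, mul_one]
    field_simp

/-- `x` and `y` act diagonally on the nilradical. -/
structure Good {m : ℕ} (br : Bil L) (φ : V m →ₗ[ℂ] L) (x y : L) : Prop where
  hx : ∀ a, br (φ a) x = φ (Lm m a)
  hy : ∀ a, br (φ a) y = φ (Pm m a)

namespace Frame
variable {m : ℕ} {br : Bil L} {φ : V m →ₗ[ℂ] L} {g : L →ₗ[ℂ] V m} {N : Submodule ℂ L}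

lemma ann_swap (F : Frame br φ g N) (c a b : L) : br c (br a b) = - br c (br b a) := by
  have h1 := F.leib c a b
  have h2 := F.leib c b a
  rw [h2] at h1
  rw [eq_neg_iff_add_eq_zero]
  have : br (br c a) b + (br c (br b a) + br c (br a b)) = br (br c a) b + 0 := by
    rw [add_zero, ← add_assoc]; exact h1.symm
  rw [add_comm]
  exact add_left_cancel this

lemma ann_sq (F : Frame br φ g N) (c a : L) : br c (br a a) = 0 := by
  have h1 := F.leib c a a
  exact left_eq_add.1 h1

lemma annE (F : Frame br φ g N) (k : ℕ) (hk : k + 2 < m + 4) (c : L) :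
    br c (φ (E ⟨k + 2, hk⟩)) = 0 := by
  induction k generalizing c with
  | zero =>
    have : φ (E ⟨0 + 2, hk⟩) = br (φ (E 0)) (φ (E 0)) := by
      rw [F.hom, Sh_E0]
      simp
      rfl
    rw [this, F.ann_sq]
  | succ k ih =>
    have : φ (E ⟨k + 1 + 2, hk⟩) = br (φ (E ⟨k + 2, by omega⟩)) (φ (E 0)) := by
      rw [F.hom, Sh_E (k+2) (by omega) hk]
      simp
    have h2 := F.leib c (φ (E ⟨k + 2, by omega⟩)) (φ (E 0))
    rw [ih (by omega), ih (by omega), map_zero, LinearMap.zero_apply, zero_add] at h2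
    rw [this, ← h2]

lemma annF (F : Frame br φ g N) (c : L) (a : V m) :
    br c (φ a) = a 0 • br c (φ (E 0)) + a 1 • br c (φ (E 1)) := by
  have : (br c) ∘ₗ φ = (LinearMap.proj 0 : V m →ₗ[ℂ] ℂ).smulRight (br c (φ (E 0)))
      + (LinearMap.proj 1 : V m →ₗ[ℂ] ℂ).smulRight (br c (φ (E 1))) := by
    refine LinearMap.pi_ext' fun i => LinearMap.ext_ring ?_
    simp only [LinearMap.comp_apply, LinearMap.single_apply, LinearMap.add_apply,
      LinearMap.smulRight_apply, LinearMap.proj_apply]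
    rw [← E, E_apply, E_apply, v0, v1]
    by_cases hi : (i : ℕ) = 0
    · obtain rfl : i = 0 := Fin.ext hi
      simp
    by_cases hi1 : (i : ℕ) = 1
    · obtain rfl : i = 1 := Fin.ext hi1
      simp
    · have := F.annE ((i : ℕ) - 2) (by omega) c
      have e : (⟨(i : ℕ) - 2 + 2, by omega⟩ : Fin (m+4)) = i := Fin.ext (by simp; omega)
      rw [e] at this
      rw [this, if_neg (by omega), if_neg (by omega)]
      simp
  exact LinearMap.congr_fun this a

lemma ann00 (F : Frame br φ g N) (c : L) {a : V m} (h0 : a 0 = 0) (h1 : a 1 = 0) :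
    br c (φ a) = 0 := by
  rw [F.annF, h0, h1]; simp

lemma ann0 (F : Frame br φ g N) {a : V m} (h : br (φ (E 0)) (φ a) = 0) : a 0 = 0 := by
  rw [F.hom, Sh_E0, ← map_zero φ] at h
  have := congrFun (F.inj h) 2
  simpa using this

lemma shift_x (F : Frame br φ g N) {x y : L} (G : Good br φ x y) {w : V m} (h : w 0 = 0) :
    Good br φ (x - φ w) y :=
  ⟨fun a => by rw [map_sub, G.hx, F.hom, h]; simp, G.hy⟩

lemma shift_y (F : Frame br φ g N) {x y : L} (G : Good br φ x y) {w : V m} (h : w 0 = 0) :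
    Good br φ x (y - φ w) :=
  ⟨G.hx, fun a => by rw [map_sub, G.hy, F.hom, h]; simp⟩

lemma good_s1 (F : Frame br φ g N) {x y : L} (G : Good br φ x y) {s : V m}
    (h : br x (φ (E 1)) = φ s) : s 0 = 0 ∧ s 1 = 0 := by
  have ha : ∀ c, br c (φ s) = 0 := by
    intro c
    rw [← h, F.ann_swap, G.hx, Lm_E1]; simp
  have h0 := F.ann0 (ha _)
  refine ⟨h0, ?_⟩
  have h1 := ha x
  rw [F.annF, h0, h, zero_smul, zero_add, ← map_smul, ← map_zero φ] at h1
  have := congrFun (F.inj h1) 1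
  simpa using this

lemma good_q0 (F : Frame br φ g N) {x y : L} (G : Good br φ x y) {q : V m}
    (h : br x y = φ q) : q 0 = 0 := by
  apply F.ann0
  have := F.leib (φ (E 0)) x y
  rw [h, G.hx, G.hy, G.hy, G.hx, Lm_E0, Pm_zero (by simp), map_zero, map_zero, map_zero, zero_add] at this
  exact this.symm

lemma step1 (F : Frame br φ g N) (hLL : ∀ x y, br x y ∈ N) {x y : L} (G : Good br φ x y) :
    ∃ x', Good br φ x' y ∧ br x' x' = 0 := by
  obtain ⟨p, hp⟩ := F.ex (hLL x x)
  obtain ⟨q, hq⟩ := F.ex (hLL x y)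
  obtain ⟨s, hs⟩ := F.ex (hLL x (φ (E 1)))
  obtain ⟨hs0, hs1⟩ := F.good_s1 G hs
  have hq0 := F.good_q0 G hq
  have hp0 : p 0 = 0 := F.ann0 (by rw [← hp, F.ann_sq])
  have hp1 : p 1 = 0 := by
    have := F.leib x x y
    rw [hp, hq, G.hy, G.hx, F.annF, hq0, hs, zero_smul, zero_add, ← map_smul, ← map_add] at this
    have := congrFun (F.inj this) 1
    rw [Pi.add_apply, Pi.smul_apply, hs1, Lm_apply, Pm_apply] at this
    simpa [lam] using this
  obtain ⟨w, hw0, hw1, hw⟩ := Lm_solve hp0 hp1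
  refine ⟨x - φ w, F.shift_x G hw0, ?_⟩
  rw [map_sub (br (x - φ w)), F.ann00 _ hw0 hw1, sub_zero, map_sub, LinearMap.sub_apply, hp, G.hx,
    hw, sub_self]

lemma step2a (F : Frame br φ g N) (hLL : ∀ x y, br x y ∈ N) {x y : L} (G : Good br φ x y)
    (hxx : br x x = 0) : br x (φ (E 0)) = - φ (E 0) ∧ br x (φ (E 1)) = 0 := by
  constructor
  · obtain ⟨s, hs⟩ := F.ex (hLL x (φ (E 0)))
    have h := F.leib x (φ (E 0)) x
    rw [hxx, G.hx, Lm_E0, hs, G.hx, map_zero, LinearMap.zero_apply, zero_add] at h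
    have he := Lm_eig1 (F.inj h)
    have h2 := F.ann_swap (φ (E 0)) x (φ (E 0))
    rw [hs, G.hx, Lm_E0, F.hom, F.hom, ← map_neg, Sh_E0] at h2
    have h3 := congrFun (F.inj h2) 2
    have h4 : s 0 = -1 := by simpa using h3
    rw [hs, he, h4]
    simp
  · obtain ⟨s, hs⟩ := F.ex (hLL x (φ (E 1)))
    obtain ⟨hs0, hs1⟩ := F.good_s1 G hs
    have h := F.leib x (φ (E 1)) x
    rw [hxx, G.hx, Lm_E1, hs, G.hx, map_zero, LinearMap.zero_apply, zero_add, map_zero,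
      map_zero, ← map_zero φ] at h
    have he := Lm_eig0 (F.inj h)
    rw [hs, he, hs1]
    simp

lemma step2 (F : Frame br φ g N) (hLL : ∀ x y, br x y ∈ N) {x y : L} (G : Good br φ x y)
    (hxx : br x x = 0) : ∃ x', Good br φ x' y ∧ br x' x' = 0 ∧ br x' y = 0 := by
  obtain ⟨q, hq⟩ := F.ex (hLL x y)
  have hq0 := F.good_q0 G hq
  have hs := (F.step2a hLL G hxx).2
  have hxq : br x (φ q) = 0 := by rw [F.annF, hq0, hs]; simp
  have h := F.leib x y x
  rw [hxx, F.ann_swap x y x, hq, hxq, map_zero, LinearMap.zero_apply, neg_zero, add_zero,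
    G.hx, ← map_zero φ] at h
  have hL := F.inj h
  have he := Lm_eig0 hL
  refine ⟨x - φ q, F.shift_x G hq0, ?_, ?_⟩
  · rw [map_sub, map_sub, LinearMap.sub_apply, LinearMap.sub_apply, hxx, G.hx, hL, hxq, F.hom, hq0]
    simp
  · rw [map_sub, LinearMap.sub_apply, hq, G.hy, Pm_apply, ← he, sub_self]

lemma step3 (F : Frame br φ g N) (hLL : ∀ x y, br x y ∈ N) {x y : L} (G : Good br φ x y)
    (hxy : br x y = 0) :
    ∃ y', Good br φ x y' ∧ br x y' = 0 ∧ br y' x = 0 ∧ br y' y' = 0 := by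
  obtain ⟨r, hr⟩ := F.ex (hLL y x)
  obtain ⟨v, hv⟩ := F.ex (hLL y y)
  have hv0 : v 0 = 0 := F.ann0 (by rw [← hv, F.ann_sq])
  have hr0 : r 0 = 0 := F.ann0 (by rw [← hr, F.ann_swap, hxy]; simp)
  have h := F.leib y x y
  rw [hr, hv, hxy, map_zero, add_zero, G.hx, G.hy] at h
  have h := F.inj h
  have hr1 : r 1 = 0 := by
    have := congrFun h 1
    rw [Lm_apply, Pm_apply] at this
    simpa [lam] using this
  have hLv : Lm m v = 0 := by rw [← h, Pm_zero hr1]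
  have he := Lm_eig0 hLv
  obtain ⟨w, hw0, hw1, hw⟩ := Lm_solve hr0 hr1
  have hann : ∀ c, br c (φ (w + v)) = 0 := by
    intro c
    rw [map_add, map_add, F.ann00 _ hw0 hw1, ← hv, F.ann_sq, add_zero]
  refine ⟨y - φ (w + v), F.shift_y G (by simp [hw0, hv0]), ?_, ?_, ?_⟩
  · rw [map_sub, hxy, hann, sub_zero]
  · rw [map_sub, LinearMap.sub_apply, hr, G.hx, map_add, hw, hLv, add_zero, sub_self]
  · rw [map_sub (br _), hann, sub_zero, map_sub, LinearMap.sub_apply, hv, G.hy, map_add,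
      Pm_zero hw1, zero_add, Pm_apply, ← he, sub_self]

lemma step4 (F : Frame br φ g N) (hLL : ∀ x y, br x y ∈ N) {x y : L} (G : Good br φ x y)
    (hyx : br y x = 0) : br y (φ (E 0)) = 0 ∧
      ∃ d : ℂ, (d = -1 ∨ d = 0) ∧ br y (φ (E 1)) = d • φ (E 1) := by
  constructor
  · obtain ⟨t, ht⟩ := F.ex (hLL y (φ (E 0)))
    have h := F.leib y (φ (E 0)) x
    rw [hyx, G.hx, Lm_E0, ht, G.hx, map_zero, LinearMap.zero_apply, zero_add] at h
    have he := Lm_eig1 (F.inj h)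
    have h0 : t 0 = 0 := F.ann0 (by
      rw [← ht, F.ann_swap, G.hy, Pm_zero (by simp)]; simp)
    rw [ht, he, h0]
    simp
  · obtain ⟨t, ht⟩ := F.ex (hLL y (φ (E 1)))
    have h := F.leib y (φ (E 1)) x
    rw [hyx, G.hx, Lm_E1, ht, G.hx, map_zero, LinearMap.zero_apply, zero_add, map_zero,
      map_zero, ← map_zero φ] at h
    have he := Lm_eig0 (F.inj h)
    refine ⟨t 1, ?_, by rw [ht, ← map_smul, ← he]⟩
    have h2 := F.ann_swap y y (φ (E 1))
    have hP : Pm m (E 1) = E 1 := by rw [Pm_apply]; simp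
    rw [G.hy, hP, ht, he, map_smul, map_smul, ht, ← map_smul, ← map_smul, ← map_neg] at h2
    have h3 := congrFun (F.inj h2) 1
    simp only [Pi.smul_apply, Pi.neg_apply, smul_eq_mul] at h3
    have h4 : (t 1 + 1) * t 1 = 0 := by
      simp at h3
      linear_combination h3
    rcases mul_eq_zero.1 h4 with h5 | h5
    · exact Or.inl (eq_neg_of_add_eq_zero_left h5)
    · exact Or.inr h5

/-- Diagonalization of the frame. -/
lemma diag (F : Frame br φ g N) (hs : Function.Surjective (psi br φ g)) :
    ∃ (φ' : V m →ₗ[ℂ] L) (g' : L →ₗ[ℂ] V m) (x : L), Frame br φ' g' N ∧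
      ∀ a, br (φ' a) x = φ' (Lm m a) := by
  obtain ⟨x, hx⟩ := hs (1, 0)
  rw [psi_apply, Prod.mk.injEq] at hx
  obtain ⟨T, hTi, hT0, hTS, hTE⟩ := der_diag _ (F.der x) hx.1 hx.2
  let e := LinearEquiv.ofInjectiveEndo T hTi
  have he : ∀ a, e a = T a := fun a => rfl
  have he' : ∀ a, T (e.symm a) = a := fun a => by rw [← he, e.apply_symm_apply]
  refine ⟨φ ∘ₗ T, e.symm.toLinearMap ∘ₗ g, x, ⟨F.leib, ?_, ?_, ?_, F.idl⟩, ?_⟩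
  · intro a
    simp only [LinearMap.comp_apply, F.gφ, LinearEquiv.coe_coe, ← he, e.symm_apply_apply]
  · intro z
    simp only [LinearMap.comp_apply, LinearEquiv.coe_coe, he']
    exact F.rng z
  · intro a b
    simp only [LinearMap.comp_apply]
    rw [F.hom, hT0, ← hTS, map_smul T]
  · intro a
    have : br.flip x ∘ₗ φ ∘ₗ T = φ ∘ₗ T ∘ₗ Lm m := by
      refine LinearMap.pi_ext' fun i => LinearMap.ext_ring ?_
      simp only [LinearMap.comp_apply, LinearMap.single_apply, LinearMap.flip_apply]
      rw [← E, Lm_E, ← F.φD, hTE, map_smul T]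
    exact LinearMap.congr_fun this a

lemma good_ex (F : Frame br φ g N) (hLL : ∀ x y, br x y ∈ N)
    (hs : Function.Surjective (psi br φ g)) {x : L} (hx : ∀ a, br (φ a) x = φ (Lm m a)) :
    ∃ y, Good br φ x y := by
  obtain ⟨y₀, hy₀⟩ := hs (0, 1)
  obtain ⟨q₀, hq₀⟩ := F.ex (hLL x y₀)
  obtain ⟨s, hsx⟩ := F.ex (hLL x (φ (E 0)))
  have hs0 : s 0 = -1 := by
    have h2 := F.ann_swap (φ (E 0)) x (φ (E 0))
    rw [hsx, hx, Lm_E0, F.hom, F.hom, ← map_neg, Sh_E0] at h2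
    have h3 := congrFun (F.inj h2) 2
    simpa using h3
  obtain ⟨y, hy⟩ : ∃ y, y = y₀ + φ (q₀ 0 • E 0) := ⟨_, rfl⟩
  have hpsi : psi br φ g y = (0, 1) := by rw [hy, map_add, F.psi_N, hy₀, add_zero]
  rw [psi_apply, Prod.mk.injEq] at hpsi
  have hbr : br x y = φ (q₀ + q₀ 0 • s) := by
    rw [hy, map_add, hq₀, map_smul, map_smul, hsx, map_add, map_smul]
  have hDx : ∀ a, Dm br φ g x a = Lm m a := fun a => F.inj (by rw [F.φD, hx])
  have hcomm : ∀ a, Dm br φ g y (Lm m a) = Lm m (Dm br φ g y a) := by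
    intro a
    have h := F.comm x y a
    rw [hbr, F.DN, hDx, hDx] at h
    have h0 : (q₀ + q₀ 0 • s) 0 = 0 := by simp [hs0]
    rw [h0, zero_smul] at h
    exact sub_eq_zero.1 h.symm
  have hDy : ∀ i, Dm br φ g y (E i) = Pm m (E i) := by
    intro i
    have h := hcomm (E i)
    rw [Lm_E, map_smul] at h
    have h1 := Lm_eig i h.symm
    have h2 := der_tri _ (F.der y) i i.2 i le_rfl
    rw [hpsi.1, hpsi.2, if_pos rfl] at h2
    rw [h1]
    change Dm br φ g y (E i) i = _ at h2
    rw [h2, Pm_apply, E_apply, v1]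
    by_cases hi1 : (i : ℕ) = 1
    · obtain rfl : i = 1 := Fin.ext hi1
      simp [lam]
    · rw [if_neg (fun h => hi1 h.symm)]
      simp [lam, hi1]
  refine ⟨y, hx, fun a => ?_⟩
  have : Dm br φ g y = Pm m := by
    refine LinearMap.pi_ext' fun i => LinearMap.ext_ring ?_
    simp only [LinearMap.comp_apply, LinearMap.single_apply]
    exact hDy i
  rw [← F.φD, this]

end Frame
set_option linter.unusedSimpArgs false

lemma table15_map {W W' : Type*} [AddCommGroup W] [Module ℂ W] [AddCommGroup W'] [Module ℂ W']
    (f : W →ₗ[ℂ] W') (n : ℕ) (c : ℂ) (v : Fin (n + 2) → W) (i j : Fin (n + 2)) :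
    f (table15 n c v i j) = table15 n c (fun t => f (v t)) i j := by
  unfold table15
  have hu : ∀ k, f (if h : k < n + 2 then v ⟨k, h⟩ else 0)
      = if h : k < n + 2 then f (v ⟨k, h⟩) else 0 := by
    intro k
    split_ifs <;> simp
  simp only [apply_ite f, map_neg, map_smul, hu, map_zero]

/-- The adapted basis. -/
noncomputable def bv {m : ℕ} (φ : V m →ₗ[ℂ] L) (x y : L) (i : Fin (m + 4 + 2)) : L :=
  if h : (i : ℕ) < m + 4 then φ (E ⟨i, h⟩) else if (i : ℕ) = m + 4 then x else y

lemma bv_lt {m : ℕ} (φ : V m →ₗ[ℂ] L) (x y : L) (k : ℕ) (hk : k < m + 4) (hk' : k < m + 4 + 2) :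
    bv φ x y ⟨k, hk'⟩ = φ (E ⟨k, hk⟩) := by simp [bv, hk]

lemma bv_x {m : ℕ} (φ : V m →ₗ[ℂ] L) (x y : L) (hk' : m + 4 < m + 4 + 2) :
    bv φ x y ⟨m + 4, hk'⟩ = x := by simp [bv]

lemma bv_y {m : ℕ} (φ : V m →ₗ[ℂ] L) (x y : L) (hk' : m + 4 + 1 < m + 4 + 2) :
    bv φ x y ⟨m + 4 + 1, hk'⟩ = y := by simp [bv]

lemma fin_cases6 {m : ℕ} (i : Fin (m + 4 + 2)) :
    i = ⟨0, by omega⟩ ∨ i = ⟨1, by omega⟩ ∨ (∃ k, ∃ h : k + 2 < m + 4, i = ⟨k + 2, by omega⟩) ∨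
      i = ⟨m + 4, by omega⟩ ∨ i = ⟨m + 4 + 1, by omega⟩ := by
  have := i.2
  by_cases h0 : (i : ℕ) = 0
  · exact Or.inl (Fin.ext h0)
  by_cases h1 : (i : ℕ) = 1
  · exact Or.inr (Or.inl (Fin.ext h1))
  by_cases h2 : (i : ℕ) < m + 4
  · exact Or.inr (Or.inr (Or.inl ⟨i - 2, by omega, Fin.ext (by simp; omega)⟩))
  by_cases h3 : (i : ℕ) = m + 4
  · exact Or.inr (Or.inr (Or.inr (Or.inl (Fin.ext h3))))
  · exact Or.inr (Or.inr (Or.inr (Or.inr (Fin.ext (by simp; omega)))))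

namespace Frame
variable {m : ℕ} {br : Bil L} {φ : V m →ₗ[ℂ] L} {g : L →ₗ[ℂ] V m} {N : Submodule ℂ L}

lemma bv_table (F : Frame br φ g N) {x y : L} (G : Good br φ x y) {d : ℂ}
    (hxx : br x x = 0) (hxy : br x y = 0) (hyx : br y x = 0) (hyy : br y y = 0)
    (hx0 : br x (φ (E 0)) = - φ (E 0)) (hx1 : br x (φ (E 1)) = 0)
    (hy0 : br y (φ (E 0)) = 0) (hy1 : br y (φ (E 1)) = d • φ (E 1)) (i j : Fin (m + 4 + 2)) :
    br (bv φ x y i) (bv φ x y j) = table15 (m + 4) d (bv φ x y) i j := by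
  have b0 : ∀ h, bv φ x y ⟨0, h⟩ = φ (E 0) := fun h => bv_lt φ x y 0 (by omega) h
  have b1 : ∀ h, bv φ x y ⟨1, h⟩ = φ (E 1) := fun h => bv_lt φ x y 1 (by omega) h
  have b2 : ∀ h, bv φ x y ⟨2, h⟩ = φ (E 2) := fun h => bv_lt φ x y 2 (by omega) h
  have bk := bv_lt φ x y
  have bx := bv_x φ x y
  have b_y := bv_y φ x y
  have e00 : (E 0 : V m) 0 = 1 := by simp
  have e10 : (E 1 : V m) 0 = 0 := by simp
  have hP1 : Pm m (E 1) = E 1 := by rw [Pm_apply]; simp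
  have hP0 : Pm m (E 0) = 0 := Pm_zero (by simp)
  have b0' : bv φ x y 0 = φ (E 0) := b0 (by omega)
  have b1' : bv φ x y 1 = φ (E 1) := b1 (by omega)
  have b2' : bv φ x y 2 = φ (E 2) := b2 (by omega)
  unfold table15
  rcases fin_cases6 j with rfl | rfl | ⟨k, hk, rfl⟩ | rfl | rfl
  · rcases fin_cases6 i with rfl | rfl | ⟨l, hl, rfl⟩ | rfl | rfl
    · simp [b0, b0', b1', b2', b2, F.hom, Sh_E0]
    · simp [b0, b0', b1', b2', b1, F.hom, Sh_E1]
    · rw [bk _ hl, b0, F.hom, e00, one_smul]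
      by_cases hl' : l + 2 + 1 < m + 4
      · rw [Sh_E (l + 2) (by omega) hl']
        have := bk (l + 2 + 1) hl' (by omega)
        simp [this, hl', show l + 2 + 1 < m + 4 + 2 by omega]
      · have e : (⟨l + 2, hl⟩ : Fin (m + 4)) = ⟨m + 3, by omega⟩ := Fin.ext (by simp; omega)
        rw [e, Sh_Elast]
        simp [show ¬ l + 2 + 1 < m + 4 by omega, show l ≠ m + 2 by omega, show ¬ l < m + 1 by omega]
        try (intros; omega)
    · simp [b0, b0', b1', b2', bx, hx0]
    · simp [b0, b0', b1', b2', b_y, hy0]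
  · rcases fin_cases6 i with rfl | rfl | ⟨l, hl, rfl⟩ | rfl | rfl
    · simp [b0, b0', b1', b2', b1, F.hom]
    · simp [b1, b0', b1', b2', F.hom]
    · rw [bk _ hl, b1, F.hom, e10]
      simp [show l ≠ m + 3 by omega]
    · simp [b1, b0', b1', b2', bx, hx1]
    · simp [b1, b0', b1', b2', b_y, hy1]
  · rw [bk _ hk, F.annE]
    simp [show k ≠ m + 3 by omega, show k ≠ m + 2 by omega]
  · rw [bx]
    rcases fin_cases6 i with rfl | rfl | ⟨l, hl, rfl⟩ | rfl | rfl
    · simp [b0, b0', b1', b2', G.hx, Lm_E0]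
    · simp [b1, b0', b1', b2', G.hx, Lm_E1]
    · rw [bk _ hl, G.hx, Lm_E, map_smul]
      simp [lam, bk _ hl, show l + 2 ≤ m + 4 - 1 by omega, show ¬ m + 1 < l by omega, show l ≤ m + 1 by omega, show l + 2 < m + 4 + 2 by omega]
    · rw [bx, hxx]; simp
    · rw [b_y, hyx]; simp
  · rw [b_y]
    rcases fin_cases6 i with rfl | rfl | ⟨l, hl, rfl⟩ | rfl | rfl
    · simp [b0, b0', b1', b2', G.hy, hP0]
    · simp [b1, b0', b1', b2', G.hy, hP1]
    · rw [bk _ hl, G.hy, Pm_zero]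
      · simp
      · rw [E_apply, v1]; simp
    · rw [bx, hxy]; simp
    · rw [b_y, hyy]; simp

lemma final [FiniteDimensional ℂ L] (F : Frame br φ g N) (hN : IsNilradical br N)
    (hLL : ∀ x y, br x y ∈ N) (hd : finrank ℂ L = m + 4 + 2) {x y : L} (G : Good br φ x y) {d : ℂ}
    (hT : ∀ i j, br (bv φ x y i) (bv φ x y j) = table15 (m + 4) d (bv φ x y) i j)
    (br1 : Bil (Fin (m + 4 + 2) → ℂ))
    (hbr1 : ∀ i j : Fin (m + 4 + 2), br1 (Pi.single i 1) (Pi.single j 1) =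
      table15 (m + 4) d (fun t => Pi.single t 1) i j) : AlgIso br br1 := by
  have hDx : ∀ a, Dm br φ g x a = Lm m a := fun a => F.inj (by rw [F.φD, G.hx])
  have hDy : ∀ a, Dm br φ g y a = Pm m a := fun a => F.inj (by rw [F.φD, G.hy])
  have hpx : psi br φ g x = (1, 0) := by
    rw [psi_apply, hDx, hDx, Lm_E0, Lm_E1]; simp
  have hpy : psi br φ g y = (0, 1) := by
    rw [psi_apply, hDy, hDy, Pm_zero (by simp), Pm_apply]; simp
  set v := bv φ x y with hv
  have hvm : ∀ i, v i ∈ Submodule.span ℂ (Set.range v) := fun i => Submodule.subset_span ⟨i, rfl⟩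
  have hxm : x ∈ Submodule.span ℂ (Set.range v) := by
    have := hvm ⟨m + 4, by omega⟩
    rwa [hv, bv_x] at this
  have hym : y ∈ Submodule.span ℂ (Set.range v) := by
    have := hvm ⟨m + 4 + 1, by omega⟩
    rwa [hv, bv_y] at this
  have hφm : ∀ a, φ a ∈ Submodule.span ℂ (Set.range v) := by
    intro a
    rw [LinearMap.pi_apply_eq_sum_univ φ a]
    refine Submodule.sum_mem _ fun i _ => Submodule.smul_mem _ _ ?_
    have e : (fun k => if i = k then (1:ℂ) else 0) = E i := by
      funext k; simp [E, Pi.single_apply, eq_comm]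
    rw [e]
    have := hvm ⟨i, by omega⟩
    rwa [hv, bv_lt _ _ _ _ i.2] at this
  have hspan : ⊤ ≤ Submodule.span ℂ (Set.range v) := by
    intro z _
    have hz : z - ((psi br φ g z).1 • x + (psi br φ g z).2 • y) ∈ N := by
      apply F.ker_psi hN hLL
      rw [map_sub, map_add, map_smul, map_smul, hpx, hpy]
      ext <;> simp
    obtain ⟨a, ha⟩ := F.ex hz
    rw [sub_eq_iff_eq_add] at ha
    rw [ha]
    exact Submodule.add_mem _ (hφm a) (Submodule.add_mem _ (Submodule.smul_mem _ _ hxm)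
      (Submodule.smul_mem _ _ hym))
  let b := basisOfTopLeSpanOfCardEqFinrank v hspan (by rw [hd]; simp)
  have hb : ∀ i, b i = v i := fun i => by simp [b]
  have hbe : ∀ i, b.equivFun (v i) = Pi.single i 1 := by
    intro i
    funext j
    rw [← hb, Module.Basis.equivFun_self]
    simp [Pi.single_apply, eq_comm]
  refine ⟨b.equivFun, ?_⟩
  have key : br.compr₂ b.equivFun.toLinearMap =
      br1.compl₁₂ b.equivFun.toLinearMap b.equivFun.toLinearMap := by
    refine b.ext fun i => b.ext fun j => ?_
    rw [LinearMap.compr₂_apply, LinearMap.compl₁₂_apply, hb, hb, hT, table15_map]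
    simp only [LinearEquiv.coe_coe, hbe]
    rw [hbr1]
  intro z w
  exact LinearMap.congr_fun (LinearMap.congr_fun key z) w

end Frame

lemma noniso (n : ℕ) (hn : 4 ≤ n) (br1 br2 : Bil (Fin (n + 2) → ℂ))
    (hbr1 : ∀ i j : Fin (n + 2), br1 (Pi.single i 1) (Pi.single j 1) =
      table15 n (-1) (fun t => Pi.single t 1) i j)
    (hbr2 : ∀ i j : Fin (n + 2), br2 (Pi.single i 1) (Pi.single j 1) =
      table15 n 0 (fun t => Pi.single t 1) i j) : ¬ AlgIso br1 br2 := by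
  rintro ⟨f, hf⟩
  have hn1 : n ≠ 1 := by omega
  have hn0 : n ≠ 0 := by omega
  have h1 : br1 (Pi.single ⟨1, by omega⟩ 1) (Pi.single ⟨n + 1, by omega⟩ 1)
      = Pi.single ⟨1, by omega⟩ 1 := by
    rw [hbr1]; simp [table15]
  have h2 : br1 (Pi.single ⟨n + 1, by omega⟩ 1) (Pi.single ⟨1, by omega⟩ 1)
      = - Pi.single ⟨1, by omega⟩ 1 := by
    rw [hbr1]; simp [table15, hn1.symm, hn0, hn0.symm]
  have h3 : br1 (Pi.single ⟨1, by omega⟩ 1) (Pi.single ⟨1, by omega⟩ 1) = 0 := by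
    rw [hbr1]; simp [table15, hn1.symm, hn0, hn0.symm]
  obtain ⟨w, hw⟩ : ∃ w, w = f (Pi.single ⟨1, by omega⟩ 1) := ⟨_, rfl⟩
  obtain ⟨b, hb⟩ : ∃ b, b = f (Pi.single ⟨n + 1, by omega⟩ 1) := ⟨_, rfl⟩
  have k1 : br2 w b = w := by rw [hw, hb, ← hf, h1]
  have k2 : br2 b w = - w := by rw [hw, hb, ← hf, h2, map_neg]
  have k3 : br2 w w = 0 := by rw [hw, ← hf, h3, map_zero]
  have hw0 : w ≠ 0 := by
    rw [hw]
    intro h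
    have := f.map_eq_zero_iff.1 h
    have := congrFun this ⟨1, by omega⟩
    simp at this
  -- the coordinates `x`, `y` vanish on products
  have cx : ∀ t : Fin (n + 2), n ≤ (t : ℕ) → ∀ a c, br2 a c t = 0 := by
    intro t ht a c
    have : br2.compr₂ (LinearMap.proj t : (Fin (n + 2) → ℂ) →ₗ[ℂ] ℂ) = 0 := by
      refine LinearMap.pi_ext' fun i => LinearMap.ext_ring ?_
      refine LinearMap.pi_ext' fun j => LinearMap.ext_ring ?_
      simp only [LinearMap.comp_apply, LinearMap.single_apply, LinearMap.compr₂_apply, hbr2]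
      rw [table15_map]
      have hu : ∀ k (h : k < n + 2), k < n →
          (LinearMap.proj t : (Fin (n + 2) → ℂ) →ₗ[ℂ] ℂ) (Pi.single ⟨k, h⟩ 1) = 0 := by
        intro k h hk
        rw [LinearMap.proj_apply, Pi.single_apply, if_neg]
        intro h
        rw [h] at ht
        simp at ht
        omega
      unfold table15
      simp only [LinearMap.zero_apply]
      split_ifs <;> first
        | rfl
        | (rw [hu _ _ (by omega)]; done)
        | (rw [hu _ _ (by omega)]; simp; done)
        | (simp; done)
    exact LinearMap.congr_fun (LinearMap.congr_fun this a) c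
  have wx : ∀ t : Fin (n + 2), n ≤ (t : ℕ) → w t = 0 := fun t ht => by rw [← k1]; exact cx t ht w b
  -- right multiplications by `w`
  have hr : ∀ a, w ⟨0, by omega⟩ • br2 a (Pi.single ⟨0, by omega⟩ 1) = br2 a w := by
    intro a
    conv_rhs => rw [LinearMap.pi_apply_eq_sum_univ (br2 a) w]
    rw [Finset.sum_eq_single ⟨0, by omega⟩]
    · congr 2
      funext k; simp [Pi.single_apply, eq_comm]
    · intro t _ ht
      have e : (fun k => if t = k then (1:ℂ) else 0) = Pi.single t 1 := by
        funext k; simp [Pi.single_apply, eq_comm]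
      rw [e]
      by_cases htn : n ≤ (t : ℕ)
      · rw [wx t htn, zero_smul]
      · have : br2.flip (Pi.single t 1) = 0 := by
          refine LinearMap.pi_ext' fun i => LinearMap.ext_ring ?_
          simp only [LinearMap.comp_apply, LinearMap.single_apply, LinearMap.flip_apply, hbr2]
          have ht0 : (t : ℕ) ≠ 0 := fun h => ht (Fin.ext h)
          unfold table15
          rw [if_neg ht0, if_neg (by omega), if_neg (by omega)]
          simp
        have h := LinearMap.congr_fun this a
        rw [LinearMap.flip_apply] at h
        rw [h]; simp
    · simp
  have w0 : w ⟨0, by omega⟩ = 0 := by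
    have h := congrFun k3 ⟨2, by omega⟩
    rw [← hr] at h
    have h5 : br2 w (Pi.single ⟨0, by omega⟩ 1) ⟨2, by omega⟩ = w ⟨0, by omega⟩ := by
      rw [← LinearMap.flip_apply, LinearMap.pi_apply_eq_sum_univ (br2.flip _) w, Finset.sum_apply,
        Finset.sum_eq_single ⟨0, by omega⟩]
      · have e : (fun k => if (⟨0, by omega⟩ : Fin (n+2)) = k then (1:ℂ) else 0)
            = Pi.single ⟨0, by omega⟩ 1 := by
          funext k; simp [Pi.single_apply, eq_comm]
        rw [e, LinearMap.flip_apply, hbr2]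
        simp [table15, show 0 < n by omega]
      · intro t _ ht
        have e : (fun k => if t = k then (1:ℂ) else 0) = Pi.single t 1 := by
          funext k; simp [Pi.single_apply, eq_comm]
        have ht0 : (t : ℕ) ≠ 0 := fun h => ht (Fin.ext h)
        rw [e, LinearMap.flip_apply, hbr2]
        unfold table15
        rw [Pi.smul_apply]
        simp only [if_true, ht0, if_false]
        by_cases h6 : 2 ≤ (t : ℕ) ∧ (t : ℕ) + 1 < n
        · rw [if_pos h6, dif_pos (by omega), Pi.single_apply, if_neg]
          · simp
          · intro h; have := congrArg Fin.val h; simp at this; omega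
        · rw [if_neg h6]
          by_cases h7 : (t : ℕ) = n
          · rw [wx t h7.ge, zero_smul]
          · rw [if_neg h7]; simp
      · simp
    rw [Pi.smul_apply, h5] at h
    simpa using h
  apply hw0
  have := hr b
  rw [w0, zero_smul, k2] at this
  exact neg_eq_zero.1 this.symm

end S15

/-- Theorem 5.3. Any `(n+2)`-dimensional solvable Leibniz algebra with
nilradical `Fₙ²` is isomorphic to exactly one of the two non-isomorphic algebras
`R₁`, `R₂`. -/
theorem stmt15 {L : Type u} [AddCommGroup L] [Module ℂ L] [FiniteDimensional ℂ L]
    (n : ℕ) (hn : 4 ≤ n)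
    (brF : Bil (Fin n → ℂ))
    (hbrF : ∀ i j : Fin n, brF (Pi.single i 1) (Pi.single j 1) =
      tableF n (fun t => Pi.single t 1) i j)
    (br1 br2 : Bil (Fin (n + 2) → ℂ))
    (hbr1 : ∀ i j : Fin (n + 2), br1 (Pi.single i 1) (Pi.single j 1) =
      table15 n (-1) (fun t => Pi.single t 1) i j)
    (hbr2 : ∀ i j : Fin (n + 2), br2 (Pi.single i 1) (Pi.single j 1) =
      table15 n 0 (fun t => Pi.single t 1) i j)
    (br : Bil L) (hleib : IsLeibniz br) (hsolv : IsSolvableSub br (⊤ : Submodule ℂ L))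
    (hdim : finrank ℂ L = n + 2)
    (N : Submodule ℂ L) (hN : IsNilradical br N)
    (hiso : SubAlgIso brF ⊤ br N) :
    (AlgIso br br1 ∨ AlgIso br br2) ∧ ¬ AlgIso br1 br2 := by
  refine ⟨?_, S15.noniso n hn br1 br2 hbr1 hbr2⟩
  obtain ⟨m, rfl⟩ : ∃ m, n = m + 4 := ⟨n - 4, by omega⟩
  obtain ⟨ψ, hinj, hrng, hhom⟩ := hiso
  let φ₀ : S15.V m →ₗ[ℂ] L := ψ ∘ₗ (Submodule.topEquiv (R := ℂ) (M := S15.V m)).symm.toLinearMap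
  have hφ₀ : ∀ a, φ₀ a = ψ ⟨a, trivial⟩ := fun a => rfl
  have hφinj : Function.Injective φ₀ := by
    intro a b h
    rw [hφ₀, hφ₀] at h
    exact congrArg Subtype.val (hinj h)
  obtain ⟨g, hg⟩ := LinearMap.exists_leftInverse_of_injective φ₀ (LinearMap.ker_eq_bot.2 hφinj)
  have hg' : ∀ a, g (φ₀ a) = a := fun a => LinearMap.congr_fun hg a
  have F : S15.Frame br φ₀ g N := by
    refine ⟨hleib, hg', ?_, ?_, ?_⟩
    · intro z
      have hz : z ∈ N ↔ z ∈ Set.range ψ := by rw [hrng]; rfl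
      rw [hz]
      constructor
      · rintro ⟨a, rfl⟩
        have e : ψ a = φ₀ a.1 := rfl
        rw [e, hg']
      · intro h
        exact ⟨⟨g z, trivial⟩, h⟩
    · intro a b
      rw [← S15.brF_eq brF hbrF]
      exact (hhom ⟨a, trivial⟩ ⟨b, trivial⟩ ⟨brF a b, trivial⟩ rfl).symm
    · intro z hz w
      exact hN.1.2 z hz w trivial
  have hLL := F.LL hN hsolv hdim
  obtain ⟨φ', g', x, F', hx⟩ := F.diag (F.psi_surj hN hLL hdim)
  obtain ⟨y, G⟩ := F'.good_ex hLL (F'.psi_surj hN hLL hdim) hx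
  obtain ⟨x1, G1, hxx1⟩ := F'.step1 hLL G
  obtain ⟨x2, G2, hxx2, hxy2⟩ := F'.step2 hLL G1 hxx1
  obtain ⟨y2, G3, hxy, hyx, hyy⟩ := F'.step3 hLL G2 hxy2
  obtain ⟨hx0, hx1⟩ := F'.step2a hLL G3 hxx2
  obtain ⟨hy0, d, hd, hy1⟩ := F'.step4 hLL G3 hyx
  have hT := F'.bv_table G3 hxx2 hxy hyx hyy hx0 hx1 hy0 hy1
  rcases hd with rfl | rfl
  · exact Or.inl (F'.final hN hLL hdim G3 hT br1 hbr1)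
  · exact Or.inr (F'.final hN hLL hdim G3 hT br2 hbr2)
end

section
/- Let L be a 4-dimensional complex solvable Leibniz algebra whose nilradical is 2-dimensional and abelian. Then L is isomorphic to exactly one of the following three pairwise non-isomorphic algebras on basis {e_1, e_2, x, y}: R₄¹ with nonzero products [e_1,x]=e_1, [e_2,y]=e_2; R₄² with nonzero products [e_1,x]=e_1, [x,e_1]=−e_1, [e_2,y]=e_2, [y,e_2]=−e_2; and R₄³ with nonzero products [e_1,x]=e_1, [e_2,y]=e_2, [y,e_2]=−e_2. -/
open Module Submodule

universe u v w

variable {L : Type u} [AddCommGroup L] [Module ℂ L]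

/-- The multiplication table of the `4`-dimensional solvable algebras `R₄(c₁, c₂)` on the
basis `e₁ ↦ v 0`, `e₂ ↦ v 1`, `x ↦ v 2`, `y ↦ v 3`:
`[e₁,x] = e₁`, `[x,e₁] = c₁•e₁`, `[e₂,y] = e₂`, `[y,e₂] = c₂•e₂`, all other products
zero.  `R₄¹ = R₄(0,0)`, `R₄² = R₄(-1,-1)`, `R₄³ = R₄(0,-1)`. -/
def table16 (c1 c2 : ℂ) {W : Type v} [AddCommGroup W] [Module ℂ W]
    (v : Fin 4 → W) (i j : Fin 4) : W :=
  if i = 0 ∧ j = 2 then v 0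
  else if i = 2 ∧ j = 0 then c1 • v 0
  else if i = 1 ∧ j = 3 then v 1
  else if i = 3 ∧ j = 1 then c2 • v 1
  else 0

lemma table_formula (c1 c2 : ℂ) (b : Bil (Fin 4 → ℂ))
    (h : ∀ i j : Fin 4, b (Pi.single i 1) (Pi.single j 1) =
      table16 c1 c2 (fun t => Pi.single t 1) i j) (p q : Fin 4 → ℂ) :
    b p q = ![p 0 * q 2 + c1 * (p 2 * q 0), p 1 * q 3 + c2 * (p 3 * q 1), 0, 0] := by
  have e : ∀ p : Fin 4 → ℂ, p = ∑ i, p i • (Pi.single i 1 : Fin 4 → ℂ) := by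
    intro p; simpa [Pi.single_apply] using pi_eq_sum_univ' p
  rw [e p, e q]
  simp only [map_sum, map_smul, LinearMap.sum_apply, LinearMap.smul_apply, h]
  funext k
  fin_cases k <;> simp [Fin.sum_univ_four, table16, Pi.single_apply] <;> ring

lemma not_iso (brA brB brC : Bil (Fin 4 → ℂ))
    (hbrA : ∀ i j : Fin 4, brA (Pi.single i 1) (Pi.single j 1) =
      table16 0 0 (fun t => Pi.single t 1) i j)
    (hbrB : ∀ i j : Fin 4, brB (Pi.single i 1) (Pi.single j 1) =
      table16 (-1) (-1) (fun t => Pi.single t 1) i j)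
    (hbrC : ∀ i j : Fin 4, brC (Pi.single i 1) (Pi.single j 1) =
      table16 0 (-1) (fun t => Pi.single t 1) i j) :
    ¬ AlgIso brA brB ∧ ¬ AlgIso brA brC ∧ ¬ AlgIso brB brC := by
  have fA := table_formula _ _ _ hbrA
  have fB := table_formula _ _ _ hbrB
  have fC := table_formula _ _ _ hbrC
  have sB : ∀ p, brB p p = 0 := by
    intro p; rw [fB]; funext k; fin_cases k <;> simp <;> ring
  refine ⟨?_, ?_, ?_⟩
  · rintro ⟨φ, h⟩
    have h1 : brA ![1,0,1,0] ![1,0,1,0] = 0 := by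
      apply φ.injective; rw [h, sB, map_zero]
    rw [fA] at h1
    have := congrFun h1 0
    simp at this
  · rintro ⟨φ, h⟩
    have sA : ∀ p q r, brA p (brA q r) = 0 := by
      intro p q r; simp only [fA]; funext k; fin_cases k <;> simp
    have h2 : brC ![0,0,0,1] (brC ![0,1,0,0] ![0,0,0,1]) = 0 := by
      have := h (φ.symm ![0,0,0,1]) (brA (φ.symm ![0,1,0,0]) (φ.symm ![0,0,0,1]))
      rw [sA, h] at this
      simpa using this.symm
    rw [fC, fC] at h2
    have := congrFun h2 1
    simp at this
  · rintro ⟨φ, h⟩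
    have h1 : brC ![1,0,1,0] ![1,0,1,0] = 0 := by
      have := h (φ.symm ![1,0,1,0]) (φ.symm ![1,0,1,0])
      rw [sB] at this
      simpa using this.symm
    rw [fC] at h1
    have := congrFun h1 0
    simp at this

/-- An algebra with a basis multiplying by the table is isomorphic to the model. -/
lemma iso_of_table {L : Type u} [AddCommGroup L] [Module ℂ L] (br : Bil L) (c1 c2 : ℂ)
    (B : Basis (Fin 4) ℂ L)
    (hB : ∀ i j, br (B i) (B j) = table16 c1 c2 B i j)
    (b : Bil (Fin 4 → ℂ)) (h : ∀ i j : Fin 4, b (Pi.single i 1) (Pi.single j 1) =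
      table16 c1 c2 (fun t => Pi.single t 1) i j) : AlgIso br b := by
  refine ⟨B.equivFun, ?_⟩
  have key : br.compr₂ B.equivFun.toLinearMap =
      b.compl₁₂ B.equivFun.toLinearMap B.equivFun.toLinearMap := by
    apply B.ext; intro i; apply B.ext; intro j
    have e : ∀ i, B.equivFun (B i) = Pi.single i 1 := by
      intro i; funext k; simp [Pi.single_apply, eq_comm]
    simp only [LinearMap.compr₂_apply, LinearMap.compl₁₂_apply, LinearEquiv.coe_coe, e, h, hB]
    unfold table16
    split_ifs <;> simp only [map_smul, e, map_zero]
  intro x y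
  exact LinearMap.congr_fun (LinearMap.congr_fun key x) y

lemma mem_of_nil {L : Type u} [AddCommGroup L] [Module ℂ L] (br : Bil L)
    (N : Submodule ℂ L) (hN : IsNilradical br N) (hNab : IsAbelianIn br N) (w : L)
    (hI : ∀ z, br w z ∈ N ⊔ span ℂ {w} ∧ br z w ∈ N ⊔ span ℂ {w})
    (hww : br w w ∈ N) (hnil : ∀ n ∈ N, br (br n w) w = 0) : w ∈ N := by
  obtain ⟨⟨-, hid⟩, -, hmax⟩ := hN
  have hr : ∀ n ∈ N, ∀ z, br n z ∈ N := fun n hn z => (hid n hn z trivial).1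
  have hl : ∀ n ∈ N, ∀ z, br z n ∈ N := fun n hn z => (hid n hn z trivial).2
  refine hmax (N ⊔ span ℂ {w}) ⟨le_top, ?_⟩ ?_ (mem_sup_right (mem_span_singleton_self w))
  · intro p hp z _
    obtain ⟨n, hn, m, hm, rfl⟩ := mem_sup.1 hp
    obtain ⟨t, rfl⟩ := mem_span_singleton.1 hm
    simp only [map_add, map_smul, LinearMap.add_apply, LinearMap.smul_apply]
    exact ⟨add_mem (mem_sup_left (hr n hn z)) (smul_mem _ _ (hI z).1),
      add_mem (mem_sup_left (hl n hn z)) (smul_mem _ _ (hI z).2)⟩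
  · have h1 : lcs br (N ⊔ span ℂ {w}) 1 ≤ N := by
      refine span_le.2 ?_
      rintro _ ⟨p, hp, q, hq, rfl⟩
      obtain ⟨n, hn, m, hm, rfl⟩ := mem_sup.1 hp
      obtain ⟨t, rfl⟩ := mem_span_singleton.1 hm
      obtain ⟨n', hn', m', hm', rfl⟩ := mem_sup.1 hq
      obtain ⟨t', rfl⟩ := mem_span_singleton.1 hm'
      simp only [map_add, map_smul, LinearMap.add_apply, LinearMap.smul_apply]
      exact add_mem (add_mem (hr n hn _) (smul_mem _ _ (hl n' hn' _)))
        (smul_mem _ _ (add_mem (hr n hn _) (smul_mem _ _ hww)))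
    have h2 : lcs br (N ⊔ span ℂ {w}) 2 ≤ N ⊓ LinearMap.ker (br.flip w) := by
      refine span_le.2 ?_
      rintro _ ⟨p, hp, q, hq, rfl⟩
      have hp := h1 hp
      obtain ⟨n', hn', m', hm', rfl⟩ := mem_sup.1 hq
      obtain ⟨t', rfl⟩ := mem_span_singleton.1 hm'
      refine ⟨hr p hp _, ?_⟩
      simp [hNab p hp n' hn', hnil p hp]
    refine ⟨3, le_bot_iff.1 (span_le.2 ?_)⟩
    rintro _ ⟨p, hp, q, hq, rfl⟩
    obtain ⟨hp, hp'⟩ := h2 hp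
    have hp' : br p w = 0 := hp'
    obtain ⟨n', hn', m', hm', rfl⟩ := mem_sup.1 hq
    obtain ⟨t', rfl⟩ := mem_span_singleton.1 hm'
    simp [hNab p hp n' hn', hp']

lemma sq_zero_of_comm {V : Type u} [AddCommGroup V] [Module ℂ V]
    (hV : finrank ℂ V = 2) (A B : V →ₗ[ℂ] V) (h : A = B ∘ₗ A - A ∘ₗ B) : A ∘ₗ A = 0 := by
  have : FiniteDimensional ℂ V := FiniteDimensional.of_finrank_pos (by omega)
  let b := finBasisOfFinrankEq ℂ V hV
  apply (LinearMap.toMatrix b b).injective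
  have h' := congrArg (LinearMap.toMatrix b b) h
  rw [map_sub, LinearMap.toMatrix_comp b b b, LinearMap.toMatrix_comp b b b] at h'
  rw [LinearMap.toMatrix_comp b b b, map_zero]
  generalize LinearMap.toMatrix b b A = P at *
  generalize LinearMap.toMatrix b b B = Q at *
  have h00 := congrFun (congrFun h' 0) 0
  have h01 := congrFun (congrFun h' 0) 1
  have h10 := congrFun (congrFun h' 1) 0
  have h11 := congrFun (congrFun h' 1) 1
  simp only [Matrix.sub_apply, Matrix.mul_apply, Fin.sum_univ_two] at h00 h01 h10 h11
  have tr : P 1 1 = - P 0 0 := by linear_combination h00 + h11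
  have d : P 0 0 * P 0 0 + P 0 1 * P 1 0 = 0 := by
    rw [tr] at h01 h10 h11
    linear_combination (1/2) * (P 0 0 * h00 + P 0 1 * h10 + P 1 0 * h01 - P 0 0 * h11)
  ext i j
  fin_cases i <;> fin_cases j <;> simp [Matrix.mul_apply, Fin.sum_univ_two, tr] <;>
    first | ring1 | linear_combination d

lemma trace_zero {V : Type u} [AddCommGroup V] [Module ℂ V]
    (hV : finrank ℂ V = 2) (A : V →ₗ[ℂ] V) (h : LinearMap.trace ℂ V A = 0) :
    ∃ r : ℂ, A ∘ₗ A = (r * r) • LinearMap.id := by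
  have : FiniteDimensional ℂ V := FiniteDimensional.of_finrank_pos (by omega)
  let b := finBasisOfFinrankEq ℂ V hV
  rw [LinearMap.trace_eq_matrix_trace ℂ b, Matrix.trace_fin_two] at h
  let P := LinearMap.toMatrix b b A
  have h : P 0 0 + P 1 1 = 0 := h
  obtain ⟨r, hr⟩ := IsAlgClosed.exists_eq_mul_self (P 0 0 * P 0 0 + P 0 1 * P 1 0)
  refine ⟨r, (LinearMap.toMatrix b b).injective ?_⟩
  rw [LinearMap.toMatrix_comp b b b, map_smul, LinearMap.toMatrix_id, ← hr]
  change P * P = _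
  have h1 : P 1 1 = - P 0 0 := by linear_combination h
  ext i j
  fin_cases i <;> fin_cases j <;> simp [Matrix.mul_apply, Fin.sum_univ_two, h1] <;> ring

/-- The computational heart. -/
lemma heart {L : Type u} [AddCommGroup L] [Module ℂ L] (br : Bil L) (hleib : IsLeibniz br)
    (hdim : finrank ℂ L = 4)
    (e f x y : L) (hind : ∀ a b : ℂ, a • e + b • f = 0 → a = 0 ∧ b = 0)
    (hsq : ∀ u v, ∃ a b : ℂ, br u v = a • e + b • f)
    (hee : br e e = 0) (hef : br e f = 0) (hfe : br f e = 0) (hff : br f f = 0)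
    (hex : br e x = e) (hfx : br f x = 0) (hey : br e y = 0) (hfy : br f y = f) :
    ∃ c d : ℂ, (c = 0 ∨ c = -1) ∧ (d = 0 ∨ d = -1) ∧ ∃ B : Basis (Fin 4) ℂ L,
      ∀ i j, br (B i) (B j) = table16 c d B i j := by
  have : FiniteDimensional ℂ L := FiniteDimensional.of_finrank_pos (by omega)
  have hind2 : ∀ a b a' b' : ℂ, a • e + b • f = a' • e + b' • f → a = a' ∧ b = b' := by
    intro a b a' b' h
    have := hind (a - a') (b - b') (by rw [sub_smul, sub_smul]; linear_combination (norm := module) h)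
    exact ⟨sub_eq_zero.1 this.1, sub_eq_zero.1 this.2⟩
  obtain ⟨a, a', hxe⟩ := hsq x e
  obtain ⟨b', b, hxf⟩ := hsq x f
  obtain ⟨c, c', hye⟩ := hsq y e
  obtain ⟨d', d, hyf⟩ := hsq y f
  obtain ⟨p1, p2, hxx⟩ := hsq x x
  obtain ⟨q1, q2, hxy⟩ := hsq x y
  obtain ⟨r1, r2, hyx⟩ := hsq y x
  obtain ⟨s1, s2, hyy⟩ := hsq y y
  -- a packaged use of the Leibniz identity
  have L1 := hleib x e x
  have L2 := hleib x f y
  have L3 := hleib y e x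
  have L4 := hleib y f y
  simp only [hxe, hxf, hye, hyf, hxx, hxy, hyx, hyy, hex, hfx, hey, hfy, hee, hef, hfe, hff,
    map_add, map_smul, LinearMap.add_apply, LinearMap.smul_apply, smul_zero,
    add_zero, zero_add] at L1 L2 L3 L4
  have a0 : a' = 0 := ((hind2 a 0 a a' (by simpa using L1)).2).symm
  have b0 : b' = 0 := ((hind2 0 b b' b (by simpa using L2)).1).symm
  have c0 : c' = 0 := ((hind2 c 0 c c' (by simpa using L3)).2).symm
  have d0 : d' = 0 := ((hind2 0 d d' d (by simpa using L4)).1).symm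
  subst a0 b0 c0 d0
  simp only [zero_smul, add_zero, zero_add] at hxe hxf hye hyf
  have he : ∀ t : ℂ, t • e = 0 → t = 0 := fun t h => (hind t 0 (by simpa using h)).1
  have hf : ∀ t : ℂ, t • f = 0 → t = 0 := fun t h => (hind 0 t (by simpa using h)).2
  have S : ∀ z u v, br z (br u v) + br z (br v u) = 0 := by
    intro z u v
    linear_combination (norm := module) - hleib z u v - hleib z v u
  have S1 := S x e x
  have S2 := S y e x
  have S3 := S x e y
  have S4 := S x f y
  have S5 := S y f x
  have S6 := S y f y
  simp only [hxe, hxf, hye, hyf, hex, hfx, hey, hfy, map_smul, map_zero, zero_add, smul_smul]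
    at S1 S2 S3 S4 S5 S6
  have ha : a + a * a = 0 := he _ (by linear_combination (norm := module) S1)
  have hc1 : c + a * c = 0 := he _ (by linear_combination (norm := module) S2)
  have hc2 : c * a = 0 := he _ (by linear_combination (norm := module) S3)
  have hb1 : b + d * b = 0 := hf _ (by linear_combination (norm := module) S4)
  have hb2 : b * d = 0 := hf _ (by linear_combination (norm := module) S5)
  have hd : d + d * d = 0 := hf _ (by linear_combination (norm := module) S6)
  have c0 : c = 0 := by linear_combination hc1 - hc2
  have b0 : b = 0 := by linear_combination hb1 - hb2
  subst b0 c0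
  have S7 := S x x x
  have S8 := S y y y
  have M9 := hleib x x y
  have M10 := hleib x y x
  have M11 := hleib y y x
  have M12 := hleib y x y
  simp only [hxe, hxf, hye, hyf, hxx, hxy, hyx, hyy, hex, hfx, hey, hfy,
    map_add, map_smul, LinearMap.add_apply, LinearMap.smul_apply, smul_zero, zero_smul,
    add_zero, zero_add, smul_smul] at S7 S8 M9 M10 M11 M12
  have hp1 : 2 * (p1 * a) = 0 := he _ (by linear_combination (norm := module) S7)
  have hs2 : 2 * (s2 * d) = 0 := hf _ (by linear_combination (norm := module) S8)
  have hp2 := (hind (q1 + q1 * a) (-p2) (by linear_combination (norm := module) -M9)).2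
  have hs1 := (hind (-s1) (r2 + r2 * d) (by linear_combination (norm := module) -M11)).1
  have hq1 := (hind (q1 - r1 * a) (-p2) (by linear_combination (norm := module) M10)).1
  have hr2 := (hind (-s1) (r2 - q2 * d) (by linear_combination (norm := module) M12)).2
  have hp2 : p2 = 0 := by linear_combination -hp2
  have hs1 : s1 = 0 := by linear_combination -hs1
  have hp1 : p1 * a = 0 := by linear_combination hp1 / 2
  have hs2 : s2 * d = 0 := by linear_combination hs2 / 2
  have hq1 : q1 = r1 * a := by linear_combination hq1
  have hr2 : r2 = q2 * d := by linear_combination hr2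
  subst hp2 hs1 hq1 hr2
  obtain ⟨x', hx'⟩ : ∃ x', x' = x - p1 • e - q2 • f := ⟨_, rfl⟩
  obtain ⟨y', hy'⟩ : ∃ y', y' = y - r1 • e - s2 • f := ⟨_, rfl⟩
  have T1 : br e x' = e := by simp [hx', hex, hee, hef]
  have T2 : br f x' = 0 := by simp [hx', hfx, hfe, hff]
  have T3 : br e y' = 0 := by simp [hy', hey, hee, hef]
  have T4 : br f y' = f := by simp [hy', hfy, hfe, hff]
  have T5 : br x' e = a • e := by simp [hx', hxe, hee, hfe]
  have T6 : br x' f = 0 := by simp [hx', hxf, hff, hef]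
  have T7 : br y' e = 0 := by simp [hy', hye, hee, hfe]
  have T8 : br y' f = d • f := by simp [hy', hyf, hff, hef]
  have T9 : br x' x' = 0 := by
    rw [hx', map_sub, map_sub, map_smul, map_smul, ← hx', T5, T6, hx']
    simp only [map_sub, map_smul, LinearMap.sub_apply, LinearMap.smul_apply, hxx, hex, hfx,
      smul_smul, hp1]
    module
  have T10 : br x' y' = 0 := by
    rw [hy', map_sub, map_sub, map_smul, map_smul, T5, T6, hx']
    simp only [map_sub, map_smul, LinearMap.sub_apply, LinearMap.smul_apply, hxy, hey, hfy,
      smul_smul]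
    module
  have T11 : br y' x' = 0 := by
    rw [hx', map_sub, map_sub, map_smul, map_smul, T7, T8, hy']
    simp only [map_sub, map_smul, LinearMap.sub_apply, LinearMap.smul_apply, hyx, hex, hfx,
      smul_smul]
    module
  have T12 : br y' y' = 0 := by
    rw [hy', map_sub, map_sub, map_smul, map_smul, ← hy', T7, T8, hy']
    simp only [map_sub, map_smul, LinearMap.sub_apply, LinearMap.smul_apply, hyy, hey, hfy,
      smul_smul, hs2]
    module
  have li : LinearIndependent ℂ ![e, f, x', y'] := by
    rw [Fintype.linearIndependent_iff]
    intro g hg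
    simp only [Fin.sum_univ_four, Matrix.cons_val] at hg
    have g1 := congrArg (br e) hg
    have g2 := congrArg (br f) hg
    simp only [map_add, map_smul, map_zero, hee, hef, hfe, hff, T1, T2, T3, T4, smul_zero,
      add_zero, zero_add] at g1 g2
    have z2 := he _ g1
    have z3 := hf _ g2
    rw [z2, z3] at hg
    have := hind (g 0) (g 1) (by linear_combination (norm := module) hg)
    intro i; fin_cases i
    exacts [this.1, this.2, z2, z3]
  refine ⟨a, d, ?_, ?_, basisOfLinearIndependentOfCardEqFinrank li (by simp [hdim]), ?_⟩
  · have : a * (a + 1) = 0 := by linear_combination ha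
    rcases mul_eq_zero.1 this with h | h
    exacts [Or.inl h, Or.inr (by linear_combination h)]
  · have : d * (d + 1) = 0 := by linear_combination hd
    rcases mul_eq_zero.1 this with h | h
    exacts [Or.inl h, Or.inr (by linear_combination h)]
  · rw [coe_basisOfLinearIndependentOfCardEqFinrank]
    intro i j
    fin_cases i <;> fin_cases j <;> 
      simp [table16, hee, hef, hfe, hff, T1, T2, T3, T4, T5, T6, T7, T8, T9, T10, T11, T12]

lemma der_le {L : Type u} [AddCommGroup L] [Module ℂ L] [FiniteDimensional ℂ L]
    (br : Bil L) (hleib : IsLeibniz br) (hsolv : IsSolvableSub br (⊤ : Submodule ℂ L))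
    (hdim : finrank ℂ L = 4)
    (N : Submodule ℂ L) (hN : IsNilradical br N)
    (hNdim : finrank ℂ N = 2) (hNab : IsAbelianIn br N) : ∀ u v, br u v ∈ N := by
  by_contra hcon
  push Not at hcon
  obtain ⟨u, v, huv⟩ := hcon
  obtain ⟨w, hw⟩ : ∃ w, w = br u v := ⟨_, rfl⟩
  rw [← hw] at huv
  have hr : ∀ n ∈ N, ∀ z, br n z ∈ N := fun n hn z => (hN.1.2 n hn z trivial).1
  have hl : ∀ n ∈ N, ∀ z, br z n ∈ N := fun n hn z => (hN.1.2 n hn z trivial).2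
  have hD : bspan br ⊤ ⊤ ⊔ N ≠ ⊤ := by
    intro hD
    obtain ⟨m, hm⟩ := hsolv
    have key : ∀ k, derS br ⊤ k ⊔ N = ⊤ := by
      intro k
      induction k with
      | zero => simp [derS]
      | succ k ih =>
        refine top_le_iff.1 (hD.ge.trans ?_)
        refine sup_le (span_le.2 ?_) le_sup_right
        rintro _ ⟨p, -, q, -, rfl⟩
        obtain ⟨s, hs, n, hn, rfl⟩ := mem_sup.1 (by rw [ih]; trivial : p ∈ derS br ⊤ k ⊔ N)
        obtain ⟨t, ht, n', hn', rfl⟩ := mem_sup.1 (by rw [ih]; trivial : q ∈ derS br ⊤ k ⊔ N)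
        have : br (s + n) (t + n') = br s t + (br s n' + br n (t + n')) := by
          simp only [map_add, LinearMap.add_apply]; abel
        rw [this]
        exact add_mem (mem_sup_left (subset_span ⟨s, hs, t, ht, rfl⟩))
          (mem_sup_right (add_mem (hl _ hn' _) (hr _ hn _)))
    have := key m
    rw [hm, bot_sup_eq] at this
    rw [this, finrank_top] at hNdim
    omega
  have hle : N ⊔ span ℂ {w} ≤ bspan br ⊤ ⊤ ⊔ N := by
    refine sup_le le_sup_right (le_sup_of_le_left (span_le.2 ?_))
    rintro _ rfl
    exact subset_span ⟨u, trivial, v, trivial, hw⟩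
  have hlt : N < N ⊔ span ℂ {w} := by
    refine lt_of_le_of_ne le_sup_left fun h => huv ?_
    rw [h]; exact mem_sup_right (mem_span_singleton_self w)
  have f1 := finrank_lt_finrank_of_lt hlt
  have f2 := finrank_lt hD
  have hEq : N ⊔ span ℂ {w} = bspan br ⊤ ⊤ ⊔ N :=
    eq_of_le_of_finrank_le hle (by omega)
  have hall : ∀ p q, br p q ∈ N ⊔ span ℂ {w} := by
    intro p q; rw [hEq]
    exact mem_sup_left (subset_span ⟨p, trivial, q, trivial, rfl⟩)
  have hK : N ⊔ span ℂ {w} ≠ ⊤ := hEq ▸ hD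
  obtain ⟨y, hy⟩ : ∃ y, y ∉ N ⊔ span ℂ {w} := by
    by_contra h; push Not at h; exact hK (eq_top_iff'.2 h)
  have hlt2 : N ⊔ span ℂ {w} < N ⊔ span ℂ {w} ⊔ span ℂ {y} := by
    refine lt_of_le_of_ne le_sup_left fun h => hy ?_
    rw [h]; exact mem_sup_right (mem_span_singleton_self y)
  have f3 := finrank_lt_finrank_of_lt hlt2
  have hTop : N ⊔ span ℂ {w} ⊔ span ℂ {y} = ⊤ := eq_top_of_finrank_eq (by
    have := Submodule.finrank_le (N ⊔ span ℂ {w} ⊔ span ℂ {y}); omega)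
  have hform : ∀ p q, ∃ n ∈ N, ∃ t : ℂ, br p q = n + t • w := by
    intro p q
    obtain ⟨n, hn, m, hm, h⟩ := mem_sup.1 (hall p q)
    obtain ⟨t, rfl⟩ := mem_span_singleton.1 hm
    exact ⟨n, hn, t, h.symm⟩
  have hS : ∀ z p, br z (br p p) = 0 := by
    intro z p
    have := hleib z p p
    simpa using this
  have hww : br w w ∈ N := by
    obtain ⟨n, hn, t, h⟩ := hform w w
    have h2 := hS w w
    rw [h, map_add, map_smul, h] at h2
    have h3 : (t * t) • w ∈ N := by
      have : (t * t) • w = - (br w n + t • n) := by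
        linear_combination (norm := module) h2
      rw [this]
      exact neg_mem (add_mem (hl _ hn _) (smul_mem _ _ hn))
    have h4 : t * t = 0 := by
      by_contra h0
      exact huv ((smul_mem_iff _ h0).1 h3)
    have h5 : t = 0 := by simpa using h4
    rw [h, h5]; simpa using hn
  apply huv
  refine mem_of_nil br N hN hNab w (fun z => ⟨hall _ _, hall _ _⟩) hww ?_
  -- find the commutator expression
  obtain ⟨n1, hn1, α, h1⟩ := hform w y
  obtain ⟨n2, hn2, β, h2⟩ := hform y w
  obtain ⟨n3, hn3, γ, h3⟩ := hform y y
  have hcomm : ∃ c : ℂ, ∀ n ∈ N, br n w = c • (br (br n w) y - br (br n y) w) := by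
    by_cases hα : α = 0
    · by_cases hβ : β = 0
      · by_cases hγ : γ = 0
        · exfalso
          apply huv
          rw [hα, zero_smul, add_zero] at h1
          rw [hβ, zero_smul, add_zero] at h2
          rw [hγ, zero_smul, add_zero] at h3
          have dec : ∀ p, ∃ n ∈ N, ∃ s t : ℂ, p = n + s • w + t • y := by
            intro p
            obtain ⟨k, hk, m, hm, h⟩ :=
              mem_sup.1 (hTop ▸ mem_top : p ∈ N ⊔ span ℂ {w} ⊔ span ℂ {y})
            obtain ⟨n, hn, m', hm', h'⟩ := mem_sup.1 hk
            obtain ⟨t, rfl⟩ := mem_span_singleton.1 hm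
            obtain ⟨s, rfl⟩ := mem_span_singleton.1 hm'
            exact ⟨n, hn, s, t, by rw [h', h]⟩
          obtain ⟨n, hn, s, t, rfl⟩ := dec u
          obtain ⟨n', hn', s', t', rfl⟩ := dec v
          rw [hw, map_add, map_add]
          simp only [map_add, map_smul, LinearMap.add_apply, LinearMap.smul_apply, h1, h2, h3]
          have a1 := hl _ hn' n
          have a2 := hl _ hn' w
          have a3 := hl _ hn' y
          have a4 := hr _ hn w
          have a5 := hr _ hn y
          repeat' first | apply add_mem | apply smul_mem | assumption
        · refine ⟨0, fun n hn => ?_⟩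
          have h4 := hS n y
          rw [h3, map_add, hNab _ hn _ hn3, zero_add, map_smul] at h4
          rw [zero_smul]
          exact (smul_eq_zero.1 h4).resolve_left hγ
      · refine ⟨-β⁻¹, fun n hn => ?_⟩
        have h4 := hleib n y w
        rw [h2, map_add, hNab _ hn _ hn2, zero_add, map_smul] at h4
        have : br (br n w) y - br (br n y) w = -(β • br n w) := by
          rw [h4]; abel
        rw [this, smul_neg, neg_smul, neg_neg, smul_smul, inv_mul_cancel₀ hβ, one_smul]
    · refine ⟨α⁻¹, fun n hn => ?_⟩
      have h4 := hleib n w y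
      rw [h1, map_add, hNab _ hn _ hn1, zero_add, map_smul] at h4
      rw [h4, add_sub_cancel_left, smul_smul, inv_mul_cancel₀ hα, one_smul]
  obtain ⟨c, hc⟩ := hcomm
  have key := sq_zero_of_comm hNdim ((br.flip w).restrict (p := N) (q := N) fun n hn => hr n hn w)
    (c • (br.flip y).restrict (p := N) (q := N) fun n hn => hr n hn y) (by
      ext n
      have h := hc n n.2
      rw [smul_sub, ← map_smul (br (br (n : L) w))] at h
      refine h.trans ?_
      rw [map_smul]
      have h2 : c • br (br (n : L) y) w = br (c • br (n : L) y) w := by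
        rw [map_smul, LinearMap.smul_apply]
      rw [h2]
      rfl)
  intro n hn
  have := congrArg Subtype.val (LinearMap.congr_fun key ⟨n, hn⟩)
  exact this

lemma exists_basis {L : Type u} [AddCommGroup L] [Module ℂ L] [FiniteDimensional ℂ L]
    (br : Bil L) (hleib : IsLeibniz br) (hsolv : IsSolvableSub br (⊤ : Submodule ℂ L))
    (hdim : finrank ℂ L = 4)
    (N : Submodule ℂ L) (hN : IsNilradical br N)
    (hNdim : finrank ℂ N = 2) (hNab : IsAbelianIn br N) :
    ∃ c d : ℂ, (c = 0 ∨ c = -1) ∧ (d = 0 ∨ d = -1) ∧ ∃ B : Basis (Fin 4) ℂ L,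
      ∀ i j, br (B i) (B j) = table16 c d B i j := by
  have hsq := der_le br hleib hsolv hdim N hN hNdim hNab
  have hnil : ∀ w, (∀ n ∈ N, br (br n w) w = 0) → w ∈ N := fun w h =>
    mem_of_nil br N hN hNab w
      (fun z => ⟨mem_sup_left (hsq _ _), mem_sup_left (hsq _ _)⟩) (hsq _ _) h
  have hcomm : ∀ n ∈ N, ∀ p q, br (br n p) q = br (br n q) p := by
    intro n hn p q
    rw [hleib n p q, hNab _ hn _ (hsq p q), add_zero]
  let T : L →ₗ[ℂ] (N →ₗ[ℂ] N) :=
    { toFun := fun z => (br.flip z).restrict (p := N) (q := N) fun n _ => hsq n z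
      map_add' := by intro p q; ext n; exact map_add (br (n : L)) p q
      map_smul' := by intro c p; ext n; exact map_smul (br (n : L)) c p }
  have hT : ∀ z (n : N), ((T z n : N) : L) = br n z := fun z n => rfl
  have hTc : ∀ p q n, T p (T q n) = T q (T p n) := by
    intro p q n
    apply Subtype.ext
    rw [hT, hT, hT, hT, hcomm n n.2]
  -- an element of trace zero outside `N`
  obtain ⟨z, hz, hzN⟩ : ∃ z, LinearMap.trace ℂ N (T z) = 0 ∧ z ∉ N := by
    by_contra hcon
    push Not at hcon
    have hle : LinearMap.ker ((LinearMap.trace ℂ N) ∘ₗ T) ≤ N := fun z hz => hcon z hz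
    have h1 := finrank_mono hle
    have h2 := LinearMap.finrank_range_add_finrank_ker ((LinearMap.trace ℂ N) ∘ₗ T)
    have h3 := Submodule.finrank_le (LinearMap.range ((LinearMap.trace ℂ N) ∘ₗ T))
    rw [finrank_self] at h3
    omega
  obtain ⟨r, hr⟩ := trace_zero hNdim (T z) hz
  have hr' : ∀ n, T z (T z n) = (r * r) • n := fun n => LinearMap.congr_fun hr n
  have hr0 : r ≠ 0 := by
    rintro rfl
    refine hzN (hnil z fun n hn => ?_)
    have := congrArg Subtype.val (hr' ⟨n, hn⟩)
    simpa [hT] using this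
  have hev : ∀ s : ℂ, s ≠ 0 → s * s = r * r → ∃ e : N, e ≠ 0 ∧ T z e = s • e := by
    intro s hs hss
    by_contra hcon
    push Not at hcon
    have h1 : ∀ n, T z n = (-s) • n := by
      intro n
      have h2 := mt (hcon (T z n + s • n)) (not_not.2 (by
        rw [map_add, map_smul, hr', ← hss]; module))
      linear_combination (norm := module) not_not.1 h2
    have h2 : T z = (-s) • LinearMap.id := LinearMap.ext h1
    rw [h2, map_smul, LinearMap.trace_id, hNdim] at hz
    simp [hs] at hz
  obtain ⟨e, he0, he⟩ := hev r hr0 rfl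
  obtain ⟨f, hf0, hf⟩ := hev (-r) (neg_ne_zero.2 hr0) (by ring)
  have hind : ∀ a b : ℂ, a • e + b • f = 0 → a = 0 ∧ b = 0 := by
    intro a b h
    have h' := congrArg (T z) h
    rw [map_add, map_smul, map_smul, he, hf, map_zero] at h'
    have h1 : (2 * r * a) • e = 0 := by linear_combination (norm := module) r • h + h'
    have h2 : (2 * r * b) • f = 0 := by linear_combination (norm := module) r • h - h'
    simpa [he0, hf0, hr0] using And.intro h1 h2
  have li : LinearIndependent ℂ ![e, f] := by
    rw [Fintype.linearIndependent_iff]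
    intro g hg
    simp only [Fin.sum_univ_two, Matrix.cons_val] at hg
    have := hind _ _ hg
    intro i; fin_cases i
    exacts [this.1, this.2]
  let b : Basis (Fin 2) ℂ N := basisOfLinearIndependentOfCardEqFinrank li (by simp [hNdim])
  have hb0 : b 0 = e := by simp [b]
  have hb1 : b 1 = f := by simp [b]
  have hrep : ∀ n : N, n = b.repr n 0 • e + b.repr n 1 • f := by
    intro n
    have := b.sum_repr n
    rw [Fin.sum_univ_two, hb0, hb1] at this
    exact this.symm
  have hTe : ∀ p, T p e = b.repr (T p e) 0 • e := by
    intro p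
    have h1 := hrep (T p e)
    have h2 := hTc z p e
    rw [he, map_smul] at h2
    rw [h1, map_add, map_smul, map_smul, he, hf] at h2
    have h3 : (2 * r * b.repr (T p e) 1) • f = 0 := by
      linear_combination (norm := module) -h2
    have h4 : b.repr (T p e) 1 = 0 := by simpa [hr0, hf0] using h3
    rw [h4, zero_smul, add_zero] at h1
    exact h1
  have hTf : ∀ p, T p f = b.repr (T p f) 1 • f := by
    intro p
    have h1 := hrep (T p f)
    have h2 := hTc z p f
    rw [hf, map_smul] at h2
    rw [h1, map_add, map_smul, map_smul, he, hf] at h2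
    have h3 : (2 * r * b.repr (T p f) 0) • e = 0 := by
      linear_combination (norm := module) h2
    have h4 : b.repr (T p f) 0 = 0 := by simpa [hr0, he0] using h3
    rw [h4, zero_smul, zero_add] at h1
    exact h1
  let χ : L →ₗ[ℂ] ℂ × ℂ :=
    { toFun := fun p => (b.repr (T p e) 0, b.repr (T p f) 1)
      map_add' := by intro p q; simp
      map_smul' := by intro c p; simp }
  have hker : LinearMap.ker χ ≤ N := by
    intro p hp
    have hp : (b.repr (T p e) 0, b.repr (T p f) 1) = ((0 : ℂ), (0 : ℂ)) := hp
    obtain ⟨h1, h2⟩ := Prod.mk.inj hp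
    have e1 := hTe p
    have f1 := hTf p
    rw [h1, zero_smul] at e1
    rw [h2, zero_smul] at f1
    refine hnil p fun n hn => ?_
    have h3 : T p ⟨n, hn⟩ = 0 := by
      rw [hrep ⟨n, hn⟩, map_add, map_smul, map_smul, e1, f1]; simp
    have h4 : br n p = 0 := congrArg Subtype.val h3
    simp [h4]
  have hsurj : LinearMap.range χ = ⊤ := by
    apply eq_top_of_finrank_eq
    have h1 := finrank_mono hker
    have h2 := LinearMap.finrank_range_add_finrank_ker χ
    have h3 := Submodule.finrank_le (LinearMap.range χ)
    rw [finrank_prod, finrank_self] at *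
    omega
  obtain ⟨x, hx⟩ := LinearMap.range_eq_top.1 hsurj (1, 0)
  obtain ⟨y, hy⟩ := LinearMap.range_eq_top.1 hsurj (0, 1)
  obtain ⟨x1, x2⟩ := Prod.mk.inj (show (b.repr (T x e) 0, b.repr (T x f) 1) = (1, 0) from hx)
  obtain ⟨y1, y2⟩ := Prod.mk.inj (show (b.repr (T y e) 0, b.repr (T y f) 1) = (0, 1) from hy)
  have ex := hTe x
  have fx := hTf x
  have ey := hTe y
  have fy := hTf y
  rw [x1, one_smul] at ex
  rw [x2, zero_smul] at fx
  rw [y1, zero_smul] at ey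
  rw [y2, one_smul] at fy
  refine heart br hleib hdim e f x y ?_ ?_ (hNab _ e.2 _ e.2) (hNab _ e.2 _ f.2)
    (hNab _ f.2 _ e.2) (hNab _ f.2 _ f.2) (congrArg Subtype.val ex) (congrArg Subtype.val fx)
    (congrArg Subtype.val ey) (congrArg Subtype.val fy)
  · intro s t h
    exact hind s t (Subtype.ext (by simpa using h))
  · intro p q
    exact ⟨_, _, congrArg Subtype.val (hrep ⟨br p q, hsq p q⟩)⟩

/-- Theorem 5.5. A `4`-dimensional complex solvable Leibniz algebra
whose nilradical is `2`-dimensional abelian is isomorphic to exactly one of the three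
pairwise non-isomorphic algebras `R₄¹`, `R₄²`, `R₄³`. -/
theorem stmt16 {L : Type u} [AddCommGroup L] [Module ℂ L] [FiniteDimensional ℂ L]
    (br : Bil L) (hleib : IsLeibniz br) (hsolv : IsSolvableSub br (⊤ : Submodule ℂ L))
    (hdim : finrank ℂ L = 4)
    (N : Submodule ℂ L) (hN : IsNilradical br N)
    (hNdim : finrank ℂ N = 2) (hNab : IsAbelianIn br N)
    (brA brB brC : Bil (Fin 4 → ℂ))
    (hbrA : ∀ i j : Fin 4, brA (Pi.single i 1) (Pi.single j 1) =
      table16 0 0 (fun t => Pi.single t 1) i j)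
    (hbrB : ∀ i j : Fin 4, brB (Pi.single i 1) (Pi.single j 1) =
      table16 (-1) (-1) (fun t => Pi.single t 1) i j)
    (hbrC : ∀ i j : Fin 4, brC (Pi.single i 1) (Pi.single j 1) =
      table16 0 (-1) (fun t => Pi.single t 1) i j) :
    (AlgIso br brA ∨ AlgIso br brB ∨ AlgIso br brC) ∧
      ¬ AlgIso brA brB ∧ ¬ AlgIso brA brC ∧ ¬ AlgIso brB brC := by
  refine ⟨?_, not_iso brA brB brC hbrA hbrB hbrC⟩
  obtain ⟨c, d, hc, hd, B, hB⟩ := exists_basis br hleib hsolv hdim N hN hNdim hNab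
  rcases hc with rfl | rfl <;> rcases hd with rfl | rfl
  · exact Or.inl (iso_of_table br _ _ B hB brA hbrA)
  · exact Or.inr (Or.inr (iso_of_table br _ _ B hB brC hbrC))
  · refine Or.inr (Or.inr ?_)
    let σ : Fin 4 ≃ Fin 4 := ⟨![1, 0, 3, 2], ![1, 0, 3, 2], by decide, by decide⟩
    refine iso_of_table br _ _ (B.reindex σ) ?_ brC hbrC
    intro i j
    have h0 : σ.symm 0 = 1 := rfl
    have h1 : σ.symm 1 = 0 := rfl
    have h2 : σ.symm 2 = 3 := rfl
    have h3 : σ.symm 3 = 2 := rfl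
    fin_cases i <;> fin_cases j <;> simp [hB, table16, h0, h1, h2, h3]
  · exact Or.inr (Or.inl (iso_of_table br _ _ B hB brB hbrB))
end

section
/- Let n ≥ 4 and let L¹ be the n-dimensional complex Leibniz algebra with basis e_1, …, e_n and nonzero products [e_1,e_1] = e_2, [e_i,e_1] = e_{i+1} and [e_1,e_i] = −e_{i+1} for 3 ≤ i ≤ n−1 (all other basis products zero). Then up to isomorphism there is exactly one indecomposable (n+2)-dimensional complex solvable Leibniz algebra whose nilradical is isomorphic to L¹; it admits a basis {e_1, …, e_n, x_1, x_2} whose nonzero products are exactly: [e_1,e_1]=e_2, [e_i,e_1]=−[e_1,e_i]=e_{i+1} (3≤i≤n−1), [e_1,x_1]=−[x_1,e_1]=e_1, [e_2,x_1]=2·e_2, [e_i,x_1]=−[x_1,e_i]=(i−3)·e_i (4≤i≤n), [e_3,x_2]=−[x_2,e_3]=e_3, [e_i,x_2]=−[x_2,e_i]=e_i (4≤i≤n). -/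
open Module Submodule

universe u v w

variable {L : Type u} [AddCommGroup L] [Module ℂ L]

/-- The multiplication table of the nilpotent algebra `L¹`
(`[e_1,e_1] = e_2`, `[e_i,e_1] = e_{i+1}`, `[e_1,e_i] = -e_{i+1}` for `3 ≤ i ≤ n-1`),
written `0`-based: `e_{i+1} ↦ v i`. -/
def tableL1 (n : ℕ) {W : Type v} [AddCommGroup W] [Module ℂ W]
    (v : Fin n → W) (i j : Fin n) : W :=
  let u : ℕ → W := fun m => if h : m < n then v ⟨m, h⟩ else 0
  if (j : ℕ) = 0 then
    (if (i : ℕ) = 0 then u 1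
     else if 2 ≤ (i : ℕ) ∧ (i : ℕ) ≤ n - 2 then u ((i : ℕ) + 1)
     else 0)
  else if (i : ℕ) = 0 ∧ 2 ≤ (j : ℕ) ∧ (j : ℕ) ≤ n - 2 then -u ((j : ℕ) + 1)
  else 0

/-- The multiplication table of the solvable algebra `q_{n+2,1}` (in the basis of
Example 5.1), `0`-based: `e_{i+1} ↦ v i`, `x₁ ↦ v n`, `x₂ ↦ v (n+1)`. -/
def table18 (n : ℕ) {W : Type v} [AddCommGroup W] [Module ℂ W]
    (v : Fin (n + 2) → W) (i j : Fin (n + 2)) : W :=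
  let u : ℕ → W := fun m => if h : m < n + 2 then v ⟨m, h⟩ else 0
  if (j : ℕ) = 0 then
    (if (i : ℕ) = 0 then u 1
     else if 2 ≤ (i : ℕ) ∧ (i : ℕ) ≤ n - 2 then u ((i : ℕ) + 1)
     else if (i : ℕ) = n then -u 0
     else 0)
  else if (j : ℕ) = n then
    (if (i : ℕ) = 0 then u 0
     else if (i : ℕ) = 1 then (2 : ℂ) • u 1
     else if 3 ≤ (i : ℕ) ∧ (i : ℕ) ≤ n - 1 then (((i : ℕ) : ℂ) - 2) • u (i : ℕ)
     else 0)
  else if (j : ℕ) = n + 1 then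
    (if 2 ≤ (i : ℕ) ∧ (i : ℕ) ≤ n - 1 then u (i : ℕ) else 0)
  else if (i : ℕ) = 0 ∧ 2 ≤ (j : ℕ) ∧ (j : ℕ) ≤ n - 2 then -u ((j : ℕ) + 1)
  else if (i : ℕ) = n ∧ 3 ≤ (j : ℕ) ∧ (j : ℕ) ≤ n - 1 then
    -((((j : ℕ) : ℂ) - 2) • u (j : ℕ))
  else if (i : ℕ) = n + 1 ∧ 2 ≤ (j : ℕ) ∧ (j : ℕ) ≤ n - 1 then -u (j : ℕ)
  else 0

section PartOne

/-- Coordinates extended by zero to all natural numbers. -/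
def cx {m : ℕ} (x : Fin m → ℂ) (k : ℕ) : ℂ := if h : k < m then x ⟨k, h⟩ else 0

lemma cx_add {m : ℕ} (x y : Fin m → ℂ) (k : ℕ) : cx (x + y) k = cx x k + cx y k := by
  unfold cx; split_ifs <;> simp

lemma cx_smul {m : ℕ} (a : ℂ) (x : Fin m → ℂ) (k : ℕ) : cx (a • x) k = a * cx x k := by
  unfold cx; split_ifs <;> simp

lemma cx_single {m : ℕ} (i : Fin m) (k : ℕ) :
    cx (Pi.single i (1 : ℂ)) k = if k = (i : ℕ) then 1 else 0 := by
  unfold cx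
  by_cases h : k < m
  · simp [h, Pi.single_apply, Fin.ext_iff]
  · have : k ≠ i := by have := i.2; omega
    simp [h, this]

lemma cx_fin {m : ℕ} (x : Fin m → ℂ) (k : Fin m) : cx x k = x k := by
  unfold cx; simp

lemma cx_ext {m : ℕ} {x y : Fin m → ℂ} (h : ∀ k < m, cx x k = cx y k) : x = y := by
  funext k
  rw [← cx_fin x, ← cx_fin y, h k k.2]

/-- The coordinates of the product. -/
noncomputable def qc (n : ℕ) (x y : Fin (n + 2) → ℂ) (m : ℕ) : ℂ :=
  if m = 0 then cx x 0 * cx y n - cx x n * cx y 0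
  else if m = 1 then cx x 0 * cx y 0 + 2 * (cx x 1 * cx y n)
  else if m < n then
    (if m = 2 then 0 else cx x (m - 1) * cx y 0 - cx x 0 * cx y (m - 1)) +
      ((m : ℂ) - 2) * (cx x m * cx y n - cx x n * cx y m) +
      (cx x m * cx y (n + 1) - cx x (n + 1) * cx y m)
  else 0

/-- The bracket of the model algebra. -/
noncomputable def brQ (n : ℕ) : Bil (Fin (n + 2) → ℂ) :=
  LinearMap.mk₂ ℂ (fun x y => fun m : Fin (n + 2) => qc n x y m)
    (by intro x y z; funext m; simp only [qc, cx_add, Pi.add_apply]; split_ifs <;> ring)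
    (by intro a x z; funext m; simp only [qc, cx_smul, Pi.smul_apply, smul_eq_mul]
        split_ifs <;> ring)
    (by intro x y z; funext m; simp only [qc, cx_add, Pi.add_apply]; split_ifs <;> ring)
    (by intro a x z; funext m; simp only [qc, cx_smul, Pi.smul_apply, smul_eq_mul]
        split_ifs <;> ring)

lemma cx_brQ (n : ℕ) (hn : 4 ≤ n) (x y : Fin (n + 2) → ℂ) (m : ℕ) :
    cx (brQ n x y) m = qc n x y m := by
  by_cases h : m < n + 2
  · simp [cx, h, brQ]
  · unfold qc
    rw [if_neg (by omega), if_neg (by omega), if_neg (by omega)]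
    simp [cx, h]

lemma brQ_leibniz (n : ℕ) (hn : 4 ≤ n) : IsLeibniz (brQ n) := by
  intro x y z
  apply cx_ext
  intro m hm
  have e0 : ∀ x y, cx (brQ n x y) 0 = cx x 0 * cx y n - cx x n * cx y 0 := by
    intro x y; rw [cx_brQ n hn]; simp [qc]
  have e1 : ∀ x y, cx (brQ n x y) 1 = cx x 0 * cx y 0 + 2 * (cx x 1 * cx y n) := by
    intro x y; rw [cx_brQ n hn]; simp [qc]
  have en : ∀ x y, cx (brQ n x y) n = 0 := by
    intro x y; rw [cx_brQ n hn]; unfold qc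
    rw [if_neg (by omega), if_neg (by omega), if_neg (by omega)]
  have en1 : ∀ x y, cx (brQ n x y) (n + 1) = 0 := by
    intro x y; rw [cx_brQ n hn]; unfold qc
    rw [if_neg (by omega), if_neg (by omega), if_neg (by omega)]
  have e2 : ∀ x y, cx (brQ n x y) 2 = cx x 2 * cx y (n + 1) - cx x (n + 1) * cx y 2 := by
    intro x y; rw [cx_brQ n hn]; simp [qc, show 2 < n by omega]
  have em : ∀ k x y, k + 3 < n → cx (brQ n x y) (k + 3) =
      cx x (k + 2) * cx y 0 - cx x 0 * cx y (k + 2) +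
      ((k : ℂ) + 1) * (cx x (k + 3) * cx y n - cx x n * cx y (k + 3)) +
      (cx x (k + 3) * cx y (n + 1) - cx x (n + 1) * cx y (k + 3)) := by
    intro k x y hk; rw [cx_brQ n hn]; simp [qc, hk]; left; ring
  rw [cx_add]
  rcases Nat.lt_or_ge m n with h | h
  · rcases m with _ | _ | _ | _ | m
    · simp only [e0, en]; ring
    · simp only [zero_add, e1, e0, en]; ring
    · simp only [zero_add, Nat.reduceAdd, e2, en1]; ring
    · have := em 0
      simp only [zero_add, Nat.cast_zero] at this
      simp only [zero_add, Nat.reduceAdd, this _ _ h, e2, e0, en, en1]; ring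
    · simp only [show m + 1 + 1 + 1 + 1 = (m + 1) + 3 by ring] at h ⊢
      have h' : m + 3 < n := by omega
      have em2 := em m
      simp only [em _ _ _ h, show m + 1 + 2 = m + 3 by ring, em _ _ _ h', e0, en, en1]
      push_cast; ring
  · have : m = n ∨ m = n + 1 := by omega
    rcases this with rfl | rfl
    · simp only [en]; ring
    · simp only [en1]; ring

lemma brQ_table (n : ℕ) (hn : 4 ≤ n) (i j : Fin (n + 2)) :
    brQ n (Pi.single i 1) (Pi.single j 1) = table18 n (fun t => Pi.single t 1) i j := by
  have hu : ∀ m k : ℕ, cx (if h : m < n + 2 then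
      (Pi.single (⟨m, h⟩ : Fin (n + 2)) (1 : ℂ) : Fin (n + 2) → ℂ) else 0) k =
      if k = m ∧ m < n + 2 then 1 else 0 := by
    intro m k
    by_cases h : m < n + 2
    · rw [dif_pos h, cx_single]; simp [h]
    · rw [dif_neg h]; simp [h, cx]
  have hneg : ∀ (x : Fin (n + 2) → ℂ) k, cx (-x) k = - cx x k := by
    intro x k; unfold cx; split_ifs <;> simp
  have hzero : ∀ k, cx (0 : Fin (n + 2) → ℂ) k = 0 := by
    intro k; unfold cx; split_ifs <;> simp
  apply cx_ext
  intro k hk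
  rw [cx_brQ n hn]
  unfold table18 qc
  simp only [cx_single]
  obtain ⟨i, hi⟩ := i
  obtain ⟨j, hj⟩ := j
  simp only [apply_ite (fun z : Fin (n + 2) → ℂ => cx z k), hu, hneg, hzero, cx_smul]
  clear hu hneg hzero
  have hk2 : k = 2 → (k : ℂ) = 2 := by rintro rfl; norm_num
  have hi2 : i = 2 → (i : ℂ) = 2 := by rintro rfl; norm_num
  rcases (by omega : i = 0 ∨ i = 1 ∨ i = 2 ∨ (3 ≤ i ∧ i ≤ n - 1) ∨ i = n ∨ i = n + 1)
    with rfl | rfl | rfl | hi' | hi' | hi' <;>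
  rcases (by omega : j = 0 ∨ j = 1 ∨ j = 2 ∨ (3 ≤ j ∧ j ≤ n - 1) ∨ j = n ∨ j = n + 1)
    with rfl | rfl | rfl | hj' | hj' | hj' <;>
  grind (splits := 40)

lemma q0 {n : ℕ} (hn : 4 ≤ n) (x y) :
    cx (brQ n x y) 0 = cx x 0 * cx y n - cx x n * cx y 0 := by
  rw [cx_brQ n hn]; simp [qc]
lemma q1 {n : ℕ} (hn : 4 ≤ n) (x y) :
    cx (brQ n x y) 1 = cx x 0 * cx y 0 + 2 * (cx x 1 * cx y n) := by
  rw [cx_brQ n hn]; simp [qc]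
lemma qn {n : ℕ} (hn : 4 ≤ n) (x y) : cx (brQ n x y) n = 0 := by
  rw [cx_brQ n hn]; unfold qc
  rw [if_neg (by omega), if_neg (by omega), if_neg (by omega)]
lemma qn1 {n : ℕ} (hn : 4 ≤ n) (x y) : cx (brQ n x y) (n + 1) = 0 := by
  rw [cx_brQ n hn]; unfold qc
  rw [if_neg (by omega), if_neg (by omega), if_neg (by omega)]
lemma q2 {n : ℕ} (hn : 4 ≤ n) (x y) :
    cx (brQ n x y) 2 = cx x 2 * cx y (n + 1) - cx x (n + 1) * cx y 2 := by
  rw [cx_brQ n hn]; simp [qc, show 2 < n by omega]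
lemma qm {n : ℕ} (hn : 4 ≤ n) (k) (hk : k + 3 < n) (x y) : cx (brQ n x y) (k + 3) =
      cx x (k + 2) * cx y 0 - cx x 0 * cx y (k + 2) +
      ((k : ℂ) + 1) * (cx x (k + 3) * cx y n - cx x n * cx y (k + 3)) +
      (cx x (k + 3) * cx y (n + 1) - cx x (n + 1) * cx y (k + 3)) := by
  rw [cx_brQ n hn]; simp [qc, hk]; left; ring

lemma cx_zero {m : ℕ} (k : ℕ) : cx (0 : Fin m → ℂ) k = 0 := by
  unfold cx; split_ifs <;> simp

lemma bspan_le {L : Type u} [AddCommGroup L] [Module ℂ L] (br : Bil L)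
    {S T U : Submodule ℂ L} (h : ∀ x ∈ S, ∀ y ∈ T, br x y ∈ U) : bspan br S T ≤ U := by
  unfold bspan
  rw [Submodule.span_le]
  rintro z ⟨x, hx, y, hy, rfl⟩
  exact h x hx y hy

lemma mem_bspan {L : Type u} [AddCommGroup L] [Module ℂ L] (br : Bil L)
    {S T : Submodule ℂ L} {x y : L} (hx : x ∈ S) (hy : y ∈ T) : br x y ∈ bspan br S T :=
  Submodule.subset_span ⟨x, hx, y, hy, rfl⟩

/-- Vectors whose coordinates vanish on `P`. -/
def vanish (m : ℕ) (P : Set ℕ) : Submodule ℂ (Fin m → ℂ) where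
  carrier := {x | ∀ k ∈ P, cx x k = 0}
  add_mem' := by
    intro a b ha hb k hk
    rw [cx_add, ha k hk, hb k hk, add_zero]
  zero_mem' := by intro k _; exact cx_zero k
  smul_mem' := by
    intro c a ha k hk
    rw [cx_smul, ha k hk, mul_zero]

lemma mem_vanish {m : ℕ} {P : Set ℕ} {x : Fin m → ℂ} :
    x ∈ vanish m P ↔ ∀ k ∈ P, cx x k = 0 := Iff.rfl

lemma vanish_bot {m : ℕ} {P : Set ℕ} (h : ∀ k < m, k ∈ P) : vanish m P = ⊥ := by
  rw [eq_bot_iff]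
  intro x hx
  rw [Submodule.mem_bot]
  apply cx_ext
  intro k hk
  rw [cx_zero]
  exact hx k (h k hk)

lemma brQ_solvable (n : ℕ) (hn : 4 ≤ n) : IsSolvableSub (brQ n) ⊤ := by
  have h1 : derS (brQ n) ⊤ 1 ≤ vanish (n + 2) {k | n ≤ k ∧ k < n + 2} := by
    apply bspan_le
    intro x _ y _ k hk
    have : k = n ∨ k = n + 1 := by have := hk.1; have := hk.2; omega
    rcases this with rfl | rfl
    · exact qn hn x y
    · exact qn1 hn x y
  have h2 : derS (brQ n) ⊤ 2 ≤ vanish (n + 2) {k | (n ≤ k ∧ k < n + 2) ∨ k = 0 ∨ k = 2} := by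
    apply bspan_le
    intro x hx y hy k hk
    have hx := h1 hx
    have hy := h1 hy
    have a1 := hx n (by simp)
    have a2 := hx (n + 1) (by simp)
    have b1 := hy n (by simp)
    have b2 := hy (n + 1) (by simp)
    have : k = n ∨ k = n + 1 ∨ k = 0 ∨ k = 2 := by
      simp only [Set.mem_ofPred_eq] at hk; omega
    rcases this with rfl | rfl | rfl | rfl
    · exact qn hn x y
    · exact qn1 hn x y
    · rw [q0 hn, a1, b1]; ring
    · rw [q2 hn, a2, b2]; ring
  refine ⟨3, ?_⟩
  rw [eq_bot_iff]
  apply bspan_le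
  intro x hx y hy
  have hx := h2 hx
  have hy := h2 hy
  have a1 := hx n (by simp)
  have a2 := hx (n + 1) (by simp)
  have b1 := hy n (by simp)
  have b2 := hy (n + 1) (by simp)
  have a0 := hx 0 (by simp)
  have b0 := hy 0 (by simp)
  rw [Submodule.mem_bot]
  apply cx_ext
  intro k hk
  rw [cx_zero, cx_brQ n hn]
  unfold qc
  rw [a0, b0, a1, b1, a2, b2]
  simp

/-- The nilradical of the model algebra. -/
def MQ (n : ℕ) : Submodule ℂ (Fin (n + 2) → ℂ) := vanish (n + 2) {k | n ≤ k ∧ k < n + 2}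

lemma mem_MQ {n : ℕ} {x : Fin (n + 2) → ℂ} : x ∈ MQ n ↔ cx x n = 0 ∧ cx x (n + 1) = 0 := by
  constructor
  · intro h; exact ⟨h n (by simp), h (n + 1) (by simp)⟩
  · intro h k hk
    have : k = n ∨ k = n + 1 := by have := hk.1; have := hk.2; omega
    rcases this with rfl | rfl
    · exact h.1
    · exact h.2

lemma MQ_ideal (n : ℕ) (hn : 4 ≤ n) : IsIdeal (brQ n) (MQ n) :=
  ⟨le_top, fun x _ y _ => ⟨mem_MQ.2 ⟨qn hn x y, qn1 hn x y⟩, mem_MQ.2 ⟨qn hn y x, qn1 hn y x⟩⟩⟩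

lemma MQ_nilp (n : ℕ) (hn : 4 ≤ n) : IsNilpotentSub (brQ n) (MQ n) := by
  have key : ∀ r, lcs (brQ n) (MQ n) (r + 1) ≤ vanish (n + 2)
      {k | (n ≤ k ∧ k < n + 2) ∨ k = 0 ∨ (2 ≤ k ∧ k ≤ r + 2 ∧ k < n) ∨ (k = 1 ∧ 1 ≤ r)} := by
    intro r
    have base : ∀ x ∈ MQ n, ∀ y ∈ MQ n, ∀ k, ((n ≤ k ∧ k < n + 2) ∨ k = 0 ∨ k = 2) →
        cx (brQ n x y) k = 0 := by
      intro x hx y hy k hk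
      have hx := mem_MQ.1 hx
      have hy := mem_MQ.1 hy
      have : k = n ∨ k = n + 1 ∨ k = 0 ∨ k = 2 := by omega
      rcases this with rfl | rfl | rfl | rfl
      · exact qn hn x y
      · exact qn1 hn x y
      · rw [q0 hn, hx.1, hy.1]; ring
      · rw [q2 hn, hx.2, hy.2]; ring
    induction r with
    | zero =>
      apply bspan_le
      intro x hx y hy k hk
      apply base x hx y hy k
      simp only [Set.mem_ofPred_eq] at hk
      omega
    | succ r ih =>
      apply bspan_le
      intro x hx y hy k hk
      have hx := ih hx
      have hxM : x ∈ MQ n := mem_MQ.2 ⟨hx n (by simp), hx (n + 1) (by simp)⟩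
      have x0 : cx x 0 = 0 := hx 0 (by simp)
      have hx' := mem_MQ.1 hxM
      have hy' := mem_MQ.1 hy
      simp only [Set.mem_ofPred_eq] at hk
      by_cases h1 : (n ≤ k ∧ k < n + 2) ∨ k = 0 ∨ k = 2
      · exact base x hxM y hy k h1
      by_cases h2 : k = 1
      · subst h2
        rw [q1 hn, x0, hy'.1]; ring
      · obtain ⟨j, rfl⟩ : ∃ j, k = j + 3 := ⟨k - 3, by omega⟩
        have : cx x (j + 2) = 0 := by
          apply hx
          simp only [Set.mem_ofPred_eq]
          omega
        rw [qm hn j (by omega), x0, hx'.1, hx'.2, hy'.1, hy'.2, this]; ring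
  refine ⟨n + 1, ?_⟩
  rw [eq_bot_iff]
  refine (key n).trans (le_of_eq (vanish_bot ?_))
  intro k hk
  simp only [Set.mem_ofPred_eq]
  omega

lemma MQ_max (n : ℕ) (hn : 4 ≤ n) (I : Submodule ℂ (Fin (n + 2) → ℂ))
    (hI : IsIdeal (brQ n) I) (hnil : IsNilpotentSub (brQ n) I) : I ≤ MQ n := by
  obtain ⟨r, hr⟩ := hnil
  intro z hz
  rw [mem_MQ]
  constructor
  · by_contra hne
    have : ∀ s, ∃ w ∈ lcs (brQ n) I s, cx w n = 0 ∧ cx w 0 ≠ 0 := by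
      intro s
      induction s with
      | zero =>
        refine ⟨brQ n (Pi.single ⟨0, by omega⟩ 1) z, (hI.2 z hz _ trivial).2, qn hn _ _, ?_⟩
        rw [q0 hn]
        simp only [cx_single]
        simp [show n ≠ 0 by omega, hne]
      | succ s ih =>
        obtain ⟨w, hw, hwn, hw0⟩ := ih
        refine ⟨brQ n w z, mem_bspan _ hw hz, qn hn _ _, ?_⟩
        rw [q0 hn, hwn]
        simp [hw0, hne]
    obtain ⟨w, hw, -, h0⟩ := this r
    rw [hr, Submodule.mem_bot] at hw
    subst hw
    exact h0 (cx_zero _)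
  · by_contra hne
    have : ∀ s, ∃ w ∈ lcs (brQ n) I s, cx w (n + 1) = 0 ∧ cx w 2 ≠ 0 := by
      intro s
      induction s with
      | zero =>
        refine ⟨brQ n (Pi.single ⟨2, by omega⟩ 1) z, (hI.2 z hz _ trivial).2, qn1 hn _ _, ?_⟩
        rw [q2 hn]
        simp only [cx_single]
        simp [show n ≠ 1 by omega, hne]
      | succ s ih =>
        obtain ⟨w, hw, hwn, hw0⟩ := ih
        refine ⟨brQ n w z, mem_bspan _ hw hz, qn1 hn _ _, ?_⟩
        rw [q2 hn, hwn]
        simp [hw0, hne]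
    obtain ⟨w, hw, -, h0⟩ := this r
    rw [hr, Submodule.mem_bot] at hw
    subst hw
    exact h0 (cx_zero _)

lemma nosplit_aux (n : ℕ) (hn : 4 ≤ n) (A B : Submodule ℂ (Fin (n + 2) → ℂ))
    (hA : IsIdeal (brQ n) A) (hB : IsIdeal (brQ n) B) (hAB : A ⊓ B = ⊥)
    (h0 : (Pi.single ⟨0, by omega⟩ 1 : Fin (n + 2) → ℂ) ∈ A)
    (h2 : (Pi.single ⟨2, by omega⟩ 1 : Fin (n + 2) → ℂ) ∈ A) : B = ⊥ := by
  have inter : ∀ x, x ∈ A → x ∈ B → x = 0 := by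
    intro x h h'
    have : x ∈ A ⊓ B := ⟨h, h'⟩
    rwa [hAB, Submodule.mem_bot] at this
  have hmid : ∀ k, ∀ h : k + 2 < n, (Pi.single ⟨k + 2, by omega⟩ 1 : Fin (n + 2) → ℂ) ∈ A := by
    intro k
    induction k with
    | zero => intro h; exact h2
    | succ k ih =>
      intro h
      have := (hA.2 _ (ih (by omega)) (Pi.single ⟨0, by omega⟩ 1) trivial).1
      rw [brQ_table n hn] at this
      unfold table18 at this
      simp only [] at this
      rw [if_pos trivial, if_neg (by omega), if_pos (by omega), dif_pos (by omega)] at this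
      exact this
  have h1 : (Pi.single ⟨1, by omega⟩ 1 : Fin (n + 2) → ℂ) ∈ A := by
    have := (hA.2 _ h0 (Pi.single ⟨0, by omega⟩ 1) trivial).1
    rw [brQ_table n hn] at this
    unfold table18 at this
    simp only [] at this
    rw [if_pos trivial, if_pos trivial, dif_pos (by omega)] at this
    exact this
  rw [eq_bot_iff]
  intro b hb
  have c0 := inter _ (hA.2 _ h0 b trivial).2 (hB.2 _ hb _ trivial).1
  have c2 := inter _ (hA.2 _ h2 b trivial).2 (hB.2 _ hb _ trivial).1
  have bn : cx b n = 0 := by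
    have := q0 hn b (Pi.single ⟨0, by omega⟩ 1)
    rw [c0] at this
    simp only [cx_single, cx_zero] at this
    simpa [show n ≠ 0 by omega] using this
  have bn1 : cx b (n + 1) = 0 := by
    have := q2 hn b (Pi.single ⟨2, by omega⟩ 1)
    rw [c2] at this
    simp only [cx_single, cx_zero] at this
    simpa [show n ≠ 1 by omega] using this
  have hbA : b ∈ A := by
    rw [pi_eq_sum_univ' b]
    apply Submodule.sum_mem
    intro i _
    by_cases hi : (i : ℕ) < n
    · apply Submodule.smul_mem
      rcases i with ⟨i, hi2⟩
      rcases i with _ | _ | i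
      · exact h0
      · exact h1
      · exact hmid i hi
    · have : b i = 0 := by
        rw [← cx_fin b i]
        have : (i : ℕ) = n ∨ (i : ℕ) = n + 1 := by have := i.2; omega
        rcases this with h | h <;> rw [h] <;> assumption
      rw [this, zero_smul]
      exact A.zero_mem
  rw [Submodule.mem_bot]
  exact inter b hbA hb

lemma brQ_nosplit (n : ℕ) (hn : 4 ≤ n) : ¬ IsSplitIn (brQ n) ⊤ := by
  rintro ⟨A, B, hA, hB, hA0, hB0, hAB, hABs⟩
  have inter : ∀ x, x ∈ A → x ∈ B → x = 0 := by
    intro x h h'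
    have : x ∈ A ⊓ B := ⟨h, h'⟩
    rwa [hAB, Submodule.mem_bot] at this
  -- projections respect right multiplications
  have proj : ∀ a ∈ A, ∀ b ∈ B, ∀ z lam, brQ n (a + b) z = (lam : ℂ) • (a + b) →
      brQ n a z = lam • a ∧ brQ n b z = lam • b := by
    intro a ha b hb z lam h
    have e : brQ n a z - lam • a = lam • b - brQ n b z := by
      rw [map_add, LinearMap.add_apply, smul_add] at h
      linear_combination (exp := 1) h
    have m1 : brQ n a z - lam • a ∈ A :=
      A.sub_mem (hA.2 a ha z trivial).1 (A.smul_mem _ ha)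
    have m2 : lam • b - brQ n b z ∈ B :=
      B.sub_mem (B.smul_mem _ hb) (hB.2 b hb z trivial).1
    have z1 := inter _ m1 (e ▸ m2)
    rw [z1] at e
    exact ⟨sub_eq_zero.1 z1, (sub_eq_zero.1 e.symm).symm⟩
  have eig : ∀ (i : Fin (n + 2)) (l1 l2 : ℂ),
      brQ n (Pi.single i 1) (Pi.single ⟨n, by omega⟩ 1) = l1 • Pi.single i 1 →
      brQ n (Pi.single i 1) (Pi.single ⟨n + 1, by omega⟩ 1) = l2 • Pi.single i 1 →
      (∀ w, brQ n w (Pi.single ⟨n, by omega⟩ 1) = l1 • w →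
        brQ n w (Pi.single ⟨n + 1, by omega⟩ 1) = l2 • w → ∀ k < n + 2, k ≠ i → cx w k = 0) →
      (Pi.single i 1 : Fin (n + 2) → ℂ) ∈ A ∨ (Pi.single i 1 : Fin (n + 2) → ℂ) ∈ B := by
    intro i l1 l2 h1 h2 hu
    have : (Pi.single i 1 : Fin (n + 2) → ℂ) ∈ A ⊔ B := by rw [hABs]; trivial
    obtain ⟨a, ha, b, hb, hab⟩ := Submodule.mem_sup.1 this
    rw [← hab] at h1 h2
    obtain ⟨a1, b1⟩ := proj a ha b hb _ _ h1
    obtain ⟨a2, b2⟩ := proj a ha b hb _ _ h2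
    have form : ∀ w, (∀ k < n + 2, k ≠ i → cx w k = 0) →
        w = cx w i • (Pi.single i 1 : Fin (n + 2) → ℂ) := by
      intro w hw
      apply cx_ext
      intro k hk
      rw [cx_smul, cx_single]
      by_cases h : k = i
      · simp [h]
      · simp [h, hw k hk h]
    have fa := form a (hu a a1 a2)
    have fb := form b (hu b b1 b2)
    by_cases hc : cx a i = 0
    · right
      rw [hc, zero_smul] at fa
      rw [← hab, fa, zero_add]; exact hb
    · left
      have := A.smul_mem (cx a i)⁻¹ ha
      rw [fa, cx_smul, cx_single] at this
      simpa [smul_smul, hc] using this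
  have e0 := eig ⟨0, by omega⟩ 1 0
    (by
      rw [brQ_table n hn]; unfold table18; simp only []
      rw [if_neg (by omega), if_pos trivial, if_pos trivial, dif_pos (by omega), one_smul])
    (by
      rw [brQ_table n hn]; unfold table18; simp only []
      rw [if_neg (by omega), if_neg (by omega), if_pos trivial, if_neg (by omega), zero_smul])
    (by
      intro w h1 h2 k hk hki
      have g1 : ∀ k, cx (brQ n w (Pi.single ⟨n, by omega⟩ 1)) k = cx w k := by
        intro k; rw [h1, one_smul]
      have g2 : ∀ k, cx (brQ n w (Pi.single ⟨n + 1, by omega⟩ 1)) k = 0 := by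
        intro k; rw [h2, zero_smul, cx_zero]
      simp only at hki
      rcases (by omega : k = 1 ∨ k = 2 ∨ (3 ≤ k ∧ k < n) ∨ k = n ∨ k = n + 1)
        with rfl | rfl | hk' | rfl | rfl
      · have := g1 1
        rw [q1 hn] at this
        simp only [cx_single] at this
        simp [show 0 ≠ n by omega] at this
        linear_combination this
      · have := g2 2
        rw [q2 hn] at this
        simp only [cx_single] at this
        simpa [show 2 ≠ n + 1 by omega] using this
      · obtain ⟨j, rfl⟩ : ∃ j, k = j + 3 := ⟨k - 3, by omega⟩
        have := g2 (j + 3)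
        rw [qm hn j (by omega)] at this
        simp only [cx_single] at this
        simpa [show j + 2 ≠ n + 1 by omega, show j + 3 ≠ n + 1 by omega,
          show j + 2 ≠ n by omega] using this
      · rw [← g1, qn hn]
      · rw [← g1, qn1 hn])
  have e2 := eig ⟨2, by omega⟩ 0 1
    (by
      rw [brQ_table n hn]; unfold table18; simp only []
      rw [if_neg (by omega), if_pos trivial, if_neg (by omega), if_neg (by omega),
        if_neg (by omega), zero_smul])
    (by
      rw [brQ_table n hn]; unfold table18; simp only []
      rw [if_neg (by omega), if_neg (by omega), if_pos trivial, if_pos (by omega),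
        dif_pos (by omega), one_smul])
    (by
      intro w h1 h2 k hk hki
      have g1 : ∀ k, cx (brQ n w (Pi.single ⟨n, by omega⟩ 1)) k = 0 := by
        intro k; rw [h1, zero_smul, cx_zero]
      have g2 : ∀ k, cx (brQ n w (Pi.single ⟨n + 1, by omega⟩ 1)) k = cx w k := by
        intro k; rw [h2, one_smul]
      simp only at hki
      rcases (by omega : k = 0 ∨ k = 1 ∨ (3 ≤ k ∧ k < n) ∨ k = n ∨ k = n + 1)
        with rfl | rfl | hk' | rfl | rfl
      · have := g1 0
        rw [q0 hn] at this
        simp only [cx_single] at this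
        simpa [show 0 ≠ n by omega] using this
      · have := g1 1
        rw [q1 hn] at this
        simp only [cx_single] at this
        simpa [show 0 ≠ n by omega] using this
      · obtain ⟨j, rfl⟩ : ∃ j, k = j + 3 := ⟨k - 3, by omega⟩
        have := g1 (j + 3)
        rw [qm hn j (by omega)] at this
        simp only [cx_single] at this
        have hj : (j : ℂ) + 1 ≠ 0 := by exact_mod_cast Nat.succ_ne_zero j
        simpa [show j + 2 ≠ n by omega, show j + 3 ≠ n by omega, show 0 ≠ n by omega, hj]
          using this
      · rw [← g2, qn hn]
      · rw [← g2, qn1 hn])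
  have hcross : ∀ A B : Submodule ℂ (Fin (n + 2) → ℂ), IsIdeal (brQ n) A → IsIdeal (brQ n) B →
      (∀ x, x ∈ A → x ∈ B → x = 0) →
      (Pi.single ⟨0, by omega⟩ 1 : Fin (n + 2) → ℂ) ∈ A →
      (Pi.single ⟨2, by omega⟩ 1 : Fin (n + 2) → ℂ) ∈ B → False := by
    intro A B hA hB inter h0 h2
    have := inter _ (hA.2 _ h0 (Pi.single ⟨2, by omega⟩ 1) trivial).2 (hB.2 _ h2 _ trivial).1
    have h3 := qm hn 0 (by omega) (Pi.single ⟨2, by omega⟩ 1) (Pi.single ⟨0, by omega⟩ 1)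
    rw [this, cx_zero] at h3
    simp only [cx_single] at h3
    simp at h3
  rcases e0 with e0 | e0 <;> rcases e2 with e2 | e2
  · exact hB0 (nosplit_aux n hn A B hA hB hAB e0 e2)
  · exact hcross A B hA hB inter e0 e2
  · exact hcross B A hB hA (fun x h h' => inter x h' h) e0 e2
  · exact hA0 (nosplit_aux n hn B A hB hA (by rw [inf_comm]; exact hAB) e0 e2)

lemma brQ_iso (n : ℕ) (hn : 4 ≤ n) (brL1 : Bil (Fin n → ℂ))
    (hbrL1 : ∀ i j : Fin n, brL1 (Pi.single i 1) (Pi.single j 1) =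
      tableL1 n (fun t => Pi.single t 1) i j) : SubAlgIso brL1 ⊤ (brQ n) (MQ n) := by
  let P : (Fin n → ℂ) →ₗ[ℂ] (Fin (n + 2) → ℂ) :=
    { toFun := fun x k => cx x k
      map_add' := by intro x y; funext k; simp [cx_add]
      map_smul' := by intro x y; funext k; simp [cx_smul] }
  have cP : ∀ x k, cx (P x) k = cx x k := by
    intro x k
    by_cases h : k < n + 2
    · simp [cx, h, P]
    · simp [cx, h, show ¬ k < n by omega]
  have Ps : ∀ i : Fin n, P (Pi.single i 1) = Pi.single ⟨i, by omega⟩ 1 := by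
    intro i
    apply cx_ext
    intro k hk
    rw [cP, cx_single, cx_single]
  have hP : ∀ x y, P (brL1 x y) = brQ n (P x) (P y) := by
    have : brL1.compr₂ P = (brQ n).compl₁₂ P P := by
      apply (Pi.basisFun ℂ (Fin n)).ext
      intro i
      apply (Pi.basisFun ℂ (Fin n)).ext
      intro j
      simp only [Pi.basisFun_apply, LinearMap.compr₂_apply, LinearMap.compl₁₂_apply]
      rw [Ps, Ps, brQ_table n hn, hbrL1]
      obtain ⟨i, hi⟩ := i
      obtain ⟨j, hj⟩ := j
      unfold tableL1 table18
      simp only []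
      have Pu : ∀ m, m < n → P (if h : m < n then Pi.single (⟨m, h⟩ : Fin n) (1 : ℂ) else 0) =
          if h : m < n + 2 then Pi.single (⟨m, h⟩ : Fin (n + 2)) (1 : ℂ) else 0 := by
        intro m hm
        rw [dif_pos hm, dif_pos (by omega), Ps]
      by_cases hj0 : j = 0
      · rw [if_pos hj0, if_pos hj0]
        by_cases hi0 : i = 0
        · rw [if_pos hi0, if_pos hi0, Pu 1 (by omega)]
        · rw [if_neg hi0, if_neg hi0]
          by_cases hi2 : 2 ≤ i ∧ i ≤ n - 2
          · rw [if_pos hi2, if_pos hi2, Pu _ (by omega)]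
          · rw [if_neg hi2, if_neg hi2, if_neg (by omega), map_zero]
      · rw [if_neg hj0, if_neg hj0, if_neg (show ¬ j = n by omega),
          if_neg (show ¬ j = n + 1 by omega)]
        by_cases hi2 : i = 0 ∧ 2 ≤ j ∧ j ≤ n - 2
        · rw [if_pos hi2, if_pos hi2, map_neg, Pu _ (by omega)]
        · rw [if_neg hi2, if_neg hi2, if_neg (by omega), if_neg (by omega), map_zero]
    intro x y
    exact congrArg (fun f => f x y) this
  refine ⟨P.comp (Submodule.subtype ⊤), ?_, ?_, ?_⟩
  · intro x y hxy
    apply Subtype.ext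
    apply cx_ext
    intro k hk
    rw [← cP, ← cP]
    exact congrArg (fun z => cx z k) hxy
  · ext z
    constructor
    · rintro ⟨x, rfl⟩
      refine mem_MQ.2 ⟨?_, ?_⟩ <;> simp only [LinearMap.comp_apply] <;> rw [cP] <;> simp [cx]
    · intro hz
      have hz := mem_MQ.1 hz
      refine ⟨⟨fun k => cx z k, trivial⟩, ?_⟩
      apply cx_ext
      intro k hk
      simp only [LinearMap.comp_apply, Submodule.subtype_apply]
      rw [cP]
      by_cases h : k < n
      · simp [cx, h, hk]
      · have : k = n ∨ k = n + 1 := by omega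
        rcases this with rfl | rfl
        · rw [hz.1]; simp [cx]
        · rw [hz.2]; simp [cx]
  · intro x y z h
    simp only [LinearMap.comp_apply, Submodule.subtype_apply]
    rw [h, hP]

end PartOne

section PartTwo

/-- The flag spanned by the tails of `h`. -/
def Fl {L : Type u} [AddCommGroup L] [Module ℂ L] (h : ℕ → L) (k : ℕ) : Submodule ℂ L :=
  Submodule.span ℂ (h '' {j | k ≤ j})

lemma mem_Fl {L : Type u} [AddCommGroup L] [Module ℂ L] (h : ℕ → L) {k j : ℕ} (hj : k ≤ j) :
    h j ∈ Fl h k := Submodule.subset_span ⟨j, hj, rfl⟩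

lemma Fl_anti {L : Type u} [AddCommGroup L] [Module ℂ L] (h : ℕ → L) {k l : ℕ} (hkl : k ≤ l) :
    Fl h l ≤ Fl h k :=
  Submodule.span_mono (Set.image_mono fun _ hj => le_trans hkl hj)

lemma Fl_le {L : Type u} [AddCommGroup L] [Module ℂ L] {h : ℕ → L} {k : ℕ} {U : Submodule ℂ L}
    (hU : ∀ j, k ≤ j → h j ∈ U) : Fl h k ≤ U := by
  unfold Fl
  rw [Submodule.span_le]
  rintro _ ⟨j, hj, rfl⟩
  exact hU j hj

lemma Fl_dec {L : Type u} [AddCommGroup L] [Module ℂ L] (h : ℕ → L) {k : ℕ} {y : L}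
    (hy : y ∈ Fl h k) : ∃ a : ℂ, ∃ r ∈ Fl h (k + 1), y = a • h k + r := by
  have : Fl h k ≤ Submodule.span ℂ {h k} ⊔ Fl h (k + 1) := by
    apply Fl_le
    intro j hj
    rcases Nat.eq_or_lt_of_le hj with rfl | hj
    · exact Submodule.mem_sup_left (Submodule.mem_span_singleton_self _)
    · exact Submodule.mem_sup_right (mem_Fl h hj)
  obtain ⟨p, hp, r, hr, e⟩ := Submodule.mem_sup.1 (this hy)
  obtain ⟨a, rfl⟩ := Submodule.mem_span_singleton.1 hp
  exact ⟨a, r, hr, e.symm⟩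

lemma Fl_bot {L : Type u} [AddCommGroup L] [Module ℂ L] {h : ℕ → L} {n k : ℕ}
    (hz : ∀ j, n ≤ j → h j = 0) (hk : n ≤ k) : Fl h k = ⊥ := by
  rw [eq_bot_iff]
  apply Fl_le
  intro j hj
  rw [hz j (hk.trans hj)]
  exact Submodule.zero_mem _

lemma flag_surj {L : Type u} [AddCommGroup L] [Module ℂ L] {h : ℕ → L} {n : ℕ}
    (hz : ∀ j, n ≤ j → h j = 0) (T : L →ₗ[ℂ] L) (w : ℕ → ℂ)
    (hT : ∀ k, T (h k) - w k • h k ∈ Fl h (k + 1)) (lam : ℂ) :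
    ∀ d k, n ≤ k + d → (∀ j, k ≤ j → j < n → w j ≠ lam) → ∀ z ∈ Fl h k,
      ∃ y ∈ Fl h k, T y - lam • y = z := by
  intro d
  induction d with
  | zero =>
    intro k hk _ z hz'
    rw [Fl_bot hz (show n ≤ k from hk), Submodule.mem_bot] at hz'
    exact ⟨0, Submodule.zero_mem _, by simp [hz']⟩
  | succ d ih =>
    intro k hk hw z hzk
    by_cases hkn : n ≤ k
    · rw [Fl_bot hz hkn, Submodule.mem_bot] at hzk
      exact ⟨0, Submodule.zero_mem _, by simp [hzk]⟩
    obtain ⟨a, r, hr, rfl⟩ := Fl_dec h hzk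
    have hne : w k - lam ≠ 0 := sub_ne_zero.2 (hw k le_rfl (by omega))
    obtain ⟨y, hy, hye⟩ := ih (k + 1) (by omega) (fun j hj => hw j (by omega))
      (r - (a / (w k - lam)) • (T (h k) - w k • h k))
      (Submodule.sub_mem _ hr (Submodule.smul_mem _ _ (hT k)))
    refine ⟨(a / (w k - lam)) • h k + y, Submodule.add_mem _
      (Submodule.smul_mem _ _ (mem_Fl h le_rfl)) (Fl_anti h (by omega) hy), ?_⟩
    have e : a = (a / (w k - lam)) * (w k - lam) := by field_simp
    rw [map_add, map_smul]
    conv_rhs => rw [e]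
    have : r = T y - lam • y + (a / (w k - lam)) • (T (h k) - w k • h k) := by
      rw [hye]; abel
    rw [this]
    module

lemma flag_inj {L : Type u} [AddCommGroup L] [Module ℂ L] {h : ℕ → L} {n : ℕ}
    (hz : ∀ j, n ≤ j → h j = 0) (c : ℕ → L →ₗ[ℂ] ℂ)
    (hc : ∀ k < n, ∀ j, c k (h j) = if k = j then 1 else 0)
    (hcF : ∀ k < n, ∀ y ∈ Fl h (k + 1), c k y = 0)
    (T : L →ₗ[ℂ] L) (w : ℕ → ℂ)
    (hT : ∀ k, T (h k) - w k • h k ∈ Fl h (k + 1))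
    (hTF : ∀ k, ∀ y ∈ Fl h k, T y ∈ Fl h k) (lam : ℂ) :
    ∀ d k, n ≤ k + d → (∀ j, k ≤ j → j < n → w j ≠ lam) → ∀ y ∈ Fl h k,
      T y = lam • y → y = 0 := by
  intro d
  induction d with
  | zero =>
    intro k hk _ y hy _
    rwa [Fl_bot hz (show n ≤ k from hk), Submodule.mem_bot] at hy
  | succ d ih =>
    intro k hk hw y hy hTy
    by_cases hkn : n ≤ k
    · rwa [Fl_bot hz hkn, Submodule.mem_bot] at hy
    obtain ⟨a, r, hr, rfl⟩ := Fl_dec h hy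
    have hkn : k < n := by omega
    have hne : w k - lam ≠ 0 := sub_ne_zero.2 (hw k le_rfl hkn)
    have e := congrArg (c k) hTy
    have e1 : c k (T (h k)) = w k := by
      have := hcF k hkn _ (hT k)
      rw [map_sub, map_smul, hc k hkn, sub_eq_zero] at this
      simpa using this
    rw [map_add, map_smul, map_add, map_smul, e1, hcF k hkn _ (hTF _ _ hr), map_smul, map_add,
      map_smul, hc k hkn, hcF k hkn _ hr] at e
    simp at e
    have ha : a = 0 := by
      have : a * (w k - lam) = 0 := by linear_combination e
      exact (mul_eq_zero.1 this).resolve_right hne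
    subst ha
    rw [zero_smul, zero_add] at hTy ⊢
    exact ih (k + 1) (by omega) (fun j hj => hw j (by omega)) r hr hTy

/-- Structure of the nilradical in a reordered basis
(`h 0 = e₁`, `h k = e_{k+2}` for `1 ≤ k ≤ n - 2`, `h (n-1) = e₂`). -/
structure HD {L : Type u} [AddCommGroup L] [Module ℂ L] (n : ℕ) (br : Bil L) (N : Submodule ℂ L)
    (h : ℕ → L) (c : ℕ → L →ₗ[ℂ] ℂ) : Prop where
  hn : 4 ≤ n
  hz : ∀ j, n ≤ j → h j = 0
  b00 : br (h 0) (h 0) = h (n - 1)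
  b10 : ∀ k, 1 ≤ k → k + 2 < n → br (h k) (h 0) = h (k + 1)
  b10' : ∀ k, n ≤ k + 2 → br (h k) (h 0) = 0
  b01 : ∀ k, 1 ≤ k → br (h 0) (h k) = - br (h k) (h 0)
  bA : ∀ i j, 1 ≤ i → 1 ≤ j → br (h i) (h j) = 0
  hc : ∀ k < n, ∀ j, c k (h j) = if k = j then 1 else 0
  hN : N = Fl h 0

/-- The weights. -/
noncomputable def Wt (n : ℕ) (a b : ℂ) (k : ℕ) : ℂ :=
  if k = 0 then a else if k + 1 < n then b + ((k : ℂ) - 1) * a else 2 * a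

namespace HD

variable {L : Type u} [AddCommGroup L] [Module ℂ L] {n : ℕ} {br : Bil L} {N : Submodule ℂ L}
    {h : ℕ → L} {c : ℕ → L →ₗ[ℂ] ℂ}

lemma cF (H : HD n br N h c) : ∀ k < n, ∀ y ∈ Fl h (k + 1), c k y = 0 := by
  intro k hk
  have : Fl h (k + 1) ≤ LinearMap.ker (c k) := by
    apply Fl_le
    intro j hj
    rw [LinearMap.mem_ker, H.hc k hk, if_neg (by omega)]
  exact fun y hy => this hy

lemma anti (H : HD n br N h c) {y : L} (hy : y ∈ Fl h 1) : br (h 0) y = - br y (h 0) := by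
  have : Fl h 1 ≤ LinearMap.ker (br (h 0) + br.flip (h 0)) := by
    apply Fl_le
    intro j hj
    rw [LinearMap.mem_ker, LinearMap.add_apply, LinearMap.flip_apply, H.b01 j hj]
    simp
  have := this hy
  rw [LinearMap.mem_ker, LinearMap.add_apply, LinearMap.flip_apply] at this
  exact eq_neg_of_add_eq_zero_left this

lemma abel1 (H : HD n br N h c) {x y : L} (hx : x ∈ Fl h 1) (hy : y ∈ Fl h 1) : br x y = 0 := by
  have h1 : ∀ j, 1 ≤ j → br x (h j) = 0 := by
    intro j hj
    have : Fl h 1 ≤ LinearMap.ker (br.flip (h j)) := by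
      apply Fl_le
      intro i hi
      rw [LinearMap.mem_ker, LinearMap.flip_apply, H.bA i j hi hj]
    exact this hx
  have : Fl h 1 ≤ LinearMap.ker (br x) := by
    apply Fl_le
    intro j hj
    exact h1 j hj
  exact this hy

lemma shift (H : HD n br N h c) {k : ℕ} (hk : 1 ≤ k) {y : L} (hy : y ∈ Fl h k) :
    br y (h 0) ∈ Fl h (k + 1) := by
  have : Fl h k ≤ (Fl h (k + 1)).comap (br.flip (h 0)) := by
    apply Fl_le
    intro j hj
    rw [Submodule.mem_comap, LinearMap.flip_apply]
    by_cases h1 : j + 2 < n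
    · rw [H.b10 j (by omega) h1]
      exact mem_Fl h (by omega)
    · rw [H.b10' j (by omega)]
      exact Submodule.zero_mem _
  exact this hy

lemma tri (H : HD n br N h c) (hL : IsLeibniz br) (hI : IsIdeal br N) (x : L) (k : ℕ) :
    br (h k) x - Wt n (c 0 (br (h 0) x)) (c 1 (br (h 1) x)) k • h k ∈ Fl h (k + 1) := by
  have hn := H.hn
  have inN : ∀ j, br (h j) x ∈ Fl h 0 := by
    intro j
    have h1 : h j ∈ N := by rw [H.hN]; exact mem_Fl h (Nat.zero_le _)
    have := (hI.2 _ h1 x trivial).1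
    rwa [H.hN] at this
  obtain ⟨a, y0, hy0, e0⟩ := Fl_dec h (inN 0)
  obtain ⟨g, y1, hy1, e1⟩ := Fl_dec h (inN 1)
  have h1F : h 1 ∈ Fl h 1 := mem_Fl h le_rfl
  have ca : c 0 (br (h 0) x) = a := by
    rw [e0, map_add, map_smul, H.hc 0 (by omega), H.cF 0 (by omega) _ hy0]; simp
  have g0 : g = 0 := by
    have i1 := hL (h 0) (h 1) x
    have i2 := hL (h 1) (h 0) x
    have a1 := H.anti h1F
    have a2 := H.anti hy1
    rw [e0, e1, a1] at i1
    rw [e0, e1] at i2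
    simp only [map_add, map_smul, LinearMap.add_apply, LinearMap.smul_apply, map_neg,
      LinearMap.neg_apply, H.abel1 hy0 h1F, H.abel1 h1F hy0, H.b00, a1, a2] at i1 i2
    have : (2 * g) • h (n - 1) = 0 := by
      linear_combination (norm := module) -i1 - i2
    have := congrArg (c (n - 1)) this
    rw [map_smul, H.hc _ (by omega)] at this
    simpa using this
  rw [g0, zero_smul, zero_add] at e1
  obtain ⟨b, y2, hy2, e2⟩ := Fl_dec h hy1
  have cb : c 1 (br (h 1) x) = b := by
    rw [e1, e2, map_add, map_smul, H.hc 1 (by omega), H.cF 1 (by omega) _ hy2]; simp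
  rw [ca, cb]
  have mid : ∀ k, k + 2 < n → br (h (k + 1)) x - (b + (k : ℂ) * a) • h (k + 1) ∈
      Fl h (k + 2) := by
    intro k
    induction k with
    | zero =>
      intro _
      have : br (h (0 + 1)) x - (b + ((0 : ℕ) : ℂ) * a) • h (0 + 1) = y2 := by
        rw [zero_add, e1, e2]; simp
      rw [this]; exact hy2
    | succ k ih =>
      intro hk
      have ih := ih (by omega)
      have hs := H.shift (by omega) ih
      have i := hL (h (k + 1)) (h 0) x
      rw [H.b10 (k + 1) (by omega) (by omega), e0, map_add, map_smul,
        H.abel1 (mem_Fl h (by omega)) hy0, H.b10 (k + 1) (by omega) (by omega), add_zero] at i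
      rw [map_sub, map_smul, LinearMap.sub_apply, LinearMap.smul_apply,
        H.b10 (k + 1) (by omega) (by omega)] at hs
      convert hs using 1
      rw [i]
      push_cast
      module
  by_cases hk0 : k = 0
  · subst hk0
    have : br (h 0) x - Wt n a b 0 • h 0 = y0 := by
      rw [e0]; simp [Wt]
    rw [this]; exact hy0
  by_cases hk : k + 1 < n
  · obtain ⟨j, rfl⟩ : ∃ j, k = j + 1 := ⟨k - 1, by omega⟩
    have := mid j (by omega)
    have hw : Wt n a b (j + 1) = b + (j : ℂ) * a := by
      unfold Wt
      rw [if_neg hk0, if_pos hk]; push_cast; ring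
    rw [hw]; exact this
  · have hw : Wt n a b k = 2 * a := by
      unfold Wt
      rw [if_neg hk0, if_neg hk]
    rw [hw]
    by_cases hk' : k = n - 1
    · subst hk'
      have i := hL (h 0) (h 0) x
      have a2 := H.anti hy0
      rw [e0] at i
      simp only [map_add, map_smul, LinearMap.add_apply, LinearMap.smul_apply, H.b00, a2] at i
      have : br (h (n - 1)) x - (2 * a) • h (n - 1) = 0 := by
        rw [i]; module
      rw [this]; exact Submodule.zero_mem _
    · rw [H.hz k (by omega)]
      simp

lemma stab (H : HD n br N h c) (hL : IsLeibniz br) (hI : IsIdeal br N) (x : L) (k : ℕ) :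
    ∀ y ∈ Fl h k, br y x ∈ Fl h k := by
  have : Fl h k ≤ (Fl h k).comap (br.flip x) := by
    apply Fl_le
    intro j hj
    rw [Submodule.mem_comap, LinearMap.flip_apply]
    have := Submodule.add_mem _ (Fl_anti h (show k ≤ j + 1 by omega) (H.tri hL hI x j))
      (Submodule.smul_mem _ (Wt n (c 0 (br (h 0) x)) (c 1 (br (h 1) x)) j) (mem_Fl h hj))
    rwa [sub_add_cancel] at this
  exact fun y hy => this hy

lemma low (H : HD n br N h c) (hL : IsLeibniz br) (hI : IsIdeal br N) (x : L)
    (ha : c 0 (br (h 0) x) = 0) (hb : c 1 (br (h 1) x) = 0) (k : ℕ) :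
    ∀ y ∈ Fl h k, br y x ∈ Fl h (k + 1) := by
  have : Fl h k ≤ (Fl h (k + 1)).comap (br.flip x) := by
    apply Fl_le
    intro j hj
    rw [Submodule.mem_comap, LinearMap.flip_apply]
    have := H.tri hL hI x j
    have w0 : Wt n 0 0 j = 0 := by unfold Wt; simp
    rw [ha, hb, w0, zero_smul, sub_zero] at this
    exact Fl_anti h (by omega) this
  exact fun y hy => this hy

/-- The first weights vanish on brackets. -/
lemma wbr (H : HD n br N h c) (hL : IsLeibniz br) (hI : IsIdeal br N) (k : ℕ) (hk : k < n)
    (x y : L) (hW : ∀ x, c k (br (h k) x) • h k - br (h k) x ∈ Fl h (k + 1)) :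
    c k (br (h k) (br x y)) = 0 := by
  have key : ∀ x y, c k (br (br (h k) x) y) = c k (br (h k) x) * c k (br (h k) y) := by
    intro x y
    have := H.cF k hk _ (H.stab hL hI y _ _ (hW x))
    rw [map_sub, map_smul, LinearMap.sub_apply, LinearMap.smul_apply, map_sub, map_smul] at this
    rw [← sub_eq_zero.1 this]; simp
  have i := congrArg (c k) (hL (h k) x y)
  rw [map_add, key, key] at i
  linear_combination -i

lemma kerN (H : HD n br N h c) : ∀ y ∈ N, c 0 (br (h 0) y) = 0 ∧ c 1 (br (h 1) y) = 0 := by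
  have hn := H.hn
  have : N ≤ LinearMap.ker ((c 0).comp (br (h 0))) ⊓ LinearMap.ker ((c 1).comp (br (h 1))) := by
    rw [H.hN]
    apply Fl_le
    intro j _
    rw [Submodule.mem_inf, LinearMap.mem_ker, LinearMap.mem_ker, LinearMap.comp_apply,
      LinearMap.comp_apply]
    rcases Nat.eq_zero_or_pos j with rfl | hj
    · rw [H.b00, H.b10 1 le_rfl (by omega), H.hc 0 (by omega), H.hc 1 (by omega)]
      simp; omega
    · rw [H.bA 1 j le_rfl hj, H.b01 j hj]
      have := H.cF 0 (by omega) _ (Fl_anti h (by omega) (H.shift hj (mem_Fl h le_rfl)))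
      simp [this]
  intro y hy
  have := this hy
  rwa [Submodule.mem_inf, LinearMap.mem_ker, LinearMap.mem_ker, LinearMap.comp_apply,
      LinearMap.comp_apply] at this

lemma nilp (H : HD n br N h c) (hL : IsLeibniz br) (hI : IsIdeal br N) (J : Submodule ℂ L)
    (hJ : ∀ x ∈ J, ∀ y ∈ J, br x y ∈ N)
    (hJ0 : ∀ y ∈ J, c 0 (br (h 0) y) = 0 ∧ c 1 (br (h 1) y) = 0) : IsNilpotentSub br J := by
  have : ∀ k, lcs br J (k + 1) ≤ Fl h k := by
    intro k
    induction k with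
    | zero =>
      apply bspan_le
      intro x hx y hy
      rw [← H.hN]
      exact hJ x hx y hy
    | succ k ih =>
      apply bspan_le
      intro x hx y hy
      exact H.low hL hI y (hJ0 y hy).1 (hJ0 y hy).2 k x (ih hx)
  refine ⟨n + 1, ?_⟩
  rw [eq_bot_iff, ← Fl_bot H.hz le_rfl]
  exact this n

lemma wall (H : HD n br N h c) (hL : IsLeibniz br) (hI : IsIdeal br N) (x y : L) :
    c 0 (br (h 0) (br x y)) = 0 ∧ c 1 (br (h 1) (br x y)) = 0 := by
  have hn := H.hn
  constructor
  · apply H.wbr hL hI 0 (by omega)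
    intro x
    have := H.tri hL hI x 0
    unfold Wt at this
    rw [if_pos rfl] at this
    rw [← neg_sub]
    exact Submodule.neg_mem _ this
  · apply H.wbr hL hI 1 (by omega)
    intro x
    have := H.tri hL hI x 1
    unfold Wt at this
    rw [if_neg (by omega), if_pos (by omega)] at this
    rw [← neg_sub]
    refine Submodule.neg_mem _ ?_
    simpa using this

lemma derIdeal (hL : IsLeibniz br) (s : ℕ) : IsIdeal br (derS br ⊤ s) := by
  induction s with
  | zero => exact ⟨le_rfl, fun _ _ _ _ => ⟨trivial, trivial⟩⟩
  | succ s ih =>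
    refine ⟨le_top, fun x hx y _ => ?_⟩
    have h1 : derS br ⊤ (s + 1) ≤ (derS br ⊤ (s + 1)).comap (br.flip y) ⊓
        (derS br ⊤ (s + 1)).comap (br y) := by
      apply bspan_le
      intro a ha b hb
      rw [Submodule.mem_inf, Submodule.mem_comap, Submodule.mem_comap, LinearMap.flip_apply]
      constructor
      · rw [hL a b y]
        exact Submodule.add_mem _ (mem_bspan br (ih.2 a ha y trivial).1 hb)
          (mem_bspan br ha (ih.2 b hb y trivial).1)
      · have : br y (br a b) = br (br y a) b - br (br y b) a := by
          rw [hL y a b]; abel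
        rw [this]
        exact Submodule.sub_mem _ (mem_bspan br (ih.2 a ha y trivial).2 hb)
          (mem_bspan br (ih.2 b hb y trivial).2 ha)
    exact h1 hx

lemma der_le (H : HD n br N h c) (hL : IsLeibniz br) (hR : IsNilradical br N)
    (hs : IsSolvableSub br (⊤ : Submodule ℂ L)) : ∀ x y, br x y ∈ N := by
  obtain ⟨m, hm⟩ := hs
  have hI := hR.1
  have key : ∀ d s, 1 ≤ s → m ≤ s + d → derS br (⊤ : Submodule ℂ L) s ≤ N := by
    intro d
    induction d with
    | zero =>
      intro s _ hs
      have : ∀ r, derS br (⊤ : Submodule ℂ L) (m + r) = ⊥ := by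
        intro r
        induction r with
        | zero => exact hm
        | succ r ih =>
          rw [eq_bot_iff]
          apply bspan_le
          intro x hx y hy
          have hx : x ∈ derS br (⊤ : Submodule ℂ L) (m + r) := hx
          rw [ih, Submodule.mem_bot] at hx
          rw [hx]; simp
      have hs : m ≤ s := hs
      have h' := this (s - m)
      rw [Nat.add_sub_cancel' hs] at h'
      rw [h']; exact bot_le
    | succ d ih =>
      intro s hs1 hs
      have hnext := ih (s + 1) (by omega) (by omega)
      apply hR.2.2 _ (derIdeal hL s)
      apply H.nilp hL hI
      · intro x hx y hy
        exact hnext (mem_bspan br hx hy)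
      · obtain ⟨s, rfl⟩ : ∃ r, s = r + 1 := ⟨s - 1, by omega⟩
        have : derS br (⊤ : Submodule ℂ L) (s + 1) ≤
            LinearMap.ker ((c 0).comp (br (h 0))) ⊓ LinearMap.ker ((c 1).comp (br (h 1))) := by
          apply bspan_le
          intro x _ y _
          exact H.wall hL hI x y
        intro y hy
        exact this hy
  intro x y
  exact key m 1 le_rfl (by omega) (mem_bspan br trivial trivial)

lemma ker_le (H : HD n br N h c) (hL : IsLeibniz br) (hR : IsNilradical br N)
    (hs : IsSolvableSub br (⊤ : Submodule ℂ L)) (y : L) (h0 : c 0 (br (h 0) y) = 0)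
    (h1 : c 1 (br (h 1) y) = 0) : y ∈ N := by
  have hD := H.der_le hL hR hs
  have : LinearMap.ker ((c 0).comp (br (h 0))) ⊓ LinearMap.ker ((c 1).comp (br (h 1))) ≤ N := by
    apply hR.2.2
    · refine ⟨le_top, fun x _ y _ => ⟨H.kerN _ (hD x y), H.kerN _ (hD y x)⟩⟩
    · apply H.nilp hL hR.1
      · intro x _ y _; exact hD x y
      · intro y hy; exact hy
  exact this ⟨h0, h1⟩


lemma Wt0 (n : ℕ) (a b : ℂ) : Wt n a b 0 = a := by simp [Wt]
lemma Wt1 (n : ℕ) (hn : 4 ≤ n) (a b : ℂ) : Wt n a b 1 = b := by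
  unfold Wt; rw [if_neg (by omega), if_pos (by omega)]; push_cast; ring

lemma Wt_ne (n : ℕ) (k : ℕ) :
    Wt n 1 3 k ≠ 0 ∧ (1 ≤ k → Wt n 1 3 k ≠ 1) ∧ (2 ≤ k → Wt n 1 3 k ≠ 3) := by
  unfold Wt
  split_ifs with h1 h2
  · subst h1; simp
  · have e : (3 : ℂ) + ((k : ℂ) - 1) * 1 = ((k + 2 : ℕ) : ℂ) := by push_cast; ring
    rw [e]
    refine ⟨?_, fun _ => ?_, fun _ => ?_⟩
    · exact_mod_cast (by omega : k + 2 ≠ 0)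
    · exact_mod_cast (by omega : k + 2 ≠ 1)
    · exact_mod_cast (by omega : k + 2 ≠ 3)
  · norm_num

/-- The chain `f₃, f₄, …`. -/
def chain (br : Bil L) (f1 f3 : L) : ℕ → L
  | 0 => f3
  | k + 1 => br (chain br f1 f3 k) f1

/-- The table with natural indices. -/
def tb (n : ℕ) (u : ℕ → L) (i j : ℕ) : L :=
  if j = 0 then
    (if i = 0 then u 1
     else if 2 ≤ i ∧ i ≤ n - 2 then u (i + 1)
     else if i = n then -u 0
     else 0)
  else if j = n then
    (if i = 0 then u 0
     else if i = 1 then (2 : ℂ) • u 1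
     else if 3 ≤ i ∧ i ≤ n - 1 then ((i : ℂ) - 2) • u i
     else 0)
  else if j = n + 1 then
    (if 2 ≤ i ∧ i ≤ n - 1 then u i else 0)
  else if i = 0 ∧ 2 ≤ j ∧ j ≤ n - 2 then -u (j + 1)
  else if i = n ∧ 3 ≤ j ∧ j ≤ n - 1 then
    -(((j : ℂ) - 2) • u j)
  else if i = n + 1 ∧ 2 ≤ j ∧ j ≤ n - 1 then -u j
  else 0

lemma table_eq (n : ℕ) (v : Fin (n + 2) → L) (u : ℕ → L)
    (hu : ∀ m, (if hm : m < n + 2 then v ⟨m, hm⟩ else 0) = u m) (i j : Fin (n + 2)) :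
    table18 n v i j = tb n u i j := by
  have : u = fun m => (if hm : m < n + 2 then v ⟨m, hm⟩ else 0) := funext fun m => (hu m).symm
  subst this
  rfl

set_option maxHeartbeats 2000000 in
lemma tb_check (hn : 4 ≤ n) (U g : ℕ → L) (f1 p x1 x2 : L)
    (u0 : U 0 = f1) (u1 : U 1 = p) (um : ∀ k, k + 2 < n → U (k + 2) = g k)
    (un : U n = x1) (un1 : U (n + 1) = x2)
    (f11 : br f1 f1 = p) (f1p : br f1 p = 0) (pf1 : br p f1 = 0)
    (usucc : ∀ k, k + 2 < n → k + 2 ≤ n - 2 → U (k + 2 + 1) = br (g k) f1)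
    (uend : ∀ k, k + 2 < n → ¬ k + 2 ≤ n - 2 → br (g k) f1 = 0)
    (lgf : ∀ k, br f1 (g k) = - br (g k) f1)
    (pp : br p p = 0) (pg : ∀ k, br p (g k) = 0) (gp : ∀ k, br (g k) p = 0)
    (gg : ∀ k l, br (g k) (g l) = 0)
    (A1 : br f1 x1 = (1 : ℂ) • f1) (A2 : br p x1 = (2 * 1 : ℂ) • p)
    (A3 : ∀ k : ℕ, br (g k) x1 = (0 + k * 1 : ℂ) • g k)
    (A4 : br x1 f1 = -((1 : ℂ) • f1)) (A5 : br x1 p = 0)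
    (A6 : ∀ k : ℕ, br x1 (g k) = -((0 + k * 1 : ℂ) • g k))
    (B1 : br f1 x2 = (0 : ℂ) • f1) (B2 : br p x2 = (2 * 0 : ℂ) • p)
    (B3 : ∀ k : ℕ, br (g k) x2 = (1 + k * 0 : ℂ) • g k)
    (B4 : br x2 f1 = -((0 : ℂ) • f1)) (B5 : br x2 p = 0)
    (B6 : ∀ k : ℕ, br x2 (g k) = -((1 + k * 0 : ℂ) • g k))
    (X11 : br x1 x1 = 0) (X12 : br x1 x2 = 0) (X21 : br x2 x1 = 0) (X22 : br x2 x2 = 0)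
    (i j : ℕ) (hi : i < n + 2) (hj : j < n + 2) : br (U i) (U j) = tb n U i j := by
  have cls : ∀ i < n + 2, i = 0 ∨ i = 1 ∨ (∃ k, i = k + 2 ∧ k + 2 < n) ∨ i = n ∨ i = n + 1 := by
    intro i hi
    by_cases h : 2 ≤ i ∧ i < n
    · exact Or.inr (Or.inr (Or.inl ⟨i - 2, by omega, by omega⟩))
    · omega
  unfold tb
  rcases cls i hi with rfl | rfl | ⟨k, rfl, hk⟩ | rfl | rfl <;>
  rcases cls j hj with rfl | rfl | ⟨l, rfl, hl⟩ | hj' | hj'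
  all_goals try subst hj'
  all_goals try rw [u0]
  all_goals try rw [u1]
  all_goals try rw [um k hk]
  all_goals try rw [um l hl]
  all_goals try rw [un]
  all_goals try rw [un1]
  all_goals try simp only [f11, f1p, pf1, lgf, pp, pg, gp, gg, A1, A2, A3, A4, A5, A6,
    B1, B2, B3, B4, B5, B6, X11, X12, X21, X22, true_and, if_true]
  all_goals try split_ifs
  all_goals first
    | (exfalso; omega)
    | (rename_i hh; exact hh.1.elim)
    | rfl
    | (rw [usucc _ (by assumption) (by omega)]; done)
    | (rw [uend _ (by assumption) (by omega)]; done)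
    | (rw [uend _ (by assumption) (by omega), neg_zero])
    | (push_cast; module)
    | (obtain rfl : k = 0 := by omega
       push_cast; module)
    | (obtain rfl : l = 0 := by omega
       push_cast; module)

lemma final (H : HD n br N h c) (hL : IsLeibniz br) (hR : IsNilradical br N)
    (hs : IsSolvableSub br (⊤ : Submodule ℂ L)) [FiniteDimensional ℂ L]
    (hLn : finrank ℂ L = n + 2) (hNn : finrank ℂ N = n) :
    ∃ v : Fin (n + 2) → L,
        LinearIndependent ℂ v ∧ Submodule.span ℂ (Set.range v) = ⊤ ∧
        ∀ i j : Fin (n + 2), br (v i) (v j) = table18 n v i j := by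
  have hn := H.hn
  have hI := hR.1
  have hD := H.der_le hL hR hs
  have hz := H.hz
  -- existence of elements with prescribed weights
  have surj : ∀ a b : ℂ, ∃ x : L, c 0 (br (h 0) x) = a ∧ c 1 (br (h 1) x) = b := by
    let AB : L →ₗ[ℂ] ℂ × ℂ := ((c 0).comp (br (h 0))).prod ((c 1).comp (br (h 1)))
    have hk : LinearMap.ker AB = N := by
      apply le_antisymm
      · intro y hy
        rw [LinearMap.mem_ker] at hy
        exact H.ker_le hL hR hs y (congrArg Prod.fst hy) (congrArg Prod.snd hy)
      · intro y hy
        rw [LinearMap.mem_ker]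
        exact Prod.ext (H.kerN y hy).1 (H.kerN y hy).2
    have hr := LinearMap.finrank_range_add_finrank_ker AB
    rw [hk, hNn, hLn] at hr
    have : LinearMap.range AB = ⊤ := by
      apply Submodule.eq_top_of_finrank_eq
      rw [Module.finrank_prod, Module.finrank_self]
      omega
    intro a b
    obtain ⟨x, hx⟩ := LinearMap.range_eq_top.1 this (a, b)
    exact ⟨x, congrArg Prod.fst hx, congrArg Prod.snd hx⟩
  obtain ⟨t, ta, tb'⟩ := surj 1 3
  have hT : ∀ k, (br.flip t) (h k) - Wt n 1 3 k • h k ∈ Fl h (k + 1) := by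
    intro k
    have := H.tri hL hI t k
    rwa [ta, tb'] at this
  have hTF : ∀ k, ∀ y ∈ Fl h k, (br.flip t) y ∈ Fl h k := fun k => H.stab hL hI t k
  have inj := fun lam => flag_inj hz c H.hc H.cF (br.flip t) _ hT hTF lam
  have srj := fun lam => flag_surj hz (br.flip t) _ hT lam
  -- elements of the kernel of the right multiplication by `t`
  have surj0 : ∀ a b : ℂ, ∃ x : L, br x t = 0 ∧ c 0 (br (h 0) x) = a ∧
      c 1 (br (h 1) x) = b := by
    intro a b
    obtain ⟨x, xa, xb⟩ := surj a b
    have hx : br x t ∈ Fl h 0 := by rw [← H.hN]; exact hD x t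
    obtain ⟨m, hm, e⟩ := srj 0 n 0 (by omega) (fun j _ _ => (Wt_ne n j).1) _ hx
    rw [zero_smul, sub_zero, LinearMap.flip_apply] at e
    rw [← H.hN] at hm
    have hk := H.kerN m hm
    refine ⟨x - m, ?_, ?_, ?_⟩
    · rw [map_sub, LinearMap.sub_apply, e, sub_self]
    · rw [map_sub, map_sub, hk.1, xa, sub_zero]
    · rw [map_sub, map_sub, hk.2, xb, sub_zero]
  -- eigenvectors
  obtain ⟨m, hm, em⟩ := srj 1 n 1 (by omega) (fun j hj _ => (Wt_ne n j).2.1 hj)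
    _ (Submodule.neg_mem _ (hT 0))
  obtain ⟨m', hm', em'⟩ := srj 3 n 2 (by omega) (fun j hj _ => (Wt_ne n j).2.2 hj)
    _ (Submodule.neg_mem _ (hT 1))
  rw [Wt0, LinearMap.flip_apply, LinearMap.flip_apply, one_smul] at em
  rw [Wt1 n hn, LinearMap.flip_apply, LinearMap.flip_apply] at em'
  obtain ⟨f1, hf1⟩ : ∃ f1, f1 = h 0 + m := ⟨_, rfl⟩
  obtain ⟨f3, hf3⟩ : ∃ f3, f3 = h 1 + m' := ⟨_, rfl⟩
  have f1t : br f1 t = f1 := by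
    rw [hf1, map_add, LinearMap.add_apply]
    linear_combination (norm := module) em
  have f3t : br f3 t = (3 : ℂ) • f3 := by
    rw [hf3, map_add, LinearMap.add_apply]
    linear_combination (norm := module) em'
  have hm'1 : m' ∈ Fl h 1 := Fl_anti h (by omega) hm'
  have f3F : f3 ∈ Fl h 1 := by
    rw [hf3]; exact Submodule.add_mem _ (mem_Fl h le_rfl) hm'1
  have c0f1 : c 0 f1 = 1 := by
    rw [hf1, map_add, H.hc 0 (by omega), H.cF 0 (by omega) _ hm]; simp
  have c1f3 : c 1 f3 = 1 := by
    rw [hf3, map_add, H.hc 1 (by omega), H.cF 1 (by omega) _ hm']; simp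
  have U0 : ∀ y ∈ N, br y t = 0 → y = 0 := by
    intro y hy hyt
    rw [H.hN] at hy
    exact inj 0 n 0 (by omega) (fun j _ _ => (Wt_ne n j).1) y hy
      (by rw [LinearMap.flip_apply, hyt, zero_smul])
  have U1 : ∀ y ∈ N, br y t = y → ∃ a : ℂ, y = a • f1 := by
    intro y hy hyt
    rw [H.hN] at hy
    obtain ⟨a, r, hr, e⟩ := Fl_dec h hy
    refine ⟨a, sub_eq_zero.1 ?_⟩
    apply inj 1 n 1 (by omega) (fun j hj _ => (Wt_ne n j).2.1 hj)
    · have : y - a • f1 = r - a • m := by rw [e, hf1]; module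
      rw [this]
      exact Submodule.sub_mem _ hr (Submodule.smul_mem _ _ hm)
    · rw [LinearMap.flip_apply, map_sub, map_smul, LinearMap.sub_apply, LinearMap.smul_apply,
        hyt, f1t, one_smul]
  have U3 : ∀ y ∈ N, br y t = (3 : ℂ) • y → ∃ a : ℂ, y = a • f3 := by
    intro y hy hyt
    rw [H.hN] at hy
    obtain ⟨a, r, hr, e⟩ := Fl_dec h hy
    have ha : a = 0 := by
      have e1 := congrArg (c 0) hyt
      rw [e, map_add, map_smul, LinearMap.add_apply, LinearMap.smul_apply, map_add, map_smul, ta,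
        H.cF 0 (by omega) _ (H.stab hL hI t _ _ hr), map_smul, map_add, map_smul,
        H.hc 0 (by omega), H.cF 0 (by omega) _ hr] at e1
      simp at e1
      linear_combination (-1 / 2) * e1
    rw [ha, zero_smul, zero_add] at e
    subst e
    obtain ⟨b, s, hs, e⟩ := Fl_dec h hr
    refine ⟨b, sub_eq_zero.1 ?_⟩
    apply inj 3 n 2 (by omega) (fun j hj _ => (Wt_ne n j).2.2 hj)
    · have : y - b • f3 = s - b • m' := by rw [e, hf3]; module
      rw [this]
      exact Submodule.sub_mem _ hs (Submodule.smul_mem _ _ hm')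
    · rw [LinearMap.flip_apply, map_sub, map_smul, LinearMap.sub_apply, LinearMap.smul_apply,
        hyt, f3t]
      module
  -- products in the nilradical
  have rf1 : ∀ y ∈ Fl h 1, br y f1 = br y (h 0) := by
    intro y hy
    rw [hf1, map_add, H.abel1 hy hm, add_zero]
  have lf1 : ∀ y ∈ Fl h 1, br f1 y = - br y f1 := by
    intro y hy
    rw [rf1 y hy, hf1, map_add, LinearMap.add_apply, H.abel1 hm hy, add_zero, H.anti hy]
  obtain ⟨p, hp⟩ : ∃ p, p = h (n - 1) := ⟨_, rfl⟩
  have pF : p ∈ Fl h 1 := by rw [hp]; exact mem_Fl h (by omega)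
  have f11 : br f1 f1 = p := by
    have e1 : br (h 0) m = - br m (h 0) := H.anti hm
    rw [hf1, map_add, map_add, LinearMap.add_apply, LinearMap.add_apply, H.abel1 hm hm, H.b00, e1,
      hp]
    abel
  have pf1 : br p f1 = 0 := by rw [rf1 p pF, hp, H.b10' _ (by omega)]
  have f1p : br f1 p = 0 := by rw [lf1 p pF, pf1, neg_zero]
  obtain ⟨g, hg⟩ : ∃ g, g = chain br f1 f3 := ⟨_, rfl⟩
  have g0 : g 0 = f3 := by rw [hg]; rfl
  have gs : ∀ k, g (k + 1) = br (g k) f1 := by intro k; rw [hg]; rfl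
  have gF : ∀ k, g k ∈ Fl h 1 := by
    intro k
    induction k with
    | zero => rw [g0]; exact f3F
    | succ k ih =>
      rw [gs, rf1 _ ih]
      exact Fl_anti h (by omega) (H.shift le_rfl ih)
  have gh : ∀ k, k + 2 < n → g k - h (k + 1) ∈ Fl h (k + 2) := by
    intro k
    induction k with
    | zero =>
      intro _
      have : g 0 - h (0 + 1) = m' := by rw [g0, hf3]; simp
      rw [this]; exact hm'
    | succ k ih =>
      intro hk
      have := H.shift (by omega) (ih (by omega))
      rw [map_sub, LinearMap.sub_apply, H.b10 (k + 1) (by omega) (by omega),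
        ← rf1 _ (gF k), ← gs] at this
      exact this
  have gend : g (n - 2) = 0 := by
    obtain ⟨k, rfl⟩ : ∃ k, n = k + 3 := ⟨n - 3, by omega⟩
    have := H.shift (by omega) (gh k (by omega))
    rw [map_sub, LinearMap.sub_apply, H.b10' (k + 1) (by omega), ← rf1 _ (gF k), ← gs,
      Fl_bot hz (by omega), Submodule.mem_bot, sub_zero] at this
    exact this
  have pne : ∀ a b : ℂ, a • p = b • p → a = b := by
    intro a b e
    have := congrArg (c (n - 1)) e
    rw [hp, map_smul, map_smul, H.hc _ (by omega)] at this
    simpa using this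
  have g1ne : ∀ a b : ℂ, a • g 1 = b • g 1 → a = b := by
    intro a b e
    have h1 : c 2 (g 1) = 1 := by
      have := H.cF 2 (by omega) _ (gh 1 (by omega))
      rw [map_sub, H.hc 2 (by omega)] at this
      simpa [sub_eq_zero] using this
    have := congrArg (c 2) e
    rw [map_smul, map_smul, h1] at this
    simpa using this
  -- the action of the torus
  have act : ∀ a b : ℂ, ∀ x, br x t = 0 → c 0 (br (h 0) x) = a → c 1 (br (h 1) x) = b →
      br f1 x = a • f1 ∧ br p x = (2 * a) • p ∧ (∀ k : ℕ, br (g k) x = (b + k * a) • g k) ∧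
      br x f1 = -(a • f1) ∧ br x p = 0 ∧ (∀ k : ℕ, br x (g k) = -((b + k * a) • g k)) := by
    intro a b x hx xa xb
    have comm : ∀ y, br (br y x) t = br (br y t) x := by
      intro y; rw [hL y x t, hx]; simp
    have comm' : ∀ y, br (br x y) t = br x (br y t) := by
      intro y; rw [hL x y t, hx]; simp
    have r1 : br f1 x = a • f1 := by
      obtain ⟨q, hq⟩ := U1 _ (hD f1 x) (by rw [comm, f1t])
      have e := congrArg (c 0) hq
      rw [map_smul, c0f1, hf1, map_add, LinearMap.add_apply, map_add, xa,
        H.cF 0 (by omega) _ (H.stab hL hI x _ _ hm)] at e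
      rw [hq]; simp at e; rw [e]
    have r3 : br f3 x = b • f3 := by
      obtain ⟨q, hq⟩ := U3 _ (hD f3 x) (by rw [comm, f3t, map_smul, LinearMap.smul_apply])
      have e := congrArg (c 1) hq
      rw [map_smul, c1f3, hf3, map_add, LinearMap.add_apply, map_add, xb,
        H.cF 1 (by omega) _ (H.stab hL hI x _ _ hm')] at e
      rw [hq]; simp at e; rw [e]
    have rp : br p x = (2 * a) • p := by
      rw [← f11, hL f1 f1 x, r1, map_smul, map_smul, LinearMap.smul_apply, f11]; module
    have rg : ∀ k : ℕ, br (g k) x = (b + k * a) • g k := by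
      intro k
      induction k with
      | zero => rw [g0, r3]; simp
      | succ k ih =>
        rw [gs, hL (g k) f1 x, ih, r1, map_smul, map_smul, LinearMap.smul_apply]
        push_cast; module
    have l1 : br x f1 = -(a • f1) := by
      obtain ⟨q, hq⟩ := U1 _ (hD x f1) (by rw [comm', f1t])
      have i := hL f1 x f1
      rw [hq, r1, f11, rp, map_smul, map_smul, LinearMap.smul_apply, f11] at i
      have : q = -a := by
        apply pne
        linear_combination (norm := module) -i
      rw [hq, this, neg_smul]
    have l3 : br x f3 = -(b • f3) := by
      obtain ⟨q, hq⟩ := U3 _ (hD x f3) (by rw [comm', f3t, map_smul])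
      have i := hL f1 x f3
      have e31 : br f1 f3 = - g 1 := by rw [lf1 _ f3F, gs, g0]
      have rg1 := rg 1
      rw [hq, r1, map_smul, map_smul, LinearMap.smul_apply, e31, map_neg, LinearMap.neg_apply,
        rg1] at i
      have : q = -b := by
        apply g1ne
        push_cast at i
        linear_combination (norm := module) i
      rw [hq, this, neg_smul]
    have lp : br x p = 0 := by
      have i := hL x f1 f1
      rw [f11] at i
      exact left_eq_add.1 i
    have lg : ∀ k : ℕ, br x (g k) = -((b + k * a) • g k) := by
      intro k
      induction k with
      | zero => rw [g0, l3]; simp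
      | succ k ih =>
        have i := hL x (g k) f1
        rw [← gs, ih, l1] at i
        have e : br f1 (g k) = - g (k + 1) := by rw [lf1 _ (gF k), gs]
        rw [map_neg, map_neg, map_smul, map_smul, LinearMap.neg_apply, LinearMap.neg_apply,
          LinearMap.smul_apply, LinearMap.smul_apply, e, ← gs] at i
        push_cast
        linear_combination (norm := module) -i
    exact ⟨r1, rp, rg, l1, lp, lg⟩
  obtain ⟨x1, x1t, x1a, x1b⟩ := surj0 1 0
  obtain ⟨x2, x2t, x2a, x2b⟩ := surj0 0 1
  have xx : ∀ x y, br x t = 0 → br y t = 0 → br x y = 0 := by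
    intro x y hx hy
    apply U0 _ (hD x y)
    rw [hL x y t, hx, hy]; simp
  obtain ⟨A1, A2, A3, A4, A5, A6⟩ := act 1 0 x1 x1t x1a x1b
  obtain ⟨B1, B2, B3, B4, B5, B6⟩ := act 0 1 x2 x2t x2a x2b
  obtain ⟨U, hU⟩ : ∃ U : ℕ → L, U = fun m => if m = 0 then f1 else if m = 1 then p else
    if m < n then g (m - 2) else if m = n then x1 else if m = n + 1 then x2 else 0 := ⟨_, rfl⟩
  have u0 : U 0 = f1 := by rw [hU]; simp
  have u1 : U 1 = p := by rw [hU]; simp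
  have um : ∀ k, k + 2 < n → U (k + 2) = g k := by intro k hk; rw [hU]; simp [hk]
  have un : U n = x1 := by
    rw [hU]; simp only []
    rw [if_neg (by omega), if_neg (by omega), if_neg (by omega), if_pos trivial]
  have un1 : U (n + 1) = x2 := by
    rw [hU]; simp only []
    rw [if_neg (by omega), if_neg (by omega), if_neg (by omega), if_neg (by omega), if_pos trivial]
  have hu : ∀ m, (if hm : m < n + 2 then (fun i : Fin (n + 2) => U i) ⟨m, hm⟩ else 0) = U m := by
    intro m
    by_cases hm : m < n + 2
    · rw [dif_pos hm]
    · rw [dif_neg hm, hU]; simp only []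
      rw [if_neg (by omega), if_neg (by omega), if_neg (by omega), if_neg (by omega),
        if_neg (by omega)]
  have hspan : Submodule.span ℂ (Set.range fun i : Fin (n + 2) => U i) = ⊤ := by
    obtain ⟨S, hS⟩ : ∃ S, S = Submodule.span ℂ (Set.range fun i : Fin (n + 2) => U i) :=
      ⟨_, rfl⟩
    rw [← hS]
    have mS : ∀ k, k < n + 2 → U k ∈ S := by
      intro k hk
      rw [hS]
      exact Submodule.subset_span ⟨⟨k, hk⟩, rfl⟩
    have FS : ∀ d k, n ≤ k + d → Fl h k ≤ S := by
      intro d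
      induction d with
      | zero => intro k hk; rw [Fl_bot hz (show n ≤ k from hk)]; exact bot_le
      | succ d ih =>
        intro k hk y hy
        have ih := ih (k + 1) (by omega)
        obtain ⟨a, r, hr, rfl⟩ := Fl_dec h hy
        refine Submodule.add_mem _ (Submodule.smul_mem _ _ ?_) (ih hr)
        rcases (by omega : k = 0 ∨ (1 ≤ k ∧ k + 1 < n) ∨ k = n - 1 ∨ n ≤ k)
          with rfl | hk' | rfl | hk'
        · have e : h 0 = U 0 - m := by rw [u0, hf1]; abel
          rw [e]
          exact Submodule.sub_mem _ (mS 0 (by omega)) (ih hm)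
        · obtain ⟨j, rfl⟩ : ∃ j, k = j + 1 := ⟨k - 1, by omega⟩
          have e : h (j + 1) = U (j + 2) - (g j - h (j + 1)) := by rw [um j (by omega)]; abel
          rw [e]
          exact Submodule.sub_mem _ (mS _ (by omega)) (ih (gh j (by omega)))
        · rw [← hp, ← u1]; exact mS 1 (by omega)
        · rw [hz k hk']; exact Submodule.zero_mem _
    rw [eq_top_iff]
    intro y _
    have hy : y - c 0 (br (h 0) y) • x1 - c 1 (br (h 1) y) • x2 ∈ N := by
      apply H.ker_le hL hR hs
      · simp only [map_sub, map_smul, x1a, x2a]; simp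
      · simp only [map_sub, map_smul, x1b, x2b]; simp
    rw [H.hN] at hy
    have hy := FS n 0 (by omega) hy
    have e : y = (y - c 0 (br (h 0) y) • x1 - c 1 (br (h 1) y) • x2) +
      (c 0 (br (h 0) y) • U n + c 1 (br (h 1) y) • U (n + 1)) := by rw [un, un1]; abel
    rw [e]
    exact Submodule.add_mem _ hy (Submodule.add_mem _ (Submodule.smul_mem _ _ (mS _ (by omega)))
      (Submodule.smul_mem _ _ (mS _ (by omega))))
  refine ⟨fun i => U i, ?_, hspan, ?_⟩
  · apply linearIndependent_of_top_le_span_of_card_eq_finrank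
    · rw [hspan]
    · rw [hLn, Fintype.card_fin]
  intro i j
  rw [table_eq n _ U hu]
  simp only []
  obtain ⟨i, hi⟩ := i
  obtain ⟨j, hj⟩ := j
  simp only []
  have usucc : ∀ k, k + 2 < n → k + 2 ≤ n - 2 → U (k + 2 + 1) = br (g k) f1 := by
    intro k _ hk
    rw [show k + 2 + 1 = (k + 1) + 2 by ring, um _ (by omega), gs]
  have uend : ∀ k, k + 2 < n → ¬ k + 2 ≤ n - 2 → br (g k) f1 = 0 := by
    intro k _ hk
    rw [← gs, show k + 1 = n - 2 by omega, gend]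
  have lgf : ∀ k, br f1 (g k) = - br (g k) f1 := fun k => lf1 _ (gF k)
  exact tb_check hn U g f1 p x1 x2 u0 u1 um un un1 f11 f1p pf1 usucc uend lgf
    (H.abel1 pF pF) (fun k => H.abel1 pF (gF k)) (fun k => H.abel1 (gF k) pF)
    (fun k l => H.abel1 (gF k) (gF l)) A1 A2 A3 A4 A5 A6 B1 B2 B3 B4 B5 B6
    (xx _ _ x1t x1t) (xx _ _ x1t x2t) (xx _ _ x2t x1t) (xx _ _ x2t x2t) i j hi hj

end HD

end PartTwo


section PartThree

/-- The order in which the basis of `L¹` is used: `e₁, e₃, …, eₙ, e₂`. -/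
def sig (n k : ℕ) : ℕ :=
  if k = 0 then 0 else if k + 1 < n then k + 1 else if k + 1 = n then 1 else n

lemma exists_HD {L : Type u} [AddCommGroup L] [Module ℂ L] (n : ℕ) (hn : 4 ≤ n)
    (brL1 : Bil (Fin n → ℂ))
    (hbrL1 : ∀ i j : Fin n, brL1 (Pi.single i 1) (Pi.single j 1) =
      tableL1 n (fun t => Pi.single t 1) i j) (br : Bil L) (N : Submodule ℂ L)
    (hiso : SubAlgIso brL1 ⊤ br N) :
    finrank ℂ N = n ∧ ∃ h c, HD n br N h c := by
  obtain ⟨φ, hinj, hrange, hmul⟩ := hiso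
  obtain ⟨Φ, hΦ⟩ : ∃ Φ : (Fin n → ℂ) →ₗ[ℂ] L, ∀ x, Φ x = φ ⟨x, Submodule.mem_top⟩ :=
    ⟨φ.comp (Submodule.topEquiv (R := ℂ) (M := Fin n → ℂ)).symm.toLinearMap, fun x => rfl⟩
  have Φinj : Function.Injective Φ := by
    intro x y hxy
    rw [hΦ, hΦ] at hxy
    exact congrArg Subtype.val (hinj hxy)
  have Φmul : ∀ x y, br (Φ x) (Φ y) = Φ (brL1 x y) := by
    intro x y
    rw [hΦ, hΦ, hΦ]
    exact (hmul ⟨x, Submodule.mem_top⟩ ⟨y, Submodule.mem_top⟩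
      ⟨brL1 x y, Submodule.mem_top⟩ rfl).symm
  have ΦN : LinearMap.range Φ = N := by
    apply SetLike.coe_injective
    rw [← hrange]
    ext z
    constructor
    · rintro ⟨x, rfl⟩; exact ⟨⟨x, Submodule.mem_top⟩, (hΦ x).symm⟩
    · rintro ⟨x, rfl⟩; exact ⟨x.1, hΦ x.1⟩
  have hfin : finrank ℂ N = n := by
    rw [← ΦN, LinearMap.finrank_range_of_inj Φinj, Module.finrank_fin_fun]
  refine ⟨hfin, ?_⟩
  obtain ⟨ψ, hψ⟩ := LinearMap.exists_leftInverse_of_injective Φ (LinearMap.ker_eq_bot.2 Φinj)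
  have hψ' : ∀ x, ψ (Φ x) = x := fun x => LinearMap.congr_fun hψ x
  obtain ⟨E, hE⟩ : ∃ E : ℕ → L, E = fun m =>
    if hm : m < n then Φ (Pi.single ⟨m, hm⟩ 1) else 0 := ⟨_, rfl⟩
  have E1 : ∀ m (hm : m < n), E m = Φ (Pi.single ⟨m, hm⟩ 1) := by
    intro m hm; rw [hE]; simp only []; rw [dif_pos hm]
  have E0 : ∀ m, n ≤ m → E m = 0 := by
    intro m hm; rw [hE]; simp only []; rw [dif_neg (by omega)]
  have EE : ∀ i j, i < n → j < n → br (E i) (E j) =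
      if j = 0 then (if i = 0 then E 1 else if 2 ≤ i ∧ i ≤ n - 2 then E (i + 1) else 0)
      else if i = 0 ∧ 2 ≤ j ∧ j ≤ n - 2 then - E (j + 1) else 0 := by
    intro i j hi hj
    rw [E1 i hi, E1 j hj, Φmul, hbrL1]
    unfold tableL1
    try simp only []
    split_ifs
    all_goals first
      | omega
      | exact map_zero Φ
      | (rw [map_neg, E1 _ (by omega)])
      | (rw [E1 _ (by omega)])
  have cl : ∀ k, ∃ c : L →ₗ[ℂ] ℂ, ∀ y, c y = cx (ψ y) k := by
    intro k
    exact ⟨{ toFun := fun y => cx (ψ y) k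
             map_add' := fun x y => by rw [map_add, cx_add]
             map_smul' := fun a x => by rw [map_smul, cx_smul]; rfl }, fun y => rfl⟩
  choose c0 hc0 using cl
  refine ⟨fun k => E (sig n k), fun k => c0 (sig n k), hn, ?_, ?_, ?_, ?_, ?_, ?_, ?_, ?_⟩
  · intro j hj
    apply E0
    unfold sig
    split_ifs <;> omega
  · try simp only []
    rw [show sig n 0 = 0 from rfl, EE 0 0 (by omega) (by omega), if_pos rfl, if_pos rfl]
    congr 1
    unfold sig
    split_ifs <;> omega
  · intro k hk hk2
    try simp only []
    rw [show sig n 0 = 0 from rfl, show sig n k = k + 1 by unfold sig; split_ifs <;> omega,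
      show sig n (k + 1) = k + 2 by unfold sig; split_ifs <;> omega,
      EE _ 0 (by omega) (by omega), if_pos rfl, if_neg (by omega), if_pos (by omega)]
  · intro k hk
    try simp only []
    rw [show sig n 0 = 0 from rfl]
    by_cases hk' : sig n k < n
    · rw [EE _ 0 hk' (by omega), if_pos rfl]
      have hs : sig n k = n - 1 ∨ sig n k = 1 ∨ sig n k = n := by
        unfold sig; split_ifs <;> omega
      rw [if_neg (by omega), if_neg (by omega)]
    · rw [E0 (sig n k) (by omega)]; simp
  · intro k hk
    try simp only []
    rw [show sig n 0 = 0 from rfl]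
    by_cases hk' : sig n k < n
    · rw [EE _ 0 hk' (by omega), EE 0 _ (by omega) hk']
      have : sig n k ≠ 0 := by unfold sig; split_ifs <;> omega
      by_cases h2 : 2 ≤ sig n k ∧ sig n k ≤ n - 2
      · simp [this, h2]
      · simp [this, h2]
    · rw [E0 (sig n k) (by omega)]; simp
  · intro i j hi hj
    try simp only []
    by_cases hi' : sig n i < n
    · by_cases hj' : sig n j < n
      · rw [EE _ _ hi' hj']
        have h1 : sig n i ≠ 0 := by unfold sig; split_ifs <;> omega
        have h2 : sig n j ≠ 0 := by unfold sig; split_ifs <;> omega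
        rw [if_neg h2, if_neg (fun h => h1 h.1)]
      · rw [E0 (sig n j) (by omega)]; simp
    · rw [E0 (sig n i) (by omega)]; simp
  · intro k hk j
    try simp only []
    rw [hc0]
    have hk' : sig n k < n := by unfold sig; split_ifs <;> omega
    by_cases hj : j < n
    · have hj' : sig n j < n := by unfold sig; split_ifs <;> omega
      rw [E1 _ hj', hψ', cx_single]
      have : sig n k = sig n j → k = j := by
        unfold sig; intro he; split_ifs at he <;> omega
      by_cases h : k = j
      · subst h; simp
      · have h3 : ¬ sig n k = sig n j := fun h' => h (this h')
        rw [if_neg h, if_neg (by first | exact h3 | exact fun h' => h3 h'.symm)]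
    · have hj' : n ≤ sig n j := by unfold sig; split_ifs <;> omega
      rw [E0 _ hj', map_zero, if_neg (by omega)]
      unfold cx; split_ifs <;> rfl
  · apply le_antisymm
    · rw [← ΦN]
      rintro _ ⟨x, rfl⟩
      rw [← Finset.univ_sum_single x, map_sum]
      apply Submodule.sum_mem
      intro i _
      have e : (Pi.single i (x i) : Fin n → ℂ) = x i • Pi.single i 1 := by
        rw [← Pi.single_smul, smul_eq_mul, mul_one]
      rw [e, map_smul]
      apply Submodule.smul_mem
      have e2 : ∃ k, sig n k = i.1 := by
        have := i.2
        by_cases h0 : i.1 = 0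
        · exact ⟨0, by rw [h0]; rfl⟩
        by_cases h1 : i.1 = 1
        · exact ⟨n - 1, by unfold sig; split_ifs <;> omega⟩
        · exact ⟨i.1 - 1, by unfold sig; split_ifs <;> omega⟩
      obtain ⟨k, hk⟩ := e2
      have := mem_Fl (fun k => E (sig n k)) (Nat.zero_le k)
      try simp only [] at this
      rw [hk, E1 _ i.2] at this
      exact this
    · apply Fl_le
      intro j _
      try simp only []
      by_cases hj : sig n j < n
      · rw [E1 _ hj, ← ΦN]; exact ⟨_, rfl⟩
      · rw [E0 _ (by omega)]; exact Submodule.zero_mem _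

end PartThree

/-- Theorem 5.2 / Example 5.1. Up to isomorphism there is exactly one
indecomposable `(n+2)`-dimensional solvable Leibniz algebra with nilradical `L¹`
(`n ≥ 4`): such an algebra exists, and every such algebra admits a basis realizing the
table of `q_{n+2,1}` (hence any two of them are isomorphic). -/
theorem stmt18 (n : ℕ) (hn : 4 ≤ n)
    (brL1 : Bil (Fin n → ℂ))
    (hbrL1 : ∀ i j : Fin n, brL1 (Pi.single i 1) (Pi.single j 1) =
      tableL1 n (fun t => Pi.single t 1) i j) :
    (∃ brq : Bil (Fin (n + 2) → ℂ),
      (∀ i j : Fin (n + 2), brq (Pi.single i 1) (Pi.single j 1) =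
        table18 n (fun t => Pi.single t 1) i j) ∧
      IsLeibniz brq ∧ IsSolvableSub brq ⊤ ∧ ¬ IsSplitIn brq ⊤ ∧
      ∃ M, IsNilradical brq M ∧ SubAlgIso brL1 ⊤ brq M) ∧
    (∀ (L : Type u) [AddCommGroup L] [Module ℂ L] [FiniteDimensional ℂ L]
      (br : Bil L), IsLeibniz br → IsSolvableSub br (⊤ : Submodule ℂ L) →
      ¬ IsSplitIn br (⊤ : Submodule ℂ L) → finrank ℂ L = n + 2 →
      (∃ N, IsNilradical br N ∧ SubAlgIso brL1 ⊤ br N) →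
      ∃ v : Fin (n + 2) → L,
        LinearIndependent ℂ v ∧ Submodule.span ℂ (Set.range v) = ⊤ ∧
        ∀ i j : Fin (n + 2), br (v i) (v j) = table18 n v i j) := by
  refine ⟨⟨brQ n, brQ_table n hn, brQ_leibniz n hn, brQ_solvable n hn, brQ_nosplit n hn, MQ n,
    ⟨MQ_ideal n hn, MQ_nilp n hn, MQ_max n hn⟩, brQ_iso n hn brL1 hbrL1⟩, ?_⟩
  intro L _ _ _ br hL hs _ hLn hN
  obtain ⟨N, hR, hiso⟩ := hN
  obtain ⟨hNn, h, c, H⟩ := exists_HD n hn brL1 hbrL1 br N hiso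
  exact H.final hL hR hs hLn hNn
end
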